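/- arXiv:2312.12886 — 2 statements merged into one kernel-verified Lean document; each statement's English description precedes it below -/
import Mathlib

section
/- (Compactness of the nonlocal terms, Lemma 4.1, exponential kernel.) Let T > 0, let V : ℝ → ℝ be locally Lipschitz and nondecreasing, let q₀ ∈ L^∞(ℝ) have bounded total variation, and for each η > 0 let q_η be the unique weak solution of the nonlocal conservation law with exponential kernel γ_η and initial datum q₀. Then there exists ε > 0 such that for every sequence (η_k)_{k∈ℕ} ⊂ (0,ε) there exist a subsequence (η_{k_j}) and a function W* ∈ C([0,T];L¹_loc(ℝ)) with lim_{j→∞} sup_{t∈[0,T]} ‖W[q_{η_{k_j}},γ_{η_{k_j}}](t,·) − W*(t,·)‖_{L¹(K)} = 0 for every compact set K ⊂ ℝ; that is, the family {W[q_η,γ_η] : η ∈ (0,ε)} is relatively compact in C([0,T];L¹_loc(ℝ)). -/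
open MeasureTheory Set Filter Function

noncomputable section

/-- The nonlocal term `W[q,γ](t,x) = ∫_{-∞}^x γ(y-x) |q(t,y)| dy`. -/
def nonlocalTerm (γ : ℝ → ℝ) (q : ℝ → ℝ → ℝ) (t x : ℝ) : ℝ :=
  ∫ y in Iic x, γ (y - x) * |q t y|

/-- The exponential kernel `γ_η(x) = exp(x/η)/η`. -/
def expKernel (η : ℝ) (x : ℝ) : ℝ := Real.exp (x / η) / η

/-- An admissible kernel: nonnegative, nondecreasing, convex, of bounded variation,
and of unit mass on `(-∞, 0]`. -/
structure AdmissibleKernel (γ : ℝ → ℝ) : Prop where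
  nonneg : ∀ x ≤ (0:ℝ), 0 ≤ γ x
  mono : MonotoneOn γ (Iic (0:ℝ))
  convex : ConvexOn ℝ (Iic (0:ℝ)) γ
  bv : BoundedVariationOn γ (Iic (0:ℝ))
  mass : (∫ x in Iic (0:ℝ), γ x) = 1

/-- A test function in `C¹_c([0,T) × ℝ)`. -/
structure IsTestFun (T : ℝ) (φ : ℝ → ℝ → ℝ) : Prop where
  smooth : ContDiff ℝ 1 (uncurry φ)
  compSupp : HasCompactSupport (uncurry φ)
  vanish : ∀ t x : ℝ, T ≤ t → φ t x = 0

/-- Membership in `C([0,T]; L¹_loc(ℝ)) ∩ L^∞(Ω_T)`. -/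
structure InSolutionClass (T : ℝ) (q : ℝ → ℝ → ℝ) : Prop where
  meas : Measurable (uncurry q)
  bdd : ∃ M : ℝ, ∀ t x : ℝ, |q t x| ≤ M
  timeCont : ∀ s ∈ Icc (0:ℝ) T, ∀ K : Set ℝ, IsCompact K →
    Tendsto (fun t => ∫ x in K, |q t x - q s x|) (nhdsWithin s (Icc (0:ℝ) T)) (nhds 0)

/-- Weak solution of the nonlocal conservation law
`∂ₜ q + ∂ₓ (V(W[q,γ]) q) = 0`, `q(0,·) = q₀`. -/
def IsWeakSolutionNonlocal (T : ℝ) (V γ q₀ : ℝ → ℝ) (q : ℝ → ℝ → ℝ) : Prop :=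
  ∀ φ : ℝ → ℝ → ℝ, IsTestFun T φ →
    (∫ t in Ioo (0:ℝ) T, ∫ x : ℝ, q t x *
        (deriv (fun s => φ s x) t + deriv (fun y => φ t y) x * V (nonlocalTerm γ q t x)))
      + (∫ x : ℝ, φ 0 x * q₀ x) = 0

/-- Strong solution: Lipschitz on `[0,T] × ℝ` and the PDE holds pointwise a.e. in `Ω_T`. -/
def IsStrongSolutionNonlocal (T : ℝ) (V γ q₀ : ℝ → ℝ) (q : ℝ → ℝ → ℝ) : Prop :=
  (∃ L : NNReal, LipschitzOnWith L (uncurry q) (Icc (0:ℝ) T ×ˢ (univ : Set ℝ))) ∧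
  (∀ x : ℝ, q 0 x = q₀ x) ∧
  (∀ᵐ p : ℝ × ℝ ∂(volume.restrict (Ioo (0:ℝ) T ×ˢ (univ : Set ℝ))),
    deriv (fun s => q s p.2) p.1
      + deriv (fun y => V (nonlocalTerm γ q p.1 y) * q p.1 y) p.2 = 0)

/-- The entropy functional `ℰ[φ,α,q]` (with entropy flux `β`). -/
def entropyE (T : ℝ) (q₀ : ℝ → ℝ) (α β : ℝ → ℝ) (φ : ℝ → ℝ → ℝ) (q : ℝ → ℝ → ℝ) : ℝ :=
  (∫ t in Ioo (0:ℝ) T, ∫ x : ℝ,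
      α (q t x) * deriv (fun s => φ s x) t + β (q t x) * deriv (fun y => φ t y) x)
    + ∫ x : ℝ, α (q₀ x) * φ 0 x

/-- Weak solution of the local conservation law `∂ₜ q + ∂ₓ (V(|q|) q) = 0`. -/
def IsWeakSolutionLocal (T : ℝ) (V q₀ : ℝ → ℝ) (q : ℝ → ℝ → ℝ) : Prop :=
  ∀ φ : ℝ → ℝ → ℝ, IsTestFun T φ →
    (∫ t in Ioo (0:ℝ) T, ∫ x : ℝ, q t x *
        (deriv (fun s => φ s x) t + deriv (fun y => φ t y) x * V |q t x|))
      + (∫ x : ℝ, φ 0 x * q₀ x) = 0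

/-- Entropy solution of the local conservation law. -/
def IsEntropySolutionLocal (T : ℝ) (V q₀ : ℝ → ℝ) (q : ℝ → ℝ → ℝ) : Prop :=
  ∀ α β : ℝ → ℝ, ContDiff ℝ 2 α → ConvexOn ℝ univ α → ContDiff ℝ 1 β →
    (∀ x : ℝ, deriv β x = deriv α x * deriv (fun y => y * V |y|) x) →
    ∀ φ : ℝ → ℝ → ℝ, IsTestFun T φ → (∀ t x : ℝ, 0 ≤ φ t x) →
      0 ≤ entropyE T q₀ α β φ q


/-- The exponential average `∫₀^∞ exp(-r) f(x - η r) dr`. -/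
def expAvg (η : ℝ) (f : ℝ → ℝ) (x : ℝ) : ℝ :=
  ∫ r in Ioi (0:ℝ), Real.exp (-r) * f (x - η * r)

theorem integrableOn_expAvg {f : ℝ → ℝ} {M : ℝ} (hf : Measurable f) (hM : ∀ x, |f x| ≤ M)
    (η x : ℝ) : IntegrableOn (fun r => Real.exp (-r) * f (x - η * r)) (Ioi 0) := by
  refine Integrable.mono' ((integrableOn_exp_neg_Ioi 0).mul_const M) (by fun_prop) ?_
  refine Eventually.of_forall fun r => ?_
  rw [Real.norm_eq_abs, abs_mul, Real.abs_exp]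
  exact mul_le_mul_of_nonneg_left (hM _) (Real.exp_pos _).le

theorem expAvg_mono {f g : ℝ → ℝ} {M N : ℝ} (hf : Measurable f) (hM : ∀ x, |f x| ≤ M)
    (hg : Measurable g) (hN : ∀ x, |g x| ≤ N) (hfg : ∀ x, f x ≤ g x) (η x : ℝ) :
    expAvg η f x ≤ expAvg η g x :=
  setIntegral_mono (integrableOn_expAvg hf hM η x) (integrableOn_expAvg hg hN η x)
    fun _ => mul_le_mul_of_nonneg_left (hfg _) (Real.exp_pos _).le

theorem expAvg_const (η c x : ℝ) : expAvg η (fun _ => c) x = c := by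
  simp only [expAvg, integral_mul_const, integral_exp_neg_Ioi_zero, one_mul]

theorem expAvg_nonneg {f : ℝ → ℝ} (hf : ∀ x, 0 ≤ f x) (η x : ℝ) : 0 ≤ expAvg η f x :=
  integral_nonneg fun _ => mul_nonneg (Real.exp_pos _).le (hf _)

theorem abs_expAvg_le {f : ℝ → ℝ} {M : ℝ} (hf : Measurable f) (hM : ∀ x, |f x| ≤ M) (η x : ℝ) :
    |expAvg η f x| ≤ M := by
  have hc : ∀ c : ℝ, ∀ _ : ℝ, |c| ≤ |c| := fun c _ => le_rfl
  refine abs_le.2 ⟨?_, ?_⟩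
  · have := expAvg_mono measurable_const (hc (-M)) hf hM (fun x => (abs_le.1 (hM x)).1) η x
    rwa [expAvg_const] at this
  · have := expAvg_mono hf hM measurable_const (hc M) (fun x => (abs_le.1 (hM x)).2) η x
    rwa [expAvg_const] at this

theorem expAvg_sub {f g : ℝ → ℝ} {M N : ℝ} (hf : Measurable f) (hM : ∀ x, |f x| ≤ M)
    (hg : Measurable g) (hN : ∀ x, |g x| ≤ N) (η x : ℝ) :
    expAvg η (fun y => f y - g y) x = expAvg η f x - expAvg η g x := by
  simp only [expAvg, mul_sub]
  exact integral_sub (integrableOn_expAvg hf hM η x) (integrableOn_expAvg hg hN η x)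

theorem expAvg_eq_integral_Iic {η : ℝ} (hη : 0 < η) (f : ℝ → ℝ) (x : ℝ) :
    expAvg η f x = ∫ y in Iic x, expKernel η (y - x) * f y := by
  rw [expAvg, ← integral_Ici_eq_integral_Ioi, ← integral_indicator measurableSet_Ici,
    ← integral_indicator measurableSet_Iic]
  set g := (Iic x).indicator (fun y => expKernel η (y - x) * f y) with hg
  rw [← integral_sub_left_eq_self g volume x]
  have h := Measure.integral_comp_mul_left (fun r => g (x - r)) η
  rw [abs_of_pos (inv_pos.2 hη), smul_eq_mul] at h
  have h2 : ∫ r, g (x - r) = η * ∫ r, g (x - η * r) := by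
    rw [h]; field_simp
  rw [h2, ← integral_const_mul]
  congr 1
  ext r
  by_cases hr : 0 ≤ r
  · have : x - η * r ∈ Iic x := by simp only [mem_Iic]; nlinarith
    rw [indicator_of_mem (show r ∈ Ici (0:ℝ) from hr), hg, indicator_of_mem this, expKernel]
    have e : (x - η * r - x) / η = -r := by field_simp; ring
    rw [e]; field_simp
  · have : x - η * r ∉ Iic x := by simp only [mem_Iic, not_le]; nlinarith
    rw [indicator_of_notMem (show r ∉ Ici (0:ℝ) from hr), hg, indicator_of_notMem this, mul_zero]

theorem integrableOn_exp_div_mul_Iic {f : ℝ → ℝ} {M η : ℝ} (hη : 0 < η) (hf : Measurable f)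
    (hM : ∀ x, |f x| ≤ M) (x : ℝ) :
    IntegrableOn (fun y => Real.exp (y / η) / η * f y) (Iic x) := by
  have h := integrableOn_exp_mul_Iic (a := η⁻¹) (by positivity) x
  refine Integrable.mono' ((h.div_const η).mul_const M) (by fun_prop) ?_
  refine Eventually.of_forall fun r => ?_
  rw [Real.norm_eq_abs, abs_mul, abs_of_pos (by positivity : 0 < Real.exp (r / η) / η),
    div_eq_inv_mul r η]
  exact mul_le_mul_of_nonneg_left (hM _) (by positivity)

theorem expAvg_eq_exp_mul {f : ℝ → ℝ} {M η : ℝ} (hη : 0 < η) (hf : Measurable f)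
    (hM : ∀ x, |f x| ≤ M) (c x : ℝ) :
    expAvg η f x = Real.exp ((c - x) / η) * expAvg η f c
      + ∫ y in c..x, Real.exp ((y - x) / η) / η * f y := by
  have h1 : ∀ x, expAvg η f x = Real.exp (-x / η) *
      ∫ y in Iic x, Real.exp (y / η) / η * f y := by
    intro x
    rw [expAvg_eq_integral_Iic hη, ← integral_const_mul]
    congr 1; ext y
    rw [expKernel, show (y - x) / η = -x / η + y / η by ring, Real.exp_add]; ring
  have h2 := intervalIntegral.integral_Iic_sub_Iic
    (integrableOn_exp_div_mul_Iic hη hf hM c) (integrableOn_exp_div_mul_Iic hη hf hM x)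
  have h3 : ∫ y in c..x, Real.exp ((y - x) / η) / η * f y
      = Real.exp (-x / η) * ∫ y in c..x, Real.exp (y / η) / η * f y := by
    rw [← intervalIntegral.integral_const_mul]
    congr 1; ext y
    rw [show (y - x) / η = -x / η + y / η by ring, Real.exp_add]; ring
  rw [h3, ← h2, h1 x, h1 c, ← mul_assoc, ← Real.exp_add,
    show (c - x) / η + -c / η = -x / η by ring]
  ring

theorem abs_expAvg_sub_le {f : ℝ → ℝ} {M η : ℝ} (hη : 0 < η) (hf : Measurable f)
    (hM : ∀ x, |f x| ≤ M) (x y : ℝ) :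
    |expAvg η f x - expAvg η f y| ≤ 2 * M / η * |x - y| := by
  wlog h : y ≤ x generalizing x y
  · rw [abs_sub_comm, abs_sub_comm x]; exact this y x (le_of_not_ge h)
  have hM0 : 0 ≤ M := (abs_nonneg _).trans (hM 0)
  rw [expAvg_eq_exp_mul hη hf hM y x, abs_of_nonneg (sub_nonneg.2 h)]
  have h1 : |∫ z in y..x, Real.exp ((z - x) / η) / η * f z| ≤ M / η * |x - y| := by
    rw [← Real.norm_eq_abs]
    refine intervalIntegral.norm_integral_le_of_norm_le_const fun z hz => ?_
    rw [uIoc_of_le h] at hz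
    rw [Real.norm_eq_abs, abs_mul, abs_of_pos (by positivity), div_mul_eq_mul_div]
    have : Real.exp ((z - x) / η) ≤ 1 :=
      Real.exp_le_one_iff.2 (div_nonpos_of_nonpos_of_nonneg (by linarith [hz.2]) hη.le)
    gcongr
    calc _ ≤ 1 * M := mul_le_mul this (hM z) (abs_nonneg _) zero_le_one
      _ = M := one_mul M
  have h2 : |(Real.exp ((y - x) / η) - 1) * expAvg η f y| ≤ (x - y) / η * M := by
    rw [abs_mul]
    refine mul_le_mul ?_ (abs_expAvg_le hf hM η y) (abs_nonneg _)
      (div_nonneg (sub_nonneg.2 h) hη.le)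
    rw [abs_le]
    constructor
    · have := Real.add_one_le_exp ((y - x) / η)
      have e : (y - x) / η = -((x - y) / η) := by ring
      linarith
    · have : Real.exp ((y - x) / η) ≤ 1 :=
        Real.exp_le_one_iff.2 (div_nonpos_of_nonpos_of_nonneg (by linarith) hη.le)
      have := div_nonneg (sub_nonneg.2 h) hη.le
      linarith
  rw [abs_of_nonneg (sub_nonneg.2 h)] at h1
  calc _ = |(Real.exp ((y - x) / η) - 1) * expAvg η f y
        + ∫ z in y..x, Real.exp ((z - x) / η) / η * f z| := by ring_nf
    _ ≤ _ := abs_add_le _ _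
    _ ≤ (x - y) / η * M + M / η * (x - y) := add_le_add h2 h1
    _ = _ := by ring

theorem lipschitzWith_expAvg {f : ℝ → ℝ} {M η : ℝ} (hη : 0 < η) (hf : Measurable f)
    (hM : ∀ x, |f x| ≤ M) : LipschitzWith (2 * M / η).toNNReal (expAvg η f) := by
  refine LipschitzWith.of_dist_le_mul fun x y => ?_
  have hM0 : 0 ≤ M := (abs_nonneg _).trans (hM 0)
  rw [Real.coe_toNNReal _ (by positivity), Real.dist_eq, Real.dist_eq]
  exact abs_expAvg_sub_le hη hf hM x y

theorem ae_hasDerivAt_expAvg {f : ℝ → ℝ} {M η : ℝ} (hη : 0 < η) (hf : Measurable f)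
    (hM : ∀ x, |f x| ≤ M) :
    ∀ᵐ x, HasDerivAt (expAvg η f) ((f x - expAvg η f x) / η) x := by
  have hM0 : 0 ≤ M := (abs_nonneg _).trans (hM 0)
  have hloc : LocallyIntegrable (fun y => Real.exp (y / η) / η * f y) volume := by
    intro x
    exact ⟨Iic (x + 1), Iic_mem_nhds (by linarith), integrableOn_exp_div_mul_Iic hη hf hM _⟩
  filter_upwards [LocallyIntegrable.ae_hasDerivAt_integral hloc] with x hx
  have h0 : expAvg η f = fun x => Real.exp (-x / η) *
      (expAvg η f 0 + ∫ y in (0:ℝ)..x, Real.exp (y / η) / η * f y) := by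
    ext x
    rw [expAvg_eq_exp_mul hη hf hM 0 x, mul_add, ← intervalIntegral.integral_const_mul, zero_sub]
    congr 2; ext y
    rw [show (y - x) / η = -x / η + y / η by ring, Real.exp_add]; ring
  have h1 : HasDerivAt (fun x : ℝ => Real.exp (-x / η)) (Real.exp (-x / η) * (-1 / η)) x :=
    ((hasDerivAt_neg x).div_const η).exp
  have h2 := h1.mul ((hx 0).const_add (expAvg η f 0))
  have h3 := congrFun h0 x
  have : Real.exp (-x / η) * (-1 / η) *
      (expAvg η f 0 + ∫ y in (0:ℝ)..x, Real.exp (y / η) / η * f y)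
      + Real.exp (-x / η) * (Real.exp (x / η) / η * f x) = (f x - expAvg η f x) / η := by
    have e : Real.exp (-x / η) * Real.exp (x / η) = 1 := by
      rw [← Real.exp_add, show -x / η + x / η = 0 by ring, Real.exp_zero]
    rw [h3]
    linear_combination (f x / η) * e
  rw [← this]
  exact h2.congr_of_eventuallyEq (Eventually.of_forall (congrFun h0))

/-- A bounded Lipschitz function with `D' = -D/η` almost everywhere vanishes. -/
theorem eq_zero_of_ae_hasDerivAt_neg_div {D : ℝ → ℝ} {η C : ℝ} {K : NNReal} (hη : 0 < η)
    (hK : LipschitzWith K D) (hC : ∀ x, |D x| ≤ C)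
    (hD : ∀ᵐ x, HasDerivAt D (-D x / η) x) (x : ℝ) : D x = 0 := by
  have hexp : ContDiff ℝ 1 (fun y : ℝ => Real.exp (y / η)) := by fun_prop
  have hconst : ∀ y ≤ x, Real.exp (x / η) * D x = Real.exp (y / η) * D y := by
    intro y hy
    have hac : AbsolutelyContinuousOnInterval (fun z => Real.exp (z / η) * D z) y x :=
      (hexp.contDiffOn.absolutelyContinuousOnInterval).mul
        (hK.lipschitzOnWith.absolutelyContinuousOnInterval)
    obtain ⟨c, hc⟩ := hac.const_of_ae_hasDerivAt_zero (by
      filter_upwards [hD] with z hz _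
      have := (((hasDerivAt_id z).div_const η).exp).mul hz
      convert! this using 1
      simp only [id]; field_simp; ring)
    rw [hc x right_mem_uIcc, hc y left_mem_uIcc]
  have hlim : Tendsto (fun y => Real.exp (y / η) * C) atBot (nhds 0) := by
    have : Tendsto (fun y : ℝ => y / η) atBot atBot := tendsto_id.atBot_div_const hη
    simpa using (Real.tendsto_exp_atBot.comp this).mul_const C
  have hle : |Real.exp (x / η) * D x| ≤ 0 := by
    refine ge_of_tendsto hlim ?_
    filter_upwards [eventually_le_atBot x] with y hy
    rw [hconst y hy, abs_mul, Real.abs_exp]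
    exact mul_le_mul_of_nonneg_left (hC y) (Real.exp_pos _).le
  have := abs_nonpos_iff.1 hle
  exact (mul_eq_zero.1 this).resolve_left (Real.exp_pos _).ne'

/-- The function `G(w) = w V(w) - ∫₀^w V`. -/
def fluxG (V : ℝ → ℝ) (w : ℝ) : ℝ := w * V w - ∫ s in (0:ℝ)..w, V s

theorem fluxG_sub {V : ℝ → ℝ} (hV : Continuous V) (a b : ℝ) :
    fluxG V b - fluxG V a = b * V b - a * V a - ∫ s in a..b, V s := by
  have := intervalIntegral.integral_interval_sub_left (hV.intervalIntegrable (μ := volume) 0 b)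
    (hV.intervalIntegrable 0 a)
  rw [fluxG, fluxG, ← this]; ring

theorem continuous_fluxG {V : ℝ → ℝ} (hV : Continuous V) : Continuous (fluxG V) :=
  (continuous_id.mul hV).sub
    (intervalIntegral.continuous_primitive (fun a b => hV.intervalIntegrable a b) 0)

theorem fluxG_mono {V : ℝ → ℝ} (hV : Continuous V) (hm : Monotone V) {a b : ℝ} (ha : 0 ≤ a)
    (hab : a ≤ b) : fluxG V a ≤ fluxG V b := by
  have h := fluxG_sub hV a b
  have h1 : ∫ s in a..b, V s ≤ ∫ _ in a..b, V b :=
    intervalIntegral.integral_mono_on hab (hV.intervalIntegrable a b) (by simp)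
      fun s hs => hm hs.2
  rw [intervalIntegral.integral_const, smul_eq_mul] at h1
  have := mul_nonneg ha (sub_nonneg.2 (hm hab))
  linarith

theorem fluxG_sub_le {V : ℝ → ℝ} (hV : Continuous V) (hm : Monotone V) {a b M : ℝ} {K : NNReal}
    (hK : LipschitzOnWith K V (Icc 0 M)) (ha : 0 ≤ a) (hab : a ≤ b) (hb : b ≤ M) :
    fluxG V b - fluxG V a ≤ M * K * (b - a) := by
  rw [fluxG_sub hV]
  have h1 : ∫ _ in a..b, V a ≤ ∫ s in a..b, V s :=
    intervalIntegral.integral_mono_on hab (by simp) (hV.intervalIntegrable a b)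
      fun s hs => hm hs.1
  rw [intervalIntegral.integral_const, smul_eq_mul] at h1
  have h2 := hK.dist_le_mul b ⟨ha.trans hab, hb⟩ a ⟨ha, hab.trans hb⟩
  rw [Real.dist_eq, Real.dist_eq, abs_of_nonneg (sub_nonneg.2 hab)] at h2
  have h3 := (le_abs_self _).trans h2
  have h4 : b * (V b - V a) ≤ M * (K * (b - a)) :=
    mul_le_mul hb h3 (sub_nonneg.2 (hm hab)) (ha.trans (hab.trans hb))
  linarith

theorem abs_le_of_monotone {V : ℝ → ℝ} (hm : Monotone V) {M w : ℝ} (hw : |w| ≤ M) :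
    |V w| ≤ max |V (-M)| |V M| := by
  have h := abs_le.1 hw
  exact abs_le_max_abs_abs (hm h.1) (hm h.2)

theorem abs_integral_sub_le_of_monotone {V : ℝ → ℝ} (hV : Continuous V) (hm : Monotone V)
    {M a b : ℝ} (ha : |a| ≤ M) (hb : |b| ≤ M) :
    |(∫ s in (0:ℝ)..a, V s) - ∫ s in (0:ℝ)..b, V s| ≤ max |V (-M)| |V M| * |a - b| := by
  rw [intervalIntegral.integral_interval_sub_left (hV.intervalIntegrable (μ := volume) 0 a)
    (hV.intervalIntegrable 0 b), ← Real.norm_eq_abs]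
  refine intervalIntegral.norm_integral_le_of_norm_le_const fun s hs => ?_
  refine abs_le_of_monotone hm ?_
  have h1 := abs_le.1 ha
  have h2 := abs_le.1 hb
  rw [uIoc, mem_Ioc] at hs
  exact abs_le.2 ⟨(le_min h2.1 h1.1).trans hs.1.le, hs.2.trans (max_le h2.2 h1.2)⟩

/-- The averaged flux `A[V(W) p]` with `W = A[p]` equals `∫₀^W V + A[G(W)]`. -/
theorem expAvg_mul_eq {V p : ℝ → ℝ} {η M : ℝ} (hη : 0 < η) (hV : Continuous V) (hm : Monotone V)
    (hp : Measurable p) (hM : ∀ x, |p x| ≤ M) (x : ℝ) :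
    expAvg η (fun y => V (expAvg η p y) * p y) x
      = (∫ s in (0:ℝ)..expAvg η p x, V s) + expAvg η (fun y => fluxG V (expAvg η p y)) x := by
  set W := expAvg η p with hW
  set C := max |V (-M)| |V M|
  have hC0 : 0 ≤ C := (abs_nonneg _).trans (le_max_left _ _)
  have hM0 : 0 ≤ M := (abs_nonneg _).trans (hM 0)
  have hWM : ∀ x, |W x| ≤ M := abs_expAvg_le hp hM η
  have hWc : Continuous W := (lipschitzWith_expAvg hη hp hM).continuous
  have hVW : ∀ x, |V (W x)| ≤ C := fun x => abs_le_of_monotone hm (hWM x)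
  have hΦ : ∀ x, |∫ s in (0:ℝ)..W x, V s| ≤ C * M := by
    intro x
    have := abs_integral_sub_le_of_monotone hV hm (hWM x) (b := 0) (by simpa using hM0)
    simp only [intervalIntegral.integral_same, sub_zero] at this
    exact this.trans (mul_le_mul_of_nonneg_left (hWM x) hC0)
  have hf1 : Measurable (fun y => V (W y) * p y) := (hV.comp hWc).measurable.mul hp
  have hb1 : ∀ y, |V (W y) * p y| ≤ C * M := fun y => by
    rw [abs_mul]; exact mul_le_mul (hVW y) (hM y) (abs_nonneg _) hC0
  have hf2 : Measurable (fun y => fluxG V (W y)) := ((continuous_fluxG hV).comp hWc).measurable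
  have hb2 : ∀ y, |fluxG V (W y)| ≤ M * C + C * M := fun y => by
    refine (abs_sub _ _).trans (add_le_add ?_ (hΦ y))
    rw [abs_mul]; exact mul_le_mul (hWM y) (hVW y) (abs_nonneg _) hM0
  have hL1 := lipschitzWith_expAvg hη hf1 hb1
  have hL2 := lipschitzWith_expAvg hη hf2 hb2
  have hLΦ : LipschitzWith (C.toNNReal * (2 * M / η).toNNReal) (fun x => ∫ s in (0:ℝ)..W x, V s) := by
    refine LipschitzWith.of_dist_le_mul fun x y => ?_
    have h1 := abs_integral_sub_le_of_monotone hV hm (hWM x) (hWM y)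
    rw [NNReal.coe_mul, Real.coe_toNNReal _ hC0, Real.coe_toNNReal _ (by positivity), mul_assoc]
    exact h1.trans (mul_le_mul_of_nonneg_left (abs_expAvg_sub_le hη hp hM x y) hC0)
  have key := eq_zero_of_ae_hasDerivAt_neg_div (C := C * M + C * M + (M * C + C * M)) hη
    ((hL1.sub hLΦ).sub hL2)
    (fun x => (abs_sub _ _).trans (add_le_add ((abs_sub _ _).trans
      (add_le_add (abs_expAvg_le hf1 hb1 η x) (hΦ x))) (abs_expAvg_le hf2 hb2 η x))) ?_ x
  · linarith
  · filter_upwards [ae_hasDerivAt_expAvg hη hp hM, ae_hasDerivAt_expAvg hη hf1 hb1,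
      ae_hasDerivAt_expAvg hη hf2 hb2] with x h1 h2 h3
    have h4 : HasDerivAt (fun u => ∫ s in (0:ℝ)..u, V s) (V (W x)) (W x) :=
      intervalIntegral.integral_hasDerivAt_right (hV.intervalIntegrable _ _)
        hV.stronglyMeasurable.stronglyMeasurableAtFilter hV.continuousAt
    have h5 := (h2.sub (h4.comp x h1)).sub h3
    refine h5.congr_deriv ?_
    simp only [← hW, fluxG]
    ring

/-- Fubini for the exponential average. -/
theorem intervalIntegral_expAvg {f : ℝ → ℝ} {M : ℝ} (hf : Measurable f)
    (hM : ∀ x, |f x| ≤ M) (η c d : ℝ) :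
    ∫ x in c..d, expAvg η f x
      = ∫ r in Ioi (0:ℝ), Real.exp (-r) * ∫ x in c..d, f (x - η * r) := by
  unfold expAvg
  rw [intervalIntegral_integral_swap]
  · simp only [intervalIntegral.integral_const_mul]
  · have : IsFiniteMeasure (volume.restrict (uIoc c d)) := by unfold uIoc; infer_instance
    have hd : Integrable (fun z : ℝ × ℝ => (1:ℝ) * (Real.exp (-z.2) * M))
        ((volume.restrict (uIoc c d)).prod (volume.restrict (Ioi 0))) :=
      (integrable_const (1:ℝ)).mul_prod ((integrableOn_exp_neg_Ioi 0).mul_const M)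
    refine hd.mono' (by unfold uncurry; fun_prop) (Eventually.of_forall fun z => ?_)
    simp only [uncurry, Real.norm_eq_abs, abs_mul, Real.abs_exp, one_mul]
    exact mul_le_mul_of_nonneg_left (hM _) (Real.exp_pos _).le

/-- The retraction of `ℝ` onto `[0, T]`. -/
def clampIcc (T t : ℝ) : ℝ := max 0 (min T t)

theorem continuous_clampIcc (T : ℝ) : Continuous (clampIcc T) := by unfold clampIcc; fun_prop

theorem clampIcc_mem {T : ℝ} (hT : 0 ≤ T) (t : ℝ) : clampIcc T t ∈ Icc 0 T :=
  ⟨le_max_left _ _, max_le hT (min_le_left _ _)⟩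

theorem clampIcc_of_mem {T t : ℝ} (ht : t ∈ Icc 0 T) : clampIcc T t = t := by
  rw [clampIcc, min_eq_right ht.2, max_eq_right ht.1]

theorem abs_clampIcc_sub_le (T s t : ℝ) : |clampIcc T t - clampIcc T s| ≤ |t - s| := by
  unfold clampIcc
  rw [max_comm, max_comm 0]
  exact (abs_max_sub_max_le_abs _ _ _).trans (by
    simpa using abs_min_sub_min_le_max T t T s)

section Flow

variable {v : ℝ → ℝ → ℝ} {T B : ℝ} {K : NNReal}

theorem exists_trajectory (hT : 0 < T) (hB : ∀ t x, |v t x| ≤ B) (hK : ∀ t, LipschitzWith K (v t))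
    (hc : ∀ x, Continuous fun t => v t x) {t₀ : ℝ} (ht₀ : t₀ ∈ Icc 0 T) (x₀ : ℝ) :
    ∃ Y : ℝ → ℝ, Y t₀ = x₀ ∧ ∀ t, HasDerivAt Y (v t (Y (clampIcc T t))) t := by
  have hB0 : 0 ≤ B := (abs_nonneg _).trans (hB 0 0)
  have hpl : IsPicardLindelof v (⟨t₀, ht₀⟩ : Icc 0 T) x₀ (B * T).toNNReal 0 B.toNNReal K :=
    { lipschitzOnWith := fun t _ => (hK t).lipschitzOnWith
      continuousOn := fun x _ => (hc x).continuousOn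
      norm_le := fun t _ x _ => by
        rw [Real.coe_toNNReal _ hB0]; exact hB t x
      mul_max_le := by
        rw [Real.coe_toNNReal _ hB0, Real.coe_toNNReal _ (by positivity), NNReal.coe_zero, sub_zero,
          sub_zero]
        refine mul_le_mul_of_nonneg_left (max_le ?_ ?_) hB0
        · linarith [ht₀.1]
        · linarith [ht₀.2] }
  obtain ⟨α, hα0, hα⟩ := hpl.exists_eq_forall_mem_Icc_hasDerivWithinAt₀
  have hαc : ContinuousOn α (Icc 0 T) := fun t ht => (hα t ht).continuousWithinAt
  have hvc : Continuous (uncurry v) :=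
    continuous_prod_of_continuous_lipschitzWith' (uncurry v) K hK hc
  have hαcl : Continuous fun s => α (clampIcc T s) :=
    hαc.comp_continuous (continuous_clampIcc T) (clampIcc_mem hT.le)
  have hg : Continuous fun s => v s (α (clampIcc T s)) := hvc.comp (continuous_id.prodMk hαcl)
  have heq : ∀ t ∈ Icc 0 T, x₀ + ∫ s in t₀..t, v s (α (clampIcc T s)) = α t := by
    intro t ht
    have hsub : uIcc t₀ t ⊆ Icc 0 T := uIcc_subset_Icc ht₀ ht
    have := intervalIntegral.integral_eq_sub_of_hasDeriv_right (hαc.mono hsub)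
      (f' := fun s => v s (α (clampIcc T s))) (fun s hs => ?_) (hg.intervalIntegrable _ _)
    · rw [this, show α t₀ = x₀ from hα0]; ring
    · have hs0 : 0 ≤ min t₀ t := le_min ht₀.1 ht.1
      have hsT : max t₀ t ≤ T := max_le ht₀.2 ht.2
      have hmem : s ∈ Ioo 0 T := ⟨hs0.trans_lt hs.1, hs.2.trans_le hsT⟩
      rw [clampIcc_of_mem (Ioo_subset_Icc_self hmem)]
      exact ((hα s (Ioo_subset_Icc_self hmem)).hasDerivAt
        (Icc_mem_nhds hmem.1 hmem.2)).hasDerivWithinAt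
  refine ⟨fun t => x₀ + ∫ s in t₀..t, v s (α (clampIcc T s)), by simp, fun t => ?_⟩
  simp only [heq _ (clampIcc_mem hT.le t)]
  exact (intervalIntegral.integral_hasDerivAt_right (hg.intervalIntegrable _ _)
    hg.stronglyMeasurable.stronglyMeasurableAtFilter hg.continuousAt).const_add x₀

theorem trajectory_unique (hK : ∀ t, LipschitzWith K (v t)) {Y Z : ℝ → ℝ}
    (hY : ∀ t, HasDerivAt Y (v t (Y (clampIcc T t))) t)
    (hZ : ∀ t, HasDerivAt Z (v t (Z (clampIcc T t))) t) {s t : ℝ} (hs : s ∈ Icc 0 T)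
    (ht : t ∈ Icc 0 T) (h : Y s = Z s) : Y t = Z t := by
  have hYc : Continuous Y := continuous_iff_continuousAt.2 fun t => (hY t).continuousAt
  have hZc : Continuous Z := continuous_iff_continuousAt.2 fun t => (hZ t).continuousAt
  have key : ∀ {Y : ℝ → ℝ}, (∀ t, HasDerivAt Y (v t (Y (clampIcc T t))) t) →
      ∀ r ∈ Icc 0 T, HasDerivAt Y (v r (Y r)) r := by
    intro Y hY r hr
    have := hY r
    rwa [clampIcc_of_mem hr] at this
  rcases le_total s t with hst | hst
  · exact ODE_solution_unique_of_mem_Icc_right (s := fun _ => univ)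
      (fun r _ => (hK r).lipschitzOnWith) hYc.continuousOn
      (fun r hr => (key hY r ⟨hs.1.trans hr.1, hr.2.le.trans ht.2⟩).hasDerivWithinAt)
      (fun _ _ => mem_univ _) hZc.continuousOn
      (fun r hr => (key hZ r ⟨hs.1.trans hr.1, hr.2.le.trans ht.2⟩).hasDerivWithinAt)
      (fun _ _ => mem_univ _) h (right_mem_Icc.2 hst)
  · exact ODE_solution_unique_of_mem_Icc_left (s := fun _ => univ)
      (fun r _ => (hK r).lipschitzOnWith) hYc.continuousOn
      (fun r hr => (key hY r ⟨ht.1.trans hr.1.le, hr.2.trans hs.2⟩).hasDerivWithinAt)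
      (fun _ _ => mem_univ _) hZc.continuousOn
      (fun r hr => (key hZ r ⟨ht.1.trans hr.1.le, hr.2.trans hs.2⟩).hasDerivWithinAt)
      (fun _ _ => mem_univ _) h (left_mem_Icc.2 hst)

/-- `X` is a flow of the vector field `v` on `[0, T]`, extended to all times. -/
structure IsFlow (T : ℝ) (v X : ℝ → ℝ → ℝ) : Prop where
  zero : ∀ ξ, X 0 ξ = ξ
  deriv : ∀ ξ t, HasDerivAt (fun s => X s ξ) (v t (X (clampIcc T t) ξ)) t
  mono : ∀ t ∈ Icc 0 T, StrictMono (X t)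
  surj : ∀ t ∈ Icc 0 T, Surjective (X t)

theorem exists_isFlow (hT : 0 < T) (hB : ∀ t x, |v t x| ≤ B) (hK : ∀ t, LipschitzWith K (v t))
    (hc : ∀ x, Continuous fun t => v t x) : ∃ X, IsFlow T v X := by
  have h0 : (0:ℝ) ∈ Icc 0 T := left_mem_Icc.2 hT.le
  choose Y hY0 hY using fun ξ => exists_trajectory hT hB hK hc h0 ξ
  refine ⟨fun t ξ => Y ξ t, hY0, hY, fun t ht ξ ξ' hξ => ?_, fun t ht x => ?_⟩
  · by_contra! hcon
    have hcont : ∀ ξ, Continuous (Y ξ) := fun ξ =>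
      continuous_iff_continuousAt.2 fun t => (hY ξ t).continuousAt
    obtain ⟨s, hs, hs0⟩ := intermediate_value_Icc ht.1
      ((hcont ξ).sub (hcont ξ')).continuousOn
      (show (0:ℝ) ∈ Icc _ _ from ⟨by simp only [Pi.sub_apply, hY0]; linarith, by simpa using hcon⟩)
    have := trajectory_unique hK (hY ξ) (hY ξ') ⟨hs.1, hs.2.trans ht.2⟩ h0 (sub_eq_zero.1 hs0)
    rw [hY0, hY0] at this
    exact hξ.ne this
  · obtain ⟨Z, hZt, hZ⟩ := exists_trajectory hT hB hK hc ht x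
    refine ⟨Z 0, ?_⟩
    rw [← hZt]
    exact trajectory_unique hK (hY (Z 0)) hZ h0 ht (hY0 _)

namespace IsFlow

variable {X : ℝ → ℝ → ℝ}

theorem hasDerivAt (hX : IsFlow T v X) {t : ℝ} (ht : t ∈ Icc 0 T) (ξ : ℝ) :
    HasDerivAt (fun s => X s ξ) (v t (X t ξ)) t := by
  have := hX.deriv ξ t
  rwa [clampIcc_of_mem ht] at this

theorem continuous_time (hX : IsFlow T v X) (ξ : ℝ) : Continuous fun t => X t ξ :=
  continuous_iff_continuousAt.2 fun t => (hX.deriv ξ t).continuousAt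

theorem abs_sub_le (hX : IsFlow T v X) (hB : ∀ t x, |v t x| ≤ B) (ξ s t : ℝ) :
    |X t ξ - X s ξ| ≤ B * |t - s| :=
  Convex.norm_image_sub_le_of_norm_hasDerivWithin_le (s := univ)
    (fun r _ => (hX.deriv ξ r).hasDerivWithinAt) (fun _ _ => hB _ _) convex_univ
    (mem_univ _) (mem_univ _)

theorem continuous_space (hX : IsFlow T v X) {t : ℝ} (ht : t ∈ Icc 0 T) : Continuous (X t) :=
  (hX.mono t ht).monotone.continuous_of_surjective (hX.surj t ht)

theorem contDiff_time (hX : IsFlow T v X) (hK : ∀ t, LipschitzWith K (v t))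
    (hc : ∀ x, Continuous fun t => v t x) (ξ : ℝ) : ContDiff ℝ 1 fun t => X t ξ := by
  have hvc : Continuous (uncurry v) :=
    continuous_prod_of_continuous_lipschitzWith' (uncurry v) K hK hc
  rw [contDiff_one_iff_deriv]
  refine ⟨fun t => (hX.deriv ξ t).differentiableAt, ?_⟩
  have : _root_.deriv (fun t => X t ξ) = fun t => v t (X (clampIcc T t) ξ) :=
    funext fun t => (hX.deriv ξ t).deriv
  rw [this]
  exact hvc.comp (continuous_id.prodMk ((hX.continuous_time ξ).comp (continuous_clampIcc T)))

end IsFlow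

end Flow

theorem deriv_smoothTransition_of_neg {x : ℝ} (hx : x < 0) : deriv Real.smoothTransition x = 0 := by
  have : Real.smoothTransition =ᶠ[nhds x] fun _ => 0 := by
    filter_upwards [Iio_mem_nhds hx] with y hy
    exact Real.smoothTransition.zero_of_nonpos (le_of_lt hy)
  rw [this.deriv_eq, deriv_const]

theorem deriv_smoothTransition_of_one_lt {x : ℝ} (hx : 1 < x) :
    deriv Real.smoothTransition x = 0 := by
  have : Real.smoothTransition =ᶠ[nhds x] fun _ => 1 := by
    filter_upwards [Ioi_mem_nhds hx] with y hy
    exact Real.smoothTransition.one_of_one_le (le_of_lt hy)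
  rw [this.deriv_eq, deriv_const]

theorem continuous_deriv_smoothTransition : Continuous (deriv Real.smoothTransition) :=
  (Real.smoothTransition.contDiff (n := 1)).continuous_deriv le_rfl

theorem hasDerivAt_smoothTransition (x : ℝ) :
    HasDerivAt Real.smoothTransition (deriv Real.smoothTransition x) x :=
  ((Real.smoothTransition.contDiff (n := 1)).differentiable one_ne_zero x).hasDerivAt

theorem exists_abs_deriv_smoothTransition_le :
    ∃ C : ℝ, 0 < C ∧ ∀ x, |deriv Real.smoothTransition x| ≤ C := by
  obtain ⟨C, hC⟩ := (isCompact_Icc (a := (0:ℝ)) (b := 1)).exists_bound_of_continuousOn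
    continuous_deriv_smoothTransition.continuousOn
  refine ⟨max C 1, by positivity, fun x => ?_⟩
  by_cases hx : x ∈ Icc (0:ℝ) 1
  · exact (hC x hx).trans (le_max_left _ _)
  · rw [mem_Icc, not_and_or, not_le, not_le] at hx
    rcases hx with hx | hx
    · rw [deriv_smoothTransition_of_neg hx]; simp
    · rw [deriv_smoothTransition_of_one_lt hx]; simp

theorem abs_smoothTransition_sub_le {C : ℝ} (hC : ∀ x, |deriv Real.smoothTransition x| ≤ C)
    (x y : ℝ) : |Real.smoothTransition x - Real.smoothTransition y| ≤ C * |x - y| :=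
  Convex.norm_image_sub_le_of_norm_hasDerivWithin_le (s := univ)
    (fun r _ => (hasDerivAt_smoothTransition r).hasDerivWithinAt) (fun _ _ => hC _) convex_univ
    (mem_univ _) (mem_univ _)

/-- A `C¹` time cutoff which decreases from `1` to `0` on `[τ - δ, τ]`. -/
theorem exists_time_cutoff {τ δ : ℝ} (hδ : 0 < δ) (hδτ : δ ≤ τ) :
    ∃ χ : ℝ → ℝ, ContDiff ℝ 1 χ ∧ (∀ t ≤ -1, χ t = 0) ∧ (∀ t, τ ≤ t → χ t = 0) ∧ χ 0 = 1 ∧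
      (∀ t, |χ t| ≤ 1) ∧ (∀ t > 0, deriv χ t ≤ 0) ∧ (∀ t > 0, t ∉ Icc (τ - δ) τ → deriv χ t = 0) := by
  refine ⟨fun t => Real.smoothTransition (t + 1) * Real.smoothTransition ((τ - t) / δ), ?_, ?_, ?_,
    ?_, ?_, ?_, ?_⟩
  · exact (Real.smoothTransition.contDiff.comp (by fun_prop)).mul
      (Real.smoothTransition.contDiff.comp (by fun_prop))
  · intro t ht
    beta_reduce
    rw [Real.smoothTransition.zero_of_nonpos (by linarith), zero_mul]
  · intro t ht
    beta_reduce
    rw [Real.smoothTransition.zero_of_nonpos (x := (τ - t) / δ), mul_zero]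
    exact div_nonpos_of_nonpos_of_nonneg (by linarith) hδ.le
  · beta_reduce
    rw [Real.smoothTransition.one_of_one_le (by linarith), Real.smoothTransition.one_of_one_le,
      mul_one]
    rw [le_div_iff₀ hδ]; linarith
  · intro t
    rw [abs_of_nonneg (mul_nonneg (Real.smoothTransition.nonneg _) (Real.smoothTransition.nonneg _))]
    exact mul_le_one₀ (Real.smoothTransition.le_one _) (Real.smoothTransition.nonneg _)
      (Real.smoothTransition.le_one _)
  all_goals
    intro t ht
    have heq : (fun t => Real.smoothTransition (t + 1) * Real.smoothTransition ((τ - t) / δ))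
        =ᶠ[nhds t] fun t => Real.smoothTransition ((τ - t) / δ) := by
      filter_upwards [Ioi_mem_nhds ht] with s hs
      rw [Real.smoothTransition.one_of_one_le (by linarith [mem_Ioi.1 hs]), one_mul]
    rw [heq.deriv_eq]
  · refine Antitone.deriv_nonpos (fun a b hab => Real.smoothTransition.monotone ?_)
    gcongr
  · intro hmem
    have h1 : HasDerivAt (fun t : ℝ => (τ - t) / δ) (-1 / δ) t :=
      ((hasDerivAt_id t).const_sub τ).div_const δ
    have h2 := (hasDerivAt_smoothTransition ((τ - t) / δ)).comp t h1
    rw [show (fun t => Real.smoothTransition ((τ - t) / δ))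
      = Real.smoothTransition ∘ fun t => (τ - t) / δ from rfl, h2.deriv]
    rw [mem_Icc, not_and_or, not_le, not_le] at hmem
    rcases hmem with h | h
    · rw [deriv_smoothTransition_of_one_lt, zero_mul]
      rw [lt_div_iff₀ hδ]; linarith
    · rw [deriv_smoothTransition_of_neg, zero_mul]
      exact div_neg_of_neg_of_pos (by linarith) hδ

theorem tendsto_expAvg_abs {q : ℝ → ℝ → ℝ} {T M η : ℝ} (hη : 0 < η)
    (hq : InSolutionClass T q) (hM : ∀ t x, |q t x| ≤ M) {s : ℝ} (hs : s ∈ Icc 0 T) (x : ℝ) :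
    Tendsto (fun t => expAvg η (fun y => |q t y|) x) (nhdsWithin s (Icc 0 T))
      (nhds (expAvg η (fun y => |q s y|) x)) := by
  have hM0 : 0 ≤ M := (abs_nonneg _).trans (hM 0 0)
  have hqt : ∀ t, Measurable (q t) := fun t => hq.meas.comp measurable_prodMk_left
  have hpm : ∀ t, Measurable fun y => |q t y| := fun t => (hqt t).abs
  have hpM : ∀ t y, |(|q t y|)| ≤ M := fun t y => by rw [abs_abs]; exact hM t y
  have hii : ∀ t c, IntervalIntegrable (q t) volume c x := fun t c =>
    (intervalIntegrable_const (c := M)).mono_fun (hqt t).aestronglyMeasurable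
      (Eventually.of_forall fun y => (hM t y).trans (le_abs_self M))
  have key : ∀ R, 0 ≤ R → ∀ t, |expAvg η (fun y => |q t y|) x - expAvg η (fun y => |q s y|) x|
      ≤ 2 * M * Real.exp (-R / η) + η⁻¹ * ∫ y in Icc (x - R) x, |q t y - q s y| := by
    intro R hR t
    set c := x - R with hc
    have hcx : c ≤ x := by linarith
    have hker : ∀ t, IntervalIntegrable (fun y => Real.exp ((y - x) / η) / η * |q t y|)
        volume c x := fun t => ((hii t c).abs).continuousOn_mul (by fun_prop)
    rw [expAvg_eq_exp_mul hη (hpm t) (hpM t) c x, expAvg_eq_exp_mul hη (hpm s) (hpM s) c x,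
      show (c - x) / η = -R / η by rw [hc]; ring]
    have h1 : |Real.exp (-R / η) * (expAvg η (fun y => |q t y|) c - expAvg η (fun y => |q s y|) c)|
        ≤ 2 * M * Real.exp (-R / η) := by
      rw [abs_mul, Real.abs_exp, mul_comm]
      refine mul_le_mul_of_nonneg_right ?_ (Real.exp_pos _).le
      have := abs_sub (expAvg η (fun y => |q t y|) c) (expAvg η (fun y => |q s y|) c)
      have := abs_expAvg_le (hpm t) (hpM t) η c
      have := abs_expAvg_le (hpm s) (hpM s) η c
      linarith
    have h2 : |((∫ y in c..x, Real.exp ((y - x) / η) / η * |q t y|)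
        - ∫ y in c..x, Real.exp ((y - x) / η) / η * |q s y|)|
        ≤ η⁻¹ * ∫ y in Icc c x, |q t y - q s y| := by
      rw [← intervalIntegral.integral_sub (hker t) (hker s), integral_Icc_eq_integral_Ioc,
        ← intervalIntegral.integral_of_le hcx, ← intervalIntegral.integral_const_mul]
      rw [← Real.norm_eq_abs]
      refine intervalIntegral.norm_integral_le_of_norm_le hcx (Eventually.of_forall fun y hy => ?_)
        ((((hii t c).sub (hii s c)).abs).const_mul _)
      rw [← mul_sub, Real.norm_eq_abs, abs_mul, abs_of_pos (by positivity), div_eq_inv_mul]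
      have he : Real.exp ((y - x) / η) ≤ 1 :=
        Real.exp_le_one_iff.2 (div_nonpos_of_nonpos_of_nonneg (by linarith [hy.2]) hη.le)
      refine mul_le_mul ?_ (abs_abs_sub_abs_le_abs_sub _ _) (abs_nonneg _) (by positivity)
      exact mul_le_of_le_one_right (by positivity) he
    calc _ = |Real.exp (-R / η) * (expAvg η (fun y => |q t y|) c - expAvg η (fun y => |q s y|) c)
        + ((∫ y in c..x, Real.exp ((y - x) / η) / η * |q t y|)
        - ∫ y in c..x, Real.exp ((y - x) / η) / η * |q s y|)| := by congr 1; ring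
      _ ≤ _ := (abs_add_le _ _).trans (add_le_add h1 h2)
  rw [Metric.tendsto_nhds]
  intro δ hδ
  have hlim : Tendsto (fun R => 2 * M * Real.exp (-R / η)) atTop (nhds 0) := by
    have : Tendsto (fun R : ℝ => -R / η) atTop atBot := tendsto_neg_atTop_atBot.atBot_div_const hη
    simpa using (Real.tendsto_exp_atBot.comp this).const_mul (2 * M)
  obtain ⟨R, hR, hR0⟩ := ((hlim.eventually (gt_mem_nhds (half_pos hδ))).and
    (eventually_ge_atTop 0)).exists
  have h3 := ((hq.timeCont s hs (Icc (x - R) x) isCompact_Icc).const_mul η⁻¹)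
  rw [mul_zero] at h3
  filter_upwards [h3.eventually (gt_mem_nhds (half_pos hδ))] with t ht
  rw [Real.dist_eq]
  exact (key R hR0 t).trans_lt (by linarith)

/-- A smooth ramp increasing from `0` to `1` on `[c, c + ε]`. -/
def ramp (ε c x : ℝ) : ℝ := Real.smoothTransition ((x - c) / ε)

theorem continuous_ramp (ε : ℝ) : Continuous fun z : ℝ × ℝ => ramp ε z.1 z.2 :=
  Real.smoothTransition.continuous.comp (by fun_prop)

theorem ramp_of_le {ε c x : ℝ} (hε : 0 < ε) (h : x ≤ c) : ramp ε c x = 0 :=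
  Real.smoothTransition.zero_of_nonpos (div_nonpos_of_nonpos_of_nonneg (by linarith) hε.le)

theorem ramp_of_ge {ε c x : ℝ} (hε : 0 < ε) (h : c + ε ≤ x) : ramp ε c x = 1 :=
  Real.smoothTransition.one_of_one_le (by rw [le_div_iff₀ hε]; linarith)

theorem abs_ramp_sub_ramp_le_one (ε c d x : ℝ) : |ramp ε c x - ramp ε d x| ≤ 1 := by
  have h1 := Real.smoothTransition.nonneg ((x - c) / ε)
  have h2 := Real.smoothTransition.le_one ((x - c) / ε)
  have h3 := Real.smoothTransition.nonneg ((x - d) / ε)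
  have h4 := Real.smoothTransition.le_one ((x - d) / ε)
  exact abs_le.2 ⟨by unfold ramp; linarith, by unfold ramp; linarith⟩

theorem ramp_sub_ramp_eq_zero {ε c d R x : ℝ} (hε : 0 < ε) (hc : |c| + ε ≤ R) (hd : |d| + ε ≤ R)
    (hx : x ∉ Icc (-R) R) : ramp ε c x - ramp ε d x = 0 := by
  have h1 := abs_le.1 (le_refl |c|)
  have h2 := abs_le.1 (le_refl |d|)
  rw [mem_Icc, not_and_or, not_le, not_le] at hx
  rcases hx with hx | hx
  · rw [ramp_of_le hε (by linarith), ramp_of_le hε (by linarith), sub_zero]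
  · rw [ramp_of_ge hε (by linarith), ramp_of_ge hε (by linarith), sub_self]

theorem abs_ramp_sub_indicator_le {ε c : ℝ} (hε : 0 < ε) (x : ℝ) :
    |ramp ε c x - (Ioi c).indicator 1 x| ≤ (Icc c (c + ε)).indicator 1 x := by
  by_cases hx : x ∈ Ioi c
  · rw [indicator_of_mem hx]
    by_cases hx' : x ∈ Icc c (c + ε)
    · rw [indicator_of_mem hx']
      have h1 := Real.smoothTransition.nonneg ((x - c) / ε)
      have h2 := Real.smoothTransition.le_one ((x - c) / ε)
      simp only [Pi.one_apply]
      exact abs_le.2 ⟨by unfold ramp; linarith, by unfold ramp; linarith⟩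
    · have : c + ε ≤ x := by
        by_contra! h
        exact hx' ⟨le_of_lt hx, h.le⟩
      rw [indicator_of_notMem hx', ramp_of_ge hε this]; simp
  · rw [indicator_of_notMem hx, ramp_of_le hε (not_lt.1 hx)]
    simp only [sub_self, abs_zero]
    exact indicator_nonneg (fun _ _ => zero_le_one) x

theorem integrable_indicator_Icc (c d C : ℝ) :
    Integrable (fun x : ℝ => C * (Icc c d).indicator (1 : ℝ → ℝ) x) :=
  ((integrable_indicator_iff measurableSet_Icc).2 (integrableOn_const (by simp))).const_mul C

theorem integral_indicator_Icc {c d : ℝ} (h : c ≤ d) (C : ℝ) :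
    ∫ x, C * (Icc c d).indicator (1 : ℝ → ℝ) x = C * (d - c) := by
  rw [integral_const_mul, integral_indicator_one measurableSet_Icc, Real.volume_real_Icc_of_le h]

theorem integrable_mul_ramp_sub {f : ℝ → ℝ} {M ε : ℝ} (hε : 0 < ε) (hf : Measurable f)
    (hM : ∀ x, |f x| ≤ M) (c d : ℝ) : Integrable fun x => f x * (ramp ε c x - ramp ε d x) := by
  set R := max (|c| + ε) (|d| + ε)
  have hM0 : 0 ≤ M := (abs_nonneg _).trans (hM 0)
  have hr : ∀ c, Measurable (ramp ε c) := fun c =>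
    ((continuous_ramp ε).comp (Continuous.prodMk_right c)).measurable
  refine (integrable_indicator_Icc (-R) R M).mono'
    (hf.mul ((hr c).sub (hr d))).aestronglyMeasurable (Eventually.of_forall fun x => ?_)
  by_cases hx : x ∈ Icc (-R) R
  · rw [indicator_of_mem hx, Real.norm_eq_abs, abs_mul]
    exact mul_le_mul (hM x) (abs_ramp_sub_ramp_le_one ε c d x) (abs_nonneg _) hM0
  · rw [ramp_sub_ramp_eq_zero hε (le_max_left _ _) (le_max_right _ _) hx, mul_zero, norm_zero,
      indicator_of_notMem hx, mul_zero]

theorem abs_integral_mul_ramp_sub_le {f : ℝ → ℝ} {M ε c d : ℝ} (hε : 0 < ε) (hf : Measurable f)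
    (hM : ∀ x, |f x| ≤ M) (hcd : c ≤ d) :
    |(∫ x, f x * (ramp ε c x - ramp ε d x)) - ∫ x in c..d, f x| ≤ 2 * M * ε := by
  have hM0 : 0 ≤ M := (abs_nonneg _).trans (hM 0)
  have hind : Integrable ((Ioc c d).indicator f) := by
    refine (integrable_indicator_iff measurableSet_Ioc).2 ?_
    exact Measure.integrableOn_of_bounded (M := M) (by simp) hf.aestronglyMeasurable
      (Eventually.of_forall hM)
  rw [intervalIntegral.integral_of_le hcd, ← integral_indicator measurableSet_Ioc,
    ← integral_sub (integrable_mul_ramp_sub hε hf hM c d) hind]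
  have hbound := norm_integral_le_of_norm_le (f := fun x => f x * (ramp ε c x - ramp ε d x)
      - (Ioc c d).indicator f x)
    ((integrable_indicator_Icc c (c + ε) M).add (integrable_indicator_Icc d (d + ε) M))
    (Eventually.of_forall fun x => by
      have h1 := abs_ramp_sub_indicator_le (c := c) hε x
      have h2 := abs_ramp_sub_indicator_le (c := d) hε x
      have h3 : (Ioc c d).indicator f x
          = f x * ((Ioi c).indicator 1 x - (Ioi d).indicator 1 x) := by
        simp only [indicator_apply, mem_Ioc, mem_Ioi, Pi.one_apply]
        split_ifs <;> first | (exfalso; grind) | simp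
      rw [h3, ← mul_sub, Real.norm_eq_abs, abs_mul, Pi.add_apply, ← mul_add]
      refine mul_le_mul (hM x) ?_ (abs_nonneg _) hM0
      calc _ = |(ramp ε c x - (Ioi c).indicator 1 x) - (ramp ε d x - (Ioi d).indicator 1 x)| := by
            congr 1; ring
        _ ≤ _ := (abs_sub _ _).trans (add_le_add h1 h2))
  rw [integral_add' (integrable_indicator_Icc _ _ _) (integrable_indicator_Icc _ _ _),
    integral_indicator_Icc (by linarith), integral_indicator_Icc (by linarith)] at hbound
  rw [Real.norm_eq_abs] at hbound
  linarith

theorem abs_deriv_ramp_mul_le {v : ℝ → ℝ} {K : NNReal} {C ε : ℝ} (hε : 0 < ε)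
    (hC : ∀ x, |deriv Real.smoothTransition x| ≤ C) (hK : LipschitzWith K v) (c x : ℝ) :
    |deriv Real.smoothTransition ((x - c) / ε) * ((v x - v c) / ε)|
      ≤ C * K * (Icc c (c + ε)).indicator 1 x := by
  by_cases hx : x ∈ Icc c (c + ε)
  · rw [indicator_of_mem hx, abs_mul, Pi.one_apply, mul_one]
    refine mul_le_mul (hC _) ?_ (abs_nonneg _) ((abs_nonneg _).trans (hC 0))
    rw [abs_div, abs_of_pos hε, div_le_iff₀ hε]
    have := hK.dist_le_mul x c
    rw [Real.dist_eq, Real.dist_eq, abs_of_nonneg (sub_nonneg.2 hx.1)] at this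
    exact this.trans (mul_le_mul_of_nonneg_left (by linarith [hx.2]) K.2)
  · rw [indicator_of_notMem hx, mul_zero]
    rw [mem_Icc, not_and_or, not_le, not_le] at hx
    rcases hx with hx | hx
    · rw [deriv_smoothTransition_of_neg (div_neg_of_neg_of_pos (by linarith) hε)]; simp
    · rw [deriv_smoothTransition_of_one_lt (by rw [lt_div_iff₀ hε]; linarith)]; simp

theorem hasDerivAt_ramp_space (ε c x : ℝ) :
    HasDerivAt (fun y => ramp ε c y) (deriv Real.smoothTransition ((x - c) / ε) * (1 / ε)) x :=
  (hasDerivAt_smoothTransition ((x - c) / ε)).comp x (((hasDerivAt_id x).sub_const c).div_const ε)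

theorem hasDerivAt_ramp_time {c : ℝ → ℝ} {c' t : ℝ} (hc : HasDerivAt c c' t) (ε x : ℝ) :
    HasDerivAt (fun s => ramp ε (c s) x)
      (deriv Real.smoothTransition ((x - c t) / ε) * (-c' / ε)) t :=
  (hasDerivAt_smoothTransition ((x - c t) / ε)).comp t ((hc.const_sub x).div_const ε)

section Transport

variable {q v X : ℝ → ℝ → ℝ} {T B M : ℝ} {K : NNReal} {q₀ : ℝ → ℝ}

/-- The weak formulation of `∂ₜ q + ∂ₓ (v q) = 0`, `q(0,·) = q₀`. -/
def IsWeakTransport (T : ℝ) (v : ℝ → ℝ → ℝ) (q₀ : ℝ → ℝ) (q : ℝ → ℝ → ℝ) : Prop :=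
  ∀ φ : ℝ → ℝ → ℝ, IsTestFun T φ →
    (∫ t in Ioo (0:ℝ) T, ∫ x : ℝ, q t x *
        (deriv (fun s => φ s x) t + deriv (fun y => φ t y) x * v t x))
      + (∫ x : ℝ, φ 0 x * q₀ x) = 0

theorem isTestFun_cutoff_mul_ramp {τ ε a b : ℝ} {χ α β : ℝ → ℝ} (hε : 0 < ε) (hτT : τ ≤ T)
    (hχ : ContDiff ℝ 1 χ) (hχ1 : ∀ t ≤ -1, χ t = 0) (hχ2 : ∀ t, τ ≤ t → χ t = 0)
    (hα : ContDiff ℝ 1 α) (hβ : ContDiff ℝ 1 β)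
    (hαB : ∀ t, |α t - a| ≤ B * |t|) (hβB : ∀ t, |β t - b| ≤ B * |t|) (hB : 0 ≤ B) (hT : 0 ≤ T) :
    IsTestFun T fun t x => χ t * (ramp ε (α t) x - ramp ε (β t) x) where
  smooth := by
    have h1 : ContDiff ℝ 1 fun z : ℝ × ℝ => ramp ε (α z.1) z.2 :=
      Real.smoothTransition.contDiff.comp
        ((contDiff_snd.sub (hα.comp contDiff_fst)).div_const ε)
    have h2 : ContDiff ℝ 1 fun z : ℝ × ℝ => ramp ε (β z.1) z.2 :=
      Real.smoothTransition.contDiff.comp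
        ((contDiff_snd.sub (hβ.comp contDiff_fst)).div_const ε)
    exact (hχ.comp contDiff_fst).mul (h1.sub h2)
  compSupp := by
    set R := |a| + |b| + B * (1 + T) + ε
    refine HasCompactSupport.intro (K := Icc (-1) T ×ˢ Icc (-R) R)
      (isCompact_Icc.prod isCompact_Icc) fun z hz => ?_
    simp only [uncurry]
    by_cases ht : z.1 ∈ Icc (-1) T
    · have hx : z.2 ∉ Icc (-R) R := fun h => hz ⟨ht, h⟩
      have ht' : |z.1| ≤ 1 + T := abs_le.2 ⟨by linarith [ht.1], by linarith [ht.2]⟩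
      have hBt := mul_le_mul_of_nonneg_left ht' hB
      have h1 := abs_sub_abs_le_abs_sub (α z.1) a
      have h2 := abs_sub_abs_le_abs_sub (β z.1) b
      have h3 := hαB z.1
      have h4 := hβB z.1
      rw [ramp_sub_ramp_eq_zero hε _ _ hx, mul_zero]
      · linarith [abs_nonneg b]
      · linarith [abs_nonneg a]
    · rw [mem_Icc, not_and_or, not_le, not_le] at ht
      rcases ht with ht | ht
      · rw [hχ1 _ ht.le, zero_mul]
      · rw [hχ2 _ (hτT.trans ht.le), zero_mul]
  vanish := fun t x ht => by rw [hχ2 _ (hτT.trans ht), zero_mul]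

theorem continuousOn_integral_mul_ramp {ε : ℝ} {α β : ℝ → ℝ} (hε : 0 < ε) (hT : 0 ≤ T)
    (hq : InSolutionClass T q) (hM : ∀ t x, |q t x| ≤ M)
    (hαB : ∀ s t, |α t - α s| ≤ B * |t - s|) (hβB : ∀ s t, |β t - β s| ≤ B * |t - s|) :
    ContinuousOn (fun t => ∫ x, q t x * (ramp ε (α t) x - ramp ε (β t) x)) (Icc 0 T) := by
  obtain ⟨C, hC0, hC⟩ := exists_abs_deriv_smoothTransition_le
  have hM0 : 0 ≤ M := (abs_nonneg _).trans (hM 0 0)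
  have hB : 0 ≤ B := by simpa using (abs_nonneg _).trans (hαB 0 1)
  set R := |α 0| + |β 0| + B * T + ε with hR
  have hR0 : 0 ≤ R := by positivity
  have hqt : ∀ t, Measurable (q t) := fun t => hq.meas.comp measurable_prodMk_left
  have hsupp : ∀ t ∈ Icc 0 T, ∀ x ∉ Icc (-R) R, ramp ε (α t) x - ramp ε (β t) x = 0 := by
    intro t ht x hx
    have h1 := abs_sub_abs_le_abs_sub (α t) (α 0)
    have h2 := abs_sub_abs_le_abs_sub (β t) (β 0)
    have h3 := hαB 0 t
    have h4 := hβB 0 t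
    rw [sub_zero, abs_of_nonneg ht.1] at h3 h4
    have := mul_le_mul_of_nonneg_left ht.2 hB
    exact ramp_sub_ramp_eq_zero hε (by linarith [abs_nonneg (β 0)])
      (by linarith [abs_nonneg (α 0)]) hx
  have hrl : ∀ c d x, |ramp ε c x - ramp ε d x| ≤ C / ε * |c - d| := by
    intro c d x
    refine (abs_smoothTransition_sub_le hC _ _).trans (le_of_eq ?_)
    rw [← sub_div, abs_div, abs_of_pos hε, show x - c - (x - d) = d - c by ring, abs_sub_comm]
    ring
  intro s hs
  have hkint : IntegrableOn (fun x => |q s x|) (Icc (-R) R) :=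
    Measure.integrableOn_of_bounded (M := M) (by simp) (hqt s).abs.aestronglyMeasurable
      (Eventually.of_forall fun x => by simpa using hM s x)
  have hint2 : ∀ t, Integrable ((Icc (-R) R).indicator fun x => |q t x - q s x|) := fun t =>
    (integrable_indicator_iff measurableSet_Icc).2 <|
      Measure.integrableOn_of_bounded (M := M + M) (by simp)
      ((hqt t).sub (hqt s)).abs.aestronglyMeasurable (Eventually.of_forall fun x => by
        rw [Real.norm_eq_abs, abs_abs]
        exact (abs_sub _ _).trans (add_le_add (hM t x) (hM s x)))
  have key : ∀ t ∈ Icc 0 T, |(∫ x, q t x * (ramp ε (α t) x - ramp ε (β t) x))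
      - ∫ x, q s x * (ramp ε (α s) x - ramp ε (β s) x)|
      ≤ (∫ x in Icc (-R) R, |q t x - q s x|) + M * (C / ε * (2 * B * |t - s|)) * (R - -R) := by
    intro t ht
    rw [← integral_sub (integrable_mul_ramp_sub hε (hqt t) (hM t) _ _)
      (integrable_mul_ramp_sub hε (hqt s) (hM s) _ _), ← integral_indicator measurableSet_Icc,
      ← integral_indicator_Icc (by linarith), ← integral_add (hint2 t)
      (integrable_indicator_Icc _ _ _), ← Real.norm_eq_abs]
    refine norm_integral_le_of_norm_le ((hint2 t).add (integrable_indicator_Icc _ _ _))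
      (Eventually.of_forall fun x => ?_)
    by_cases hx : x ∈ Icc (-R) R
    · simp only [indicator_of_mem hx, Pi.one_apply, mul_one]
      have e : q t x * (ramp ε (α t) x - ramp ε (β t) x) - q s x * (ramp ε (α s) x - ramp ε (β s) x)
        = (q t x - q s x) * (ramp ε (α t) x - ramp ε (β t) x)
          + q s x * ((ramp ε (α t) x - ramp ε (α s) x) - (ramp ε (β t) x - ramp ε (β s) x)) := by
        ring
      rw [e]
      refine (norm_add_le _ _).trans (add_le_add ?_ ?_)
      · rw [Real.norm_eq_abs, abs_mul]
        exact mul_le_of_le_one_right (abs_nonneg _) (abs_ramp_sub_ramp_le_one _ _ _ _)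
      · rw [Real.norm_eq_abs, abs_mul]
        refine mul_le_mul (hM s x) ?_ (abs_nonneg _) hM0
        refine (abs_sub _ _).trans ?_
        have h1 := hrl (α t) (α s) x
        have h2 := hrl (β t) (β s) x
        have h3 := mul_le_mul_of_nonneg_left (hαB s t) (by positivity : 0 ≤ C / ε)
        have h4 := mul_le_mul_of_nonneg_left (hβB s t) (by positivity : 0 ≤ C / ε)
        linarith
    · rw [hsupp t ht x hx, hsupp s hs x hx]
      simp [indicator_of_notMem hx]
  have hlim : Tendsto (fun t => (∫ x in Icc (-R) R, |q t x - q s x|)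
      + M * (C / ε * (2 * B * |t - s|)) * (R - -R)) (nhdsWithin s (Icc 0 T)) (nhds 0) := by
    have h2 : Tendsto (fun t => M * (C / ε * (2 * B * |t - s|)) * (R - -R))
        (nhdsWithin s (Icc 0 T)) (nhds 0) := by
      have : Continuous fun t => M * (C / ε * (2 * B * |t - s|)) * (R - -R) := by fun_prop
      have := (this.tendsto s).mono_left (nhdsWithin_le_nhds (s := Icc 0 T))
      simpa using this
    simpa using (hq.timeCont s hs _ isCompact_Icc).add h2
  refine tendsto_iff_dist_tendsto_zero.2 (squeeze_zero' (Eventually.of_forall fun _ => dist_nonneg)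
    ?_ hlim)
  filter_upwards [self_mem_nhdsWithin] with t ht
  exact key t ht

theorem abs_integral_ramp_sub_le {C ε a b τ : ℝ} (hT : 0 < T) (hq : InSolutionClass T q)
    (hM : ∀ t x, |q t x| ≤ M) (hB : ∀ t x, |v t x| ≤ B)
    (hK : ∀ t, LipschitzWith K (v t)) (hc : ∀ x, Continuous fun t => v t x) (hX : IsFlow T v X)
    (hw : IsWeakTransport T v q₀ q) (hC : ∀ x, |deriv Real.smoothTransition x| ≤ C) (hε : 0 < ε)
    (hτ : τ ∈ Ioc 0 T) :
    |(∫ x, q τ x * (ramp ε (X τ a) x - ramp ε (X τ b) x))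
      - ∫ x, q₀ x * (ramp ε a x - ramp ε b x)| ≤ ε + 2 * M * C * K * ε * T := by
  have hM0 : 0 ≤ M := (abs_nonneg _).trans (hM 0 0)
  have hC0 : 0 ≤ C := (abs_nonneg _).trans (hC 0)
  have hB0 : 0 ≤ B := (abs_nonneg _).trans (hB 0 0)
  have hqt : ∀ t, Measurable (q t) := fun t => hq.meas.comp measurable_prodMk_left
  have hvc : Continuous (uncurry v) :=
    continuous_prod_of_continuous_lipschitzWith' (uncurry v) K hK hc
  set F : ℝ → ℝ := fun t => ∫ x, q t x * (ramp ε (X t a) x - ramp ε (X t b) x) with hF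
  set g : ℝ → ℝ → ℝ := fun t x =>
    deriv Real.smoothTransition ((x - X t a) / ε) * ((v t x - v t (X t a)) / ε)
      - deriv Real.smoothTransition ((x - X t b) / ε) * ((v t x - v t (X t b)) / ε) with hg
  set e : ℝ → ℝ := fun t => ∫ x, q t x * g t x with he
  have hFc : ContinuousOn F (Icc 0 T) := continuousOn_integral_mul_ramp hε hT.le hq hM
    (fun s t => hX.abs_sub_le hB a s t) (fun s t => hX.abs_sub_le hB b s t)
  have hgc : Continuous (uncurry g) := by
    have h1 : ∀ a, Continuous fun z : ℝ × ℝ => deriv Real.smoothTransition ((z.2 - X z.1 a) / ε)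
        * ((v z.1 z.2 - v z.1 (X z.1 a)) / ε) := by
      intro a
      have hXa : Continuous fun z : ℝ × ℝ => X z.1 a := (hX.continuous_time a).comp continuous_fst
      refine (continuous_deriv_smoothTransition.comp
        ((continuous_snd.sub hXa).div_const ε)).mul (Continuous.div_const ?_ ε)
      exact hvc.sub (hvc.comp (continuous_fst.prodMk hXa))
    exact (h1 a).sub (h1 b)
  have hgb : ∀ t x, ‖q t x * g t x‖ ≤ M * (C * K) * (Icc (X t a) (X t a + ε)).indicator 1 x
      + M * (C * K) * (Icc (X t b) (X t b + ε)).indicator 1 x := by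
    intro t x
    rw [Real.norm_eq_abs, abs_mul, mul_assoc M, mul_assoc M, ← mul_add]
    exact mul_le_mul (hM t x) ((abs_sub _ _).trans (add_le_add
      (abs_deriv_ramp_mul_le hε hC (hK t) _ _) (abs_deriv_ramp_mul_le hε hC (hK t) _ _)))
      (abs_nonneg _) hM0
  have hgi : ∀ t, Integrable fun x => q t x * g t x := fun t =>
    ((integrable_indicator_Icc _ _ _).add (integrable_indicator_Icc _ _ _)).mono'
      ((hqt t).mul (hgc.comp (Continuous.prodMk_right t)).measurable).aestronglyMeasurable
      (Eventually.of_forall (hgb t))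
  have heb : ∀ t, |e t| ≤ 2 * M * C * K * ε := by
    intro t
    have := norm_integral_le_of_norm_le ((integrable_indicator_Icc _ _ _).add
      (integrable_indicator_Icc _ _ _)) (Eventually.of_forall (hgb t))
    rw [integral_add' (integrable_indicator_Icc _ _ _) (integrable_indicator_Icc _ _ _),
      integral_indicator_Icc (by linarith), integral_indicator_Icc (by linarith)] at this
    rw [Real.norm_eq_abs] at this
    linarith
  have hem : Measurable e := by
    have : StronglyMeasurable (uncurry fun t x => q t x * g t x) :=
      (hq.meas.mul hgc.measurable).stronglyMeasurable
    exact this.integral_prod_right.measurable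
  -- choice of the time cutoff
  obtain ⟨δ₀, hδ₀, hδF⟩ := Metric.continuousOn_iff.1 hFc τ ⟨hτ.1.le, hτ.2⟩ ε hε
  set δ := min (δ₀ / 2) τ with hδ
  have hδpos : 0 < δ := lt_min (by linarith) hτ.1
  obtain ⟨χ, hχ, hχ1, hχ2, hχ0, hχb, hχ', hχ''⟩ := exists_time_cutoff hδpos (min_le_right _ _)
  have htest := hw _ (isTestFun_cutoff_mul_ramp (a := a) (b := b) hε hτ.2 hχ hχ1 hχ2
    (hX.contDiff_time hK hc a) (hX.contDiff_time hK hc b)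
    (fun t => by simpa [hX.zero] using hX.abs_sub_le hB a 0 t)
    (fun t => by simpa [hX.zero] using hX.abs_sub_le hB b 0 t) hB0 hT.le)
  have hinner : ∀ t ∈ Ioo 0 T, (∫ x, q t x *
      (deriv (fun s => χ s * (ramp ε (X s a) x - ramp ε (X s b) x)) t
        + deriv (fun y => χ t * (ramp ε (X t a) y - ramp ε (X t b) y)) x * v t x))
      = deriv χ t * F t + χ t * e t := by
    intro t ht
    have htI := Ioo_subset_Icc_self ht
    have hpt : ∀ x, q t x *
      (deriv (fun s => χ s * (ramp ε (X s a) x - ramp ε (X s b) x)) t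
        + deriv (fun y => χ t * (ramp ε (X t a) y - ramp ε (X t b) y)) x * v t x)
        = deriv χ t * (q t x * (ramp ε (X t a) x - ramp ε (X t b) x)) + χ t * (q t x * g t x) := by
      intro x
      have h1 := ((hχ.differentiable one_ne_zero t).hasDerivAt).mul
        ((hasDerivAt_ramp_time (hX.hasDerivAt htI a) ε x).sub
          (hasDerivAt_ramp_time (hX.hasDerivAt htI b) ε x))
      have h2 := ((hasDerivAt_ramp_space ε (X t a) x).sub
        (hasDerivAt_ramp_space ε (X t b) x)).const_mul (χ t)
      have h1' : deriv (fun s => χ s * (ramp ε (X s a) x - ramp ε (X s b) x)) t = _ := h1.deriv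
      have h2' : deriv (fun y => χ t * (ramp ε (X t a) y - ramp ε (X t b) y)) x = _ := h2.deriv
      rw [h1', h2', hg]
      simp only [Pi.sub_apply]
      ring
    simp only [hpt]
    rw [integral_add ((integrable_mul_ramp_sub hε (hqt t) (hM t) _ _).const_mul _)
      ((hgi t).const_mul _), integral_const_mul, integral_const_mul]
  rw [setIntegral_congr_fun measurableSet_Ioo hinner] at htest
  simp only [hχ0, hX.zero, one_mul] at htest
  have hχ'c : Continuous (deriv χ) := hχ.continuous_deriv le_rfl
  have hIχ' : IntegrableOn (deriv χ) (Ioo 0 T) :=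
    (hχ'c.continuousOn.integrableOn_compact isCompact_Icc).mono_set Ioo_subset_Icc_self
  have hI1 : IntegrableOn (fun t => deriv χ t * F t) (Ioo 0 T) :=
    ((hχ'c.continuousOn.mul hFc).integrableOn_compact isCompact_Icc).mono_set Ioo_subset_Icc_self
  have hI2 : IntegrableOn (fun t => χ t * e t) (Ioo 0 T) := by
    refine Measure.integrableOn_of_bounded (M := 2 * M * C * K * ε) (by simp)
      (hχ.continuous.measurable.mul hem).aestronglyMeasurable (Eventually.of_forall fun t => ?_)
    rw [Real.norm_eq_abs, abs_mul]
    exact (mul_le_of_le_one_left (abs_nonneg _) (hχb t)).trans (heb t)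
  have hIχ : ∫ t in Ioo 0 T, deriv χ t = -1 := by
    rw [← integral_Ioc_eq_integral_Ioo, ← intervalIntegral.integral_of_le hT.le,
      intervalIntegral.integral_deriv_eq_sub (fun t _ => hχ.differentiable one_ne_zero t)
      (hχ'c.intervalIntegrable _ _), hχ0, hχ2 T hτ.2, zero_sub]
  have heq : F τ - ∫ x, q₀ x * (ramp ε a x - ramp ε b x)
      = ∫ t in Ioo 0 T, (deriv χ t * F t + χ t * e t - deriv χ t * F τ) := by
    have hsub := integral_sub (hI1.add hI2) (hIχ'.mul_const (F τ))
    simp only [Pi.add_apply] at hsub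
    rw [hsub, integral_mul_const, hIχ]
    have : ∫ x, (ramp ε a x - ramp ε b x) * q₀ x = ∫ x, q₀ x * (ramp ε a x - ramp ε b x) := by
      simp only [mul_comm]
    linarith
  rw [heq, ← Real.norm_eq_abs]
  have hIb : IntegrableOn (fun t => -deriv χ t * ε + 2 * M * C * K * ε) (Ioo 0 T) :=
    (hIχ'.neg.mul_const ε).add (integrableOn_const (by simp))
  have hbound := norm_integral_le_of_norm_le hIb
    (f := fun t => deriv χ t * F t + χ t * e t - deriv χ t * F τ)
    ((ae_restrict_iff' measurableSet_Ioo).2 (Eventually.of_forall fun t ht => by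
      have h1 : |deriv χ t * (F t - F τ)| ≤ -deriv χ t * ε := by
        by_cases hmem : t ∈ Icc (τ - δ) τ
        · rw [abs_mul, abs_of_nonpos (hχ' t ht.1)]
          refine mul_le_mul_of_nonneg_left (le_of_lt ?_) (by linarith [hχ' t ht.1])
          refine hδF t (Ioo_subset_Icc_self ht) ?_
          rw [Real.dist_eq, abs_sub_comm, abs_of_nonneg (by linarith [hmem.2])]
          have : δ ≤ δ₀ / 2 := min_le_left _ _
          linarith [hmem.1]
        · rw [hχ'' t ht.1 hmem]; simp
      have h2 : |χ t * e t| ≤ 2 * M * C * K * ε := by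
        rw [abs_mul]
        exact (mul_le_of_le_one_left (abs_nonneg _) (hχb t)).trans (heb t)
      calc ‖deriv χ t * F t + χ t * e t - deriv χ t * F τ‖
          = |deriv χ t * (F t - F τ) + χ t * e t| := by rw [Real.norm_eq_abs]; congr 1; ring
        _ ≤ _ := (abs_add_le _ _).trans (add_le_add h1 h2)))
  refine hbound.trans (le_of_eq ?_)
  have hn : IntegrableOn (fun t => -deriv χ t * ε) (Ioo 0 T) := hIχ'.neg.mul_const ε
  rw [integral_add hn (integrableOn_const (by simp)), integral_mul_const, integral_neg, hIχ]
  simp [hT.le]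
  ring

/-- Mass between characteristics is conserved. -/
theorem integral_flow_eq {a b τ : ℝ} (hT : 0 < T) (hq : InSolutionClass T q)
    (hM : ∀ t x, |q t x| ≤ M) (hq₀ : Measurable q₀) (hq₀M : ∀ x, |q₀ x| ≤ M)
    (hB : ∀ t x, |v t x| ≤ B)
    (hK : ∀ t, LipschitzWith K (v t)) (hc : ∀ x, Continuous fun t => v t x) (hX : IsFlow T v X)
    (hw : IsWeakTransport T v q₀ q) (hab : a ≤ b) (hτ : τ ∈ Icc 0 T) :
    ∫ x in X τ a..X τ b, q τ x = ∫ x in a..b, q₀ x := by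
  obtain ⟨C, hC0, hC⟩ := exists_abs_deriv_smoothTransition_le
  have hqt : ∀ t, Measurable (q t) := fun t => hq.meas.comp measurable_prodMk_left
  have hclosed : ∀ ε > 0, ∀ τ ∈ Icc 0 T, |(∫ x, q τ x * (ramp ε (X τ a) x - ramp ε (X τ b) x))
      - ∫ x, q₀ x * (ramp ε a x - ramp ε b x)| ≤ ε + 2 * M * C * K * ε * T := by
    intro ε hε τ hτ
    have hFc := continuousOn_integral_mul_ramp hε hT.le hq hM
      (fun s t => hX.abs_sub_le hB a s t) (fun s t => hX.abs_sub_le hB b s t)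
    refine ContinuousWithinAt.closure_le (s := Ioc 0 T) (x := τ)
      (f := fun τ => |(∫ x, q τ x * (ramp ε (X τ a) x - ramp ε (X τ b) x))
        - ∫ x, q₀ x * (ramp ε a x - ramp ε b x)|) (g := fun _ => ε + 2 * M * C * K * ε * T)
      (by rwa [closure_Ioc hT.ne])
      (((hFc τ hτ).mono Ioc_subset_Icc_self).sub continuousWithinAt_const).abs
      continuousWithinAt_const fun s hs => ?_
    exact abs_integral_ramp_sub_le hT hq hM hB hK hc hX hw hC hε hs
  have hle : ∀ ε > 0, |(∫ x in X τ a..X τ b, q τ x) - ∫ x in a..b, q₀ x|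
      ≤ ε * (4 * M + 1 + 2 * M * C * K * T) := by
    intro ε hε
    have h1 := abs_integral_mul_ramp_sub_le hε (hqt τ) (hM τ) ((hX.mono τ hτ).monotone hab)
    have h2 := abs_integral_mul_ramp_sub_le hε hq₀ hq₀M hab
    have h3 := hclosed ε hε τ hτ
    rw [abs_le] at *
    constructor <;> linarith [h1.1, h1.2, h2.1, h2.2, h3.1, h3.2]
  have hlim : Tendsto (fun ε => ε * (4 * M + 1 + 2 * M * C * K * T)) (nhdsWithin 0 (Ioi 0))
      (nhds 0) := by
    have : Continuous fun ε : ℝ => ε * (4 * M + 1 + 2 * M * C * K * T) := by fun_prop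
    have := (this.tendsto 0).mono_left (nhdsWithin_le_nhds (s := Ioi 0))
    simpa using this
  have := ge_of_tendsto hlim (by filter_upwards [self_mem_nhdsWithin] with ε hε using hle ε hε)
  exact sub_eq_zero.1 (abs_nonpos_iff.1 this)

end Transport

section MeasureTransport

theorem add_le_add_of_mutuallySingular {ν₁ ν₂ μ₁ μ₂ : Measure ℝ} (h : ν₁ + μ₂ = ν₂ + μ₁)
    (hν : ν₁.MutuallySingular ν₂) : ν₁ + ν₂ ≤ μ₁ + μ₂ := by
  obtain ⟨S, hS, h1, h2⟩ := hν
  refine Measure.le_iff.2 fun A hA => ?_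
  have hAB : ∀ B, ν₁ B + μ₂ B = ν₂ B + μ₁ B := fun B => by
    simpa using congrArg (fun μ : Measure ℝ => μ B) h
  have hA1 := hAB (A ∩ S)
  have hA2 := hAB (A \ S)
  have z1 : ν₁ (A ∩ S) = 0 := measure_mono_null inter_subset_right h1
  have z2 : ν₂ (A \ S) = 0 := measure_mono_null (fun x hx => hx.2) h2
  rw [z1, zero_add] at hA1
  rw [z2, zero_add] at hA2
  have l1 : ν₂ (A ∩ S) ≤ μ₂ (A ∩ S) := by rw [hA1]; exact le_self_add
  have l2 : ν₁ (A \ S) ≤ μ₁ (A \ S) := by rw [← hA2]; exact le_self_add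
  simp only [Measure.add_apply]
  rw [← measure_inter_add_sdiff A hS (μ := ν₁), ← measure_inter_add_sdiff A hS (μ := ν₂),
    ← measure_inter_add_sdiff A hS (μ := μ₁), ← measure_inter_add_sdiff A hS (μ := μ₂), z1, z2,
    zero_add, add_zero, add_comm (ν₁ (A \ S))]
  calc ν₂ (A ∩ S) + ν₁ (A \ S) ≤ μ₂ (A ∩ S) + μ₁ (A \ S) := add_le_add l1 l2
    _ ≤ (μ₂ (A ∩ S) + μ₁ (A \ S)) + (μ₁ (A ∩ S) + μ₂ (A \ S)) := le_self_add
    _ = _ := by ring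

theorem withDensity_ofReal_Ioc {f : ℝ → ℝ} {M : ℝ} (hf : Measurable f) (hM : ∀ x, |f x| ≤ M)
    {a b : ℝ} (hab : a ≤ b) : volume.withDensity (fun x => ENNReal.ofReal (f x)) (Ioc a b)
      = ENNReal.ofReal (∫ x in a..b, max (f x) 0) := by
  rw [withDensity_apply _ measurableSet_Ioc, intervalIntegral.integral_of_le hab,
    ofReal_integral_eq_lintegral_ofReal]
  · simp [ENNReal.ofReal_max]
  · exact Measure.integrableOn_of_bounded (M := M) (by simp) (by fun_prop)
      (Eventually.of_forall fun x => by
        rw [Real.norm_eq_abs, abs_of_nonneg (le_max_right _ _)]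
        exact max_le ((le_abs_self _).trans (hM x)) ((abs_nonneg _).trans (hM x)))
  · exact Eventually.of_forall fun x => le_max_right _ _

theorem map_withDensity_abs_eq {f g Y : ℝ → ℝ} {M : ℝ} (hf : Measurable f) (hg : Measurable g)
    (hfM : ∀ x, |f x| ≤ M) (hgM : ∀ x, |g x| ≤ M) (hY : StrictMono Y) (hYs : Surjective Y)
    (h : ∀ a b, a ≤ b → ∫ x in Y a..Y b, f x = ∫ x in a..b, g x) :
    (volume.withDensity fun x => ENNReal.ofReal |g x|).map Y
      = volume.withDensity fun x => ENNReal.ofReal |f x| := by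
  set e : ℝ ≃ₜ ℝ := (hY.orderIsoOfSurjective Y hYs).toHomeomorph 
  have hYm : Measurable Y := hY.monotone.measurable
  have hgM' : ∀ x, |-g x| ≤ M := fun x => by rw [abs_neg]; exact hgM x
  have hfM' : ∀ x, |-f x| ≤ M := fun x => by rw [abs_neg]; exact hfM x
  have hkint : ∀ {k : ℝ → ℝ}, Measurable k → (∀ x, |k x| ≤ M) → ∀ a b,
      IntervalIntegrable (fun x => max (k x) 0) volume a b := fun {k} hk hkM a b =>
    ⟨Measure.integrableOn_of_bounded (M := M) (by simp) (by fun_prop)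
      (Eventually.of_forall fun x => by
        rw [Real.norm_eq_abs, abs_of_nonneg (le_max_right _ _)]
        exact max_le ((le_abs_self _).trans (hkM x)) ((abs_nonneg _).trans (hkM x))),
     Measure.integrableOn_of_bounded (M := M) (by simp) (by fun_prop)
      (Eventually.of_forall fun x => by
        rw [Real.norm_eq_abs, abs_of_nonneg (le_max_right _ _)]
        exact max_le ((le_abs_self _).trans (hkM x)) ((abs_nonneg _).trans (hkM x)))⟩
  have hmax : ∀ r : ℝ, max r 0 - max (-r) 0 = r := fun r => by
    rcases le_total 0 r with hr | hr
    · rw [max_eq_left hr, max_eq_right (by linarith)]; ring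
    · rw [max_eq_right hr, max_eq_left (by linarith)]; ring
  set ν₁ := volume.withDensity fun x => ENNReal.ofReal (f x)
  set ν₂ := volume.withDensity fun x => ENNReal.ofReal (-f x)
  set μ₁ := volume.withDensity fun x => ENNReal.ofReal (g x)
  set μ₂ := volume.withDensity fun x => ENNReal.ofReal (-g x)
  have hnn : ∀ {k : ℝ → ℝ} {a b : ℝ}, a ≤ b → 0 ≤ ∫ x in a..b, max (k x) 0 := fun hab =>
    intervalIntegral.integral_nonneg hab fun _ _ => le_max_right _ _
  have hval : ∀ {k : ℝ → ℝ}, Measurable k → (∀ x, |k x| ≤ M) → ∀ {a b}, a ≤ b →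
      (volume.withDensity (fun x => ENNReal.ofReal (k x))).map Y (Ioc (Y a) (Y b))
        = ENNReal.ofReal (∫ x in a..b, max (k x) 0) := fun {k} hk hkM {a b} hab => by
    have hpre : Y ⁻¹' Ioc (Y a) (Y b) = Ioc a b := by
      ext x; simp [hY.lt_iff_lt, hY.le_iff_le]
    rw [Measure.map_apply hYm measurableSet_Ioc, hpre, withDensity_ofReal_Ioc hk hkM hab]
  have hsplit : ν₁ + μ₂.map Y = ν₂ + μ₁.map Y := by
    refine Measure.ext_of_Ioc' _ _ (fun c d hcd => ?_) fun c d hcd => ?_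
    · obtain ⟨a, rfl⟩ := hYs c
      obtain ⟨b, rfl⟩ := hYs d
      have hab := (hY.lt_iff_lt.1 hcd).le
      rw [Measure.add_apply, hval (k := fun x => -g x) hg.neg hgM' hab, withDensity_ofReal_Ioc hf hfM hcd.le]
      exact ENNReal.add_ne_top.2 ⟨ENNReal.ofReal_ne_top, ENNReal.ofReal_ne_top⟩
    · obtain ⟨a, rfl⟩ := hYs c
      obtain ⟨b, rfl⟩ := hYs d
      have hab := (hY.lt_iff_lt.1 hcd).le
      rw [Measure.add_apply, Measure.add_apply, hval (k := fun x => -g x) hg.neg hgM' hab, hval hg hgM hab,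
        withDensity_ofReal_Ioc hf hfM hcd.le, withDensity_ofReal_Ioc (f := fun x => -f x) hf.neg hfM' hcd.le,
        ← ENNReal.ofReal_add (hnn hcd.le) (hnn hab), ← ENNReal.ofReal_add (hnn hcd.le) (hnn hab)]
      congr 1
      have e1 := intervalIntegral.integral_sub (hkint hf hfM (Y a) (Y b))
        (hkint (k := fun x => -f x) hf.neg hfM' (Y a) (Y b))
      have e2 := intervalIntegral.integral_sub (hkint hg hgM a b) (hkint (k := fun x => -g x) hg.neg hgM' a b)
      simp only [hmax] at e1 e2
      linarith [h a b hab]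
  have hνs : ν₁.MutuallySingular ν₂ := withDensity_ofReal_mutuallySingular hf
  have hμs : (μ₁.map Y).MutuallySingular (μ₂.map Y) :=
    e.measurableEmbedding.mutuallySingular_map (withDensity_ofReal_mutuallySingular hg)
  have habs : ∀ {k : ℝ → ℝ}, Measurable k → (volume.withDensity fun x => ENNReal.ofReal |k x|)
      = volume.withDensity (fun x => ENNReal.ofReal (k x))
        + volume.withDensity fun x => ENNReal.ofReal (-k x) := fun {k} hk => by
    rw [← withDensity_add_left (by fun_prop)]
    congr 1
    ext x
    rcases le_total 0 (k x) with hx | hx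
    · simp [abs_of_nonneg hx, ENNReal.ofReal_of_nonpos (neg_nonpos.2 hx)]
    · simp [abs_of_nonpos hx, ENNReal.ofReal_of_nonpos hx]
  rw [habs hf, habs hg, Measure.map_add _ _ hYm]
  refine le_antisymm (add_le_add_of_mutuallySingular ?_ hμs)
    (add_le_add_of_mutuallySingular hsplit hνs)
  rw [add_comm, ← hsplit, add_comm]

theorem integral_mul_abs_comp {f g Y : ℝ → ℝ} (hf : Measurable f) (hg : Measurable g)
    (hY : StrictMono Y) (hYs : Surjective Y)
    (h : (volume.withDensity fun x => ENNReal.ofReal |g x|).map Y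
      = volume.withDensity fun x => ENNReal.ofReal |f x|) (k : ℝ → ℝ) :
    ∫ y, |f y| * k y = ∫ z, |g z| * k (Y z) := by
  have hemb : MeasurableEmbedding Y :=
    (hY.orderIsoOfSurjective Y hYs).toHomeomorph.measurableEmbedding
  have h1 := integral_withDensity_eq_integral_toReal_smul (μ := volume)
    (f := fun x => ENNReal.ofReal |f x|) (by fun_prop)
    (Eventually.of_forall fun _ => ENNReal.ofReal_lt_top) k
  have h2 := integral_withDensity_eq_integral_toReal_smul (μ := volume)
    (f := fun x => ENNReal.ofReal |g x|) (by fun_prop)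
    (Eventually.of_forall fun _ => ENNReal.ofReal_lt_top) fun z => k (Y z)
  rw [← h, hemb.integral_map, h2] at h1
  simpa [ENNReal.toReal_ofReal, abs_nonneg] using h1.symm

end MeasureTransport

section Lagrangian

/-- A nonnegative bounded density `p` transported from `p₀` by the flow `X` of the velocity field
`V (W)`, where `W` is the exponential average of `p`. -/
structure IsLagrangian (T η M : ℝ) (V p₀ : ℝ → ℝ) (p X : ℝ → ℝ → ℝ) : Prop where
  T_pos : 0 < T
  η_pos : 0 < η
  contV : Continuous V
  monoV : Monotone V
  meas : ∀ t, Measurable (p t)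
  nonneg : ∀ t x, 0 ≤ p t x
  le : ∀ t x, p t x ≤ M
  meas₀ : Measurable p₀
  nonneg₀ : ∀ x, 0 ≤ p₀ x
  le₀ : ∀ x, p₀ x ≤ M
  flow : IsFlow T (fun t x => V (expAvg η (p (clampIcc T t)) x)) X
  push : ∀ t ∈ Icc 0 T, ∀ k : ℝ → ℝ, ∫ y, p t y * k y = ∫ z, p₀ z * k (X t z)

namespace IsLagrangian

variable {T η M : ℝ} {V p₀ : ℝ → ℝ} {p X : ℝ → ℝ → ℝ}

theorem abs_le (h : IsLagrangian T η M V p₀ p X) (t x : ℝ) : |p t x| ≤ M := by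
  rw [abs_of_nonneg (h.nonneg t x)]; exact h.le t x

theorem expAvg_mem (h : IsLagrangian T η M V p₀ p X) (t x : ℝ) : expAvg η (p t) x ∈ Icc 0 M :=
  ⟨expAvg_nonneg (h.nonneg t) η x, (le_abs_self _).trans (abs_expAvg_le (h.meas t) (h.abs_le t) η x)⟩

theorem continuous_expAvg (h : IsLagrangian T η M V p₀ p X) (t : ℝ) :
    Continuous (expAvg η (p t)) :=
  (lipschitzWith_expAvg h.η_pos (h.meas t) (h.abs_le t)).continuous

theorem abs_velocity_le (h : IsLagrangian T η M V p₀ p X) (t x : ℝ) :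
    |V (expAvg η (p t) x)| ≤ max |V (-M)| |V M| :=
  abs_le_of_monotone h.monoV (abs_expAvg_le (h.meas t) (h.abs_le t) η x)

theorem expAvg_mul_flow (h : IsLagrangian T η M V p₀ p X) {t : ℝ} (ht : t ∈ Icc 0 T) (f : ℝ → ℝ)
    (ξ : ℝ) : expAvg η (fun y => f y * p t y) (X t ξ)
      = ∫ z in Iic ξ, expKernel η (X t z - X t ξ) * f (X t z) * p₀ z := by
  rw [expAvg_eq_integral_Iic h.η_pos, ← integral_indicator measurableSet_Iic,
    ← integral_indicator measurableSet_Iic]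
  have := h.push t ht ((Iic (X t ξ)).indicator fun y => expKernel η (y - X t ξ) * f y)
  convert this using 2
  · ext y
    by_cases hy : y ∈ Iic (X t ξ)
    · simp only [indicator_of_mem hy]; ring
    · simp only [indicator_of_notMem hy, mul_zero]
  · ext z
    by_cases hz : z ∈ Iic ξ
    · have hz' : X t z ∈ Iic (X t ξ) := (h.flow.mono t ht).monotone hz
      simp only [indicator_of_mem hz, indicator_of_mem hz']; ring
    · have hz' : X t z ∉ Iic (X t ξ) := fun hc => hz ((h.flow.mono t ht).le_iff_le.1 hc)
      simp only [indicator_of_notMem hz, indicator_of_notMem hz', mul_zero]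

theorem expAvg_flow (h : IsLagrangian T η M V p₀ p X) {t : ℝ} (ht : t ∈ Icc 0 T) (ξ : ℝ) :
    expAvg η (p t) (X t ξ) = ∫ z in Iic ξ, expKernel η (X t z - X t ξ) * p₀ z := by
  simpa using h.expAvg_mul_flow ht (fun _ => 1) ξ

theorem expAvg_zero (h : IsLagrangian T η M V p₀ p X) (ξ : ℝ) :
    expAvg η (p 0) ξ = expAvg η p₀ ξ := by
  have := h.expAvg_flow (left_mem_Icc.2 h.T_pos.le) ξ
  simp only [h.flow.zero] at this
  rw [this, expAvg_eq_integral_Iic h.η_pos]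

theorem flow_sub_le (h : IsLagrangian T η M V p₀ p X) {t : ℝ} (ht : t ∈ Icc 0 T) (z ξ : ℝ) :
    X t z - X t ξ ≤ z - ξ + 2 * max |V (-M)| |V M| * T := by
  have h1 := h.flow.abs_sub_le (fun t x => h.abs_velocity_le (clampIcc T t) x) z 0 t
  have h2 := h.flow.abs_sub_le (fun t x => h.abs_velocity_le (clampIcc T t) x) ξ 0 t
  rw [h.flow.zero, sub_zero, abs_of_nonneg ht.1] at h1 h2
  have h3 : max |V (-M)| |V M| * t ≤ max |V (-M)| |V M| * T :=
    mul_le_mul_of_nonneg_left ht.2 ((abs_nonneg _).trans (le_max_left _ _))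
  linarith [(_root_.abs_le.1 h1).2, (_root_.abs_le.1 h2).1]

/-- The dominating function of the differentiation under the integral sign. -/
theorem expKernel_flow_le (h : IsLagrangian T η M V p₀ p X) {t : ℝ} (ht : t ∈ Icc 0 T) (z ξ : ℝ) :
    expKernel η (X t z - X t ξ) ≤
      Real.exp ((2 * max |V (-M)| |V M| * T - ξ) / η) * (Real.exp (z / η) / η) := by
  rw [expKernel, ← mul_div_assoc, ← Real.exp_add, ← add_div]
  have hη := h.η_pos
  gcongr
  linarith [h.flow_sub_le ht z ξ]

theorem continuousOn_expAvg_flow (h : IsLagrangian T η M V p₀ p X) (ξ : ℝ) :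
    ContinuousOn (fun t => expAvg η (p t) (X t ξ)) (Icc 0 T) := by
  have hη := h.η_pos
  have hm₀ := h.meas₀
  refine ContinuousOn.congr ?_ fun t ht => h.expAvg_flow ht ξ
  intro t ht
  refine continuousWithinAt_of_dominated (bound := fun z =>
    Real.exp ((2 * max |V (-M)| |V M| * T - ξ) / η) * (Real.exp (z / η) / η * p₀ z)) ?_ ?_ ?_ ?_
  · filter_upwards [self_mem_nhdsWithin] with s hs
    have := (h.flow.continuous_space hs).measurable
    unfold expKernel
    fun_prop
  · filter_upwards [self_mem_nhdsWithin] with s hs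
    refine Eventually.of_forall fun z => ?_
    have h0 : 0 ≤ expKernel η (X s z - X s ξ) := by unfold expKernel; positivity
    rw [Real.norm_eq_abs, abs_of_nonneg (mul_nonneg h0 (h.nonneg₀ z)), ← mul_assoc]
    exact mul_le_mul_of_nonneg_right (h.expKernel_flow_le hs z ξ) (h.nonneg₀ z)
  · exact (integrableOn_exp_div_mul_Iic hη h.meas₀
      (fun x => by rw [abs_of_nonneg (h.nonneg₀ x)]; exact h.le₀ x) ξ).const_mul _
  · refine Eventually.of_forall fun z => Continuous.continuousWithinAt ?_
    have h1 := h.flow.continuous_time z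
    have h2 := h.flow.continuous_time ξ
    unfold expKernel
    fun_prop

/-- Along characteristics the nonlocal term solves
`∂ₜ w = (A[G(W)] - G(W)) / η` with `G = fluxG V`. -/
theorem hasDerivAt_expAvg_flow (h : IsLagrangian T η M V p₀ p X) {t : ℝ} (ht : t ∈ Ioo 0 T)
    (ξ : ℝ) : HasDerivAt (fun t => expAvg η (p t) (X t ξ))
      ((expAvg η (fun y => fluxG V (expAvg η (p t) y)) (X t ξ)
        - fluxG V (expAvg η (p t) (X t ξ))) / η) t := by
  have hη := h.η_pos
  have hm₀ := h.meas₀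
  set L := max |V (-M)| |V M| with hL
  have hIoo : Ioo 0 T ∈ nhds t := Ioo_mem_nhds ht.1 ht.2
  have ht' := Ioo_subset_Icc_self ht
  set F : ℝ → ℝ → ℝ := fun s z => expKernel η (X s z - X s ξ) * p₀ z
  set F' : ℝ → ℝ → ℝ := fun s z => expKernel η (X s z - X s ξ) *
    ((V (expAvg η (p s) (X s z)) - V (expAvg η (p s) (X s ξ))) / η) * p₀ z
  have hdom := integrableOn_exp_div_mul_Iic hη h.meas₀
      (fun x => by rw [abs_of_nonneg (h.nonneg₀ x)]; exact h.le₀ x) ξ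
  have hk0 : ∀ r, 0 ≤ expKernel η r := fun r => by unfold expKernel; positivity
  have hFmeas : ∀ s ∈ Icc 0 T, AEStronglyMeasurable (F s) (volume.restrict (Iic ξ)) := by
    intro s hs
    have := (h.flow.continuous_space hs).measurable
    simp only [F, expKernel]
    fun_prop
  have key := (hasDerivAt_integral_of_dominated_loc_of_deriv_le (μ := volume.restrict (Iic ξ))
    (F := F) (F' := F') (x₀ := t) (s := Ioo 0 T) (bound := fun z => 2 * L / η *
    (Real.exp ((2 * L * T - ξ) / η) * (Real.exp (z / η) / η * p₀ z))) hIoo ?_ ?_ ?_ ?_ ?_ ?_).2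
  · have hev : (fun t => expAvg η (p t) (X t ξ)) =ᶠ[nhds t] fun s => ∫ z in Iic ξ, F s z := by
      filter_upwards [hIoo] with s hs using h.expAvg_flow (Ioo_subset_Icc_self hs) ξ
    refine (key.congr_of_eventuallyEq hev).congr_deriv ?_
    have e1 := h.expAvg_mul_flow ht' (fun y => (V (expAvg η (p t) y)
      - V (expAvg η (p t) (X t ξ))) / η) ξ
    have hVW : Measurable fun y => V (expAvg η (p t) y) :=
      (h.contV.comp (h.continuous_expAvg t)).measurable
    have e2 := expAvg_sub (f := fun y => V (expAvg η (p t) y) * p t y)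
      (g := fun y => V (expAvg η (p t) (X t ξ)) * p t y) (M := L * M) (N := L * M)
      (hVW.mul (h.meas t)) (fun x => by
        rw [abs_mul]
        exact mul_le_mul (h.abs_velocity_le t x) (h.abs_le t x) (abs_nonneg _)
          ((abs_nonneg _).trans (h.abs_velocity_le t x)))
      ((h.meas t).const_mul _) (fun x => by
        rw [abs_mul]
        exact mul_le_mul (h.abs_velocity_le t _) (h.abs_le t x) (abs_nonneg _)
          ((abs_nonneg _).trans (h.abs_velocity_le t x))) η (X t ξ)
    have e3 := expAvg_mul_eq hη h.contV h.monoV (h.meas t) (h.abs_le t) (X t ξ)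
    have hcm : ∀ (c : ℝ) (f : ℝ → ℝ) (x : ℝ), expAvg η (fun y => c * f y) x = c * expAvg η f x := by
      intro c f x
      simp only [expAvg, ← integral_const_mul]
      congr 1; ext r; ring
    have e4 : (fun y => (V (expAvg η (p t) y) - V (expAvg η (p t) (X t ξ))) / η * p t y)
        = fun y => η⁻¹ * (V (expAvg η (p t) y) * p t y
          - V (expAvg η (p t) (X t ξ)) * p t y) := by
      ext y; field_simp
    simp only [F']
    rw [← e1, e4, hcm, e2, e3, hcm, fluxG]
    field_simp
    ring
  · filter_upwards [hIoo] with s hs using hFmeas s (Ioo_subset_Icc_self hs)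
  · refine Integrable.mono' (hdom.const_mul (Real.exp ((2 * L * T - ξ) / η))) (hFmeas t ht')
      (Eventually.of_forall fun z => ?_)
    rw [Real.norm_eq_abs, abs_of_nonneg (mul_nonneg (hk0 _) (h.nonneg₀ z)), ← mul_assoc]
    exact mul_le_mul_of_nonneg_right (h.expKernel_flow_le ht' z ξ) (h.nonneg₀ z)
  · have h1 := (h.flow.continuous_space ht').measurable
    have h2 : Measurable fun z => V (expAvg η (p t) (X t z)) :=
      (h.contV.comp ((h.continuous_expAvg t).comp (h.flow.continuous_space ht'))).measurable
    have h3 : Measurable fun z => expKernel η (X t z - X t ξ) := by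
      unfold expKernel
      fun_prop
    exact ((h3.mul ((h2.sub_const _).div_const η)).mul hm₀).aestronglyMeasurable
  · refine Eventually.of_forall fun z s hs => ?_
    have hv : |(V (expAvg η (p s) (X s z)) - V (expAvg η (p s) (X s ξ))) / η| ≤ 2 * L / η := by
      rw [abs_div, abs_of_pos hη]
      gcongr
      have h1 := h.abs_velocity_le s (X s z)
      have h2 := h.abs_velocity_le s (X s ξ)
      exact (abs_sub _ _).trans (by linarith)
    rw [Real.norm_eq_abs, abs_mul, abs_mul, abs_of_nonneg (hk0 _), abs_of_nonneg (h.nonneg₀ z)]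
    calc _ ≤ Real.exp ((2 * L * T - ξ) / η) * (Real.exp (z / η) / η) * (2 * L / η) * p₀ z := by
          refine mul_le_mul_of_nonneg_right (mul_le_mul (h.expKernel_flow_le
            (Ioo_subset_Icc_self hs) z ξ) hv (abs_nonneg _) (by positivity)) (h.nonneg₀ z)
      _ = _ := by ring
  · exact (hdom.const_mul _).const_mul _
  · refine Eventually.of_forall fun z s hs => ?_
    have hs' := Ioo_subset_Icc_self hs
    have hz := h.flow.hasDerivAt hs' z
    have hx := h.flow.hasDerivAt hs' ξ
    rw [clampIcc_of_mem hs'] at hz hx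
    have := ((((hz.sub hx).div_const η).exp).div_const η).mul_const (p₀ z)
    refine this.congr_deriv ?_
    simp only [F', expKernel, Pi.sub_apply]
    ring

end IsLagrangian
end Lagrangian

section Comparison

theorem le_of_hasDerivAt_le {f f' : ℝ → ℝ} {T A B Λ : ℝ} (hc : ContinuousOn f (Icc 0 T))
    (hd : ∀ t ∈ Ioo 0 T, HasDerivAt f (f' t) t) (hle : ∀ t ∈ Ioo 0 T, f' t ≤ Λ * (B - f t))
    (h0 : f 0 ≤ A) (hAB : A ≤ B) (hΛ : 0 ≤ Λ) {t : ℝ} (ht : t ∈ Icc 0 T) :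
    f t ≤ B - (B - A) * Real.exp (-(Λ * T)) := by
  have hanti : AntitoneOn (fun s => (f s - B) * Real.exp (Λ * s)) (Icc 0 T) := by
    refine antitoneOn_of_hasDerivWithinAt_nonpos (convex_Icc 0 T)
      (f' := fun s => f' s * Real.exp (Λ * s) + (f s - B) * (Real.exp (Λ * s) * Λ))
      ((hc.sub continuousOn_const).mul (by fun_prop)) ?_ ?_
    · intro s hs
      rw [interior_Icc] at hs
      have h1 : HasDerivAt (fun s => Real.exp (Λ * s)) (Real.exp (Λ * s) * Λ) s := by
        simpa using ((hasDerivAt_id s).const_mul Λ).exp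
      exact (((hd s hs).sub_const B).mul h1).hasDerivWithinAt
    · intro s hs
      rw [interior_Icc] at hs
      have h1 := mul_le_mul_of_nonneg_right (hle s hs) (Real.exp_pos (Λ * s)).le
      linarith
  have h1 := hanti (left_mem_Icc.2 (ht.1.trans ht.2)) ht ht.1
  simp only [mul_zero, Real.exp_zero, mul_one] at h1
  have h2 : (f t - B) ≤ (f 0 - B) * Real.exp (-(Λ * t)) := by
    have := mul_le_mul_of_nonneg_right h1 (Real.exp_pos (-(Λ * t))).le
    rwa [mul_assoc, ← Real.exp_add, add_neg_cancel, Real.exp_zero, mul_one] at this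
  have h3 : Real.exp (-(Λ * T)) ≤ Real.exp (-(Λ * t)) := by
    gcongr
    exact ht.2
  have h4 := mul_le_mul_of_nonneg_left h3 (sub_nonneg.2 hAB)
  have h5 := mul_le_mul_of_nonneg_right (sub_le_sub_right h0 B) (Real.exp_pos (-(Λ * t))).le
  linarith

theorem integrableOn_exp_neg_mul_affine (P Q : ℝ) :
    IntegrableOn (fun r => Real.exp (-r) * (P + Q * r)) (Ioi 0) := by
  have h := Real.GammaIntegral_convergent (s := 2) (by norm_num)
  refine ((integrableOn_exp_neg_Ioi 0).mul_const P |>.add (h.mul_const Q)).congr ?_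
  filter_upwards with r
  simp only [Pi.add_apply]
  norm_num
  ring

theorem integral_exp_neg_mul_affine (P Q : ℝ) :
    ∫ r in Ioi 0, Real.exp (-r) * (P + Q * r) = P + Q := by
  have h := Real.GammaIntegral_convergent (s := 2) (by norm_num)
  have e : ∀ r : ℝ, Real.exp (-r) * (P + Q * r)
      = Real.exp (-r) * P + Real.exp (-r) * r ^ ((2:ℝ) - 1) * Q := fun r => by norm_num; ring
  simp only [e]
  rw [integral_add ((integrableOn_exp_neg_Ioi 0).mul_const P) (h.mul_const Q),
    integral_mul_const, integral_mul_const, integral_exp_neg_Ioi_zero,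
    ← Real.Gamma_eq_integral (by norm_num), Real.Gamma_two, one_mul, one_mul]

theorem sum_expAvg_sub_le {g : ℝ → ℝ} {N η P Q : ℝ} (hg : Measurable g) (hN : ∀ x, |g x| ≤ N)
    (n : ℕ) (σ x : ℕ → ℝ) (h : ∀ r > 0, ∑ i ∈ Finset.range n,
      σ i * (g (x (i + 1) - η * r) - g (x i - η * r)) ≤ P + Q * r) :
    ∑ i ∈ Finset.range n, σ i * (expAvg η g (x (i + 1)) - expAvg η g (x i)) ≤ P + Q := by
  have hi : ∀ i, IntegrableOn (fun r => σ i * (Real.exp (-r) * g (x (i + 1) - η * r)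
      - Real.exp (-r) * g (x i - η * r))) (Ioi 0) := fun i =>
    ((integrableOn_expAvg hg hN η _).sub (integrableOn_expAvg hg hN η _)).const_mul _
  have e : ∑ i ∈ Finset.range n, σ i * (expAvg η g (x (i + 1)) - expAvg η g (x i))
      = ∫ r in Ioi 0, ∑ i ∈ Finset.range n, σ i * (Real.exp (-r) * g (x (i + 1) - η * r)
      - Real.exp (-r) * g (x i - η * r)) := by
    rw [integral_finsetSum _ fun i _ => hi i]
    refine Finset.sum_congr rfl fun i _ => ?_
    rw [integral_const_mul, integral_sub (integrableOn_expAvg hg hN η _)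
      (integrableOn_expAvg hg hN η _), expAvg, expAvg]
  rw [e, ← integral_exp_neg_mul_affine P Q]
  refine setIntegral_mono_on (integrable_finsetSum _ fun i _ => hi i)
    (integrableOn_exp_neg_mul_affine P Q) measurableSet_Ioi fun r hr => ?_
  refine le_trans (le_of_eq ?_) (mul_le_mul_of_nonneg_left (h r hr) (Real.exp_pos (-r)).le)
  rw [Finset.mul_sum]
  exact Finset.sum_congr rfl fun i _ => by ring

end Comparison

section Variation

theorem eVariationOn_le_ofReal {f : ℝ → ℝ} {s : Set ℝ} {C : ℝ}
    (h : ∀ (n : ℕ) (u : ℕ → ℝ), Monotone u → (∀ i, u i ∈ s) →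
      ∑ i ∈ Finset.range n, |f (u (i + 1)) - f (u i)| ≤ C) :
    eVariationOn f s ≤ ENNReal.ofReal C := by
  refine iSup_le fun ⟨n, u, hu, hus⟩ => ?_
  refine le_trans (le_of_eq ?_) (ENNReal.ofReal_le_ofReal (h n u hu hus))
  rw [ENNReal.ofReal_sum_of_nonneg fun _ _ => abs_nonneg _]
  simp only [edist_dist, Real.dist_eq]

theorem sum_abs_sub_le_of_eVariationOn_le {f : ℝ → ℝ} {s : Set ℝ} {C : ℝ} (hC : 0 ≤ C)
    (h : eVariationOn f s ≤ ENNReal.ofReal C) (n : ℕ) {u : ℕ → ℝ} (hu : Monotone u)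
    (hus : ∀ i ≤ n, u i ∈ s) : ∑ i ∈ Finset.range n, |f (u (i + 1)) - f (u i)| ≤ C := by
  have h1 := (eVariationOn.sum_le_of_monotoneOn_Iic (f := f) (n := n) (hu.monotoneOn _)
    (fun i hi => hus i hi)).trans h
  simp only [edist_dist, Real.dist_eq] at h1
  rwa [← ENNReal.ofReal_sum_of_nonneg fun _ _ => abs_nonneg _,
    ENNReal.ofReal_le_ofReal_iff hC] at h1

theorem eVariationOn_add_edist_le {f g h : ℝ → ℝ}
    (H : ∀ x y, edist (f x) (f y) + edist (g x) (g y) ≤ edist (h x) (h y)) {x y : ℝ}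
    (hxy : x ≤ y) : eVariationOn f (Icc x y) + edist (g y) (g x) ≤ eVariationOn h (Icc x y) := by
  have : Nonempty (ℕ × { u : ℕ → ℝ // Monotone u ∧ ∀ i, u i ∈ Icc x y }) :=
    ⟨0, fun _ => x, monotone_const, fun _ => left_mem_Icc.2 hxy⟩
  rw [eVariationOn, ENNReal.iSup_add]
  refine iSup_le fun ⟨n, u, hu, hus⟩ => ?_
  have hu0 := hus 0
  have hun := hus n
  have h0n : u 0 ≤ u n := hu (Nat.zero_le n)
  have hmid : ∑ i ∈ Finset.range n, (edist (f (u (i + 1))) (f (u i))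
      + edist (g (u (i + 1))) (g (u i))) ≤ eVariationOn h (Icc (u 0) (u n)) := by
    refine (Finset.sum_le_sum fun i _ => H (u (i + 1)) (u i)).trans ?_
    exact eVariationOn.sum_le_of_monotoneOn_Iic (hu.monotoneOn _)
      fun i hi => ⟨hu (Nat.zero_le i), hu hi⟩
  have hg : edist (g y) (g x) ≤ edist (g (u 0)) (g x) + (∑ i ∈ Finset.range n,
      edist (g (u (i + 1))) (g (u i))) + edist (g y) (g (u n)) := by
    have h1 : edist (g (u n)) (g (u 0)) ≤ ∑ i ∈ Finset.range n, edist (g (u (i + 1))) (g (u i)) := by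
      rw [edist_comm]
      simpa only [edist_comm] using edist_le_range_sum_edist (fun i => g (u i)) n
    calc edist (g y) (g x) ≤ edist (g y) (g (u n)) + edist (g (u n)) (g (u 0))
          + edist (g (u 0)) (g x) := edist_triangle4 _ _ _ _
      _ ≤ edist (g y) (g (u n)) + (∑ i ∈ Finset.range n, edist (g (u (i + 1))) (g (u i)))
          + edist (g (u 0)) (g x) := by gcongr
      _ = _ := by ring
  have hl : edist (g (u 0)) (g x) ≤ eVariationOn h (Icc x (u 0)) :=
    (le_add_self.trans (H (u 0) x)).trans
      (eVariationOn.edist_le _ (right_mem_Icc.2 hu0.1) (left_mem_Icc.2 hu0.1))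
  have hr : edist (g y) (g (u n)) ≤ eVariationOn h (Icc (u n) y) :=
    (le_add_self.trans (H y (u n))).trans
      (eVariationOn.edist_le _ (right_mem_Icc.2 hun.2) (left_mem_Icc.2 hun.2))
  have e1 := eVariationOn.Icc_add_Icc h (s := univ) hu0.1 h0n (mem_univ _)
  have e2 := eVariationOn.Icc_add_Icc h (s := univ) (hu0.1.trans h0n) hun.2 (mem_univ _)
  simp only [univ_inter] at e1 e2
  rw [← e2, ← e1]
  calc _ ≤ (∑ i ∈ Finset.range n, edist (f (u (i + 1))) (f (u i))) + (edist (g (u 0)) (g x)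
      + (∑ i ∈ Finset.range n, edist (g (u (i + 1))) (g (u i))) + edist (g y) (g (u n))) :=
        add_le_add_right hg _
    _ = edist (g (u 0)) (g x) + (∑ i ∈ Finset.range n, (edist (f (u (i + 1))) (f (u i))
      + edist (g (u (i + 1))) (g (u i)))) + edist (g y) (g (u n)) := by
        rw [Finset.sum_add_distrib]; ring
    _ ≤ _ := add_le_add (add_le_add hl hmid) hr

theorem eVariationOn_add_sum_edist_le {f g h : ℝ → ℝ}
    (H : ∀ x y, edist (f x) (f y) + edist (g x) (g y) ≤ edist (h x) (h y)) {c : ℝ} {u : ℕ → ℝ}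
    (hu : Monotone u) (hc : c ≤ u 0) (n : ℕ) : eVariationOn f (Icc c (u n))
      + ∑ i ∈ Finset.range n, edist (g (u (i + 1))) (g (u i)) ≤ eVariationOn h (Icc c (u n)) := by
  induction n with
  | zero =>
    simpa using le_self_add.trans (eVariationOn_add_edist_le H hc)
  | succ n ih =>
    have hcn : c ≤ u n := hc.trans (hu (Nat.zero_le n))
    have hs : u n ≤ u (n + 1) := hu (Nat.le_succ n)
    have e1 := eVariationOn.Icc_add_Icc h (s := univ) hcn hs (mem_univ _)
    have e2 := eVariationOn.Icc_add_Icc f (s := univ) hcn hs (mem_univ _)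
    simp only [univ_inter] at e1 e2
    rw [← e1, ← e2, Finset.sum_range_succ, add_add_add_comm]
    exact add_le_add ih (eVariationOn_add_edist_le H hs)

end Variation

namespace IsLagrangian

variable {T η M : ℝ} {V p₀ : ℝ → ℝ} {p X : ℝ → ℝ → ℝ} {K : NNReal}

theorem bound_nonneg (h : IsLagrangian T η M V p₀ p X) : 0 ≤ M :=
  (h.nonneg₀ 0).trans (h.le₀ 0)

theorem continuous_fluxG_expAvg (h : IsLagrangian T η M V p₀ p X) (t : ℝ) :
    Continuous fun y => fluxG V (expAvg η (p t) y) :=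
  (continuous_fluxG h.contV).comp (h.continuous_expAvg t)

theorem abs_fluxG_expAvg_le (h : IsLagrangian T η M V p₀ p X) (t y : ℝ) :
    |fluxG V (expAvg η (p t) y)| ≤ fluxG V M := by
  have hm := h.expAvg_mem t y
  have h0 : 0 ≤ fluxG V (expAvg η (p t) y) := by
    simpa [fluxG] using fluxG_mono h.contV h.monoV le_rfl hm.1
  rw [abs_of_nonneg h0]
  exact fluxG_mono h.contV h.monoV hm.1 hm.2

theorem expAvg_le (h : IsLagrangian T η M V p₀ p X) (hK : LipschitzOnWith K V (Icc 0 M)) {M₀ : ℝ}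
    (hM₀ : ∀ x, p₀ x ≤ M₀) {t : ℝ} (ht : t ∈ Icc 0 T) (x : ℝ) : expAvg η (p t) x ≤ M₀ := by
  have hη := h.η_pos
  have h0T := left_mem_Icc.2 h.T_pos.le
  set S : Set ℝ := {w | ∃ t ∈ Icc 0 T, ∃ x, w = expAvg η (p t) x}
  have hbdd : BddAbove S := ⟨M, by rintro _ ⟨t, -, x, rfl⟩; exact (h.expAvg_mem t x).2⟩
  have hne : S.Nonempty := ⟨_, 0, h0T, 0, rfl⟩
  have hmem : ∀ t ∈ Icc 0 T, ∀ x, expAvg η (p t) x ≤ sSup S :=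
    fun t ht x => le_csSup hbdd ⟨t, ht, x, rfl⟩
  have hBM : sSup S ≤ M := csSup_le hne (by rintro _ ⟨t, -, x, rfl⟩; exact (h.expAvg_mem t x).2)
  have hB0 : 0 ≤ sSup S := (h.expAvg_mem 0 0).1.trans (hmem 0 h0T 0)
  refine (hmem t ht x).trans ?_
  by_contra! hcon
  set κ := Real.exp (-(M * K / η * T))
  have hκ : 0 < κ := Real.exp_pos _
  have hΛ : 0 ≤ M * K / η := by have := h.bound_nonneg; positivity
  have hstep : sSup S ≤ sSup S - (sSup S - M₀) * κ := by
    refine csSup_le hne ?_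
    rintro _ ⟨t, ht, x, rfl⟩
    obtain ⟨ξ, rfl⟩ := h.flow.surj t ht x
    refine le_of_hasDerivAt_le (h.continuousOn_expAvg_flow ξ)
      (fun s hs => h.hasDerivAt_expAvg_flow hs ξ) (fun s hs => ?_) ?_ hcon.le hΛ ht
    · have hs' := Ioo_subset_Icc_self hs
      have h1 : expAvg η (fun y => fluxG V (expAvg η (p s) y)) (X s ξ) ≤ fluxG V (sSup S) := by
        rw [← expAvg_const η (fluxG V (sSup S)) (X s ξ)]
        exact expAvg_mono (h.continuous_fluxG_expAvg s).measurable (h.abs_fluxG_expAvg_le s)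
          measurable_const (fun _ => le_rfl)
          (fun y => fluxG_mono h.contV h.monoV (h.expAvg_mem s y).1 (hmem s hs' y)) η _
      have h2 := fluxG_sub_le h.contV h.monoV hK (h.expAvg_mem s (X s ξ)).1 (hmem s hs' _) hBM
      calc _ ≤ M * K * (sSup S - expAvg η (p s) (X s ξ)) / η := by gcongr; linarith
        _ = _ := by ring
    · simp only [h.flow.zero, h.expAvg_zero]
      rw [← expAvg_const η M₀ ξ]
      exact expAvg_mono h.meas₀ (fun x => by rw [abs_of_nonneg (h.nonneg₀ x)]; exact h.le₀ x)
        measurable_const (fun _ => le_rfl) hM₀ η _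
  nlinarith [mul_pos (sub_pos.2 hcon) hκ]

/-- The variation of `W` splits into those of the comonotone functions `G(W)` and
`M K W - G(W)`. -/
theorem edist_fluxG_add_le (h : IsLagrangian T η M V p₀ p X) (hK : LipschitzOnWith K V (Icc 0 M))
    (t x y : ℝ) : edist (fluxG V (expAvg η (p t) x)) (fluxG V (expAvg η (p t) y))
      + edist (M * K * expAvg η (p t) x - fluxG V (expAvg η (p t) x))
        (M * K * expAvg η (p t) y - fluxG V (expAvg η (p t) y))
      ≤ edist (M * K * expAvg η (p t) x) (M * K * expAvg η (p t) y) := by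
  simp only [edist_dist, Real.dist_eq]
  rw [← ENNReal.ofReal_add (abs_nonneg _) (abs_nonneg _)]
  refine ENNReal.ofReal_le_ofReal (le_of_eq ?_)
  set a := expAvg η (p t) x with ha
  set b := expAvg η (p t) y with hb
  have hma := h.expAvg_mem t x
  have hmb := h.expAvg_mem t y
  rw [← ha] at hma
  rw [← hb] at hmb
  rcases le_total a b with hab | hab
  · have h1 := fluxG_mono h.contV h.monoV hma.1 hab
    have h2 := fluxG_sub_le h.contV h.monoV hK hma.1 hab hmb.2
    rw [abs_of_nonpos (by linarith), abs_of_nonpos (by linarith), abs_of_nonpos (by linarith)]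
    ring
  · have h1 := fluxG_mono h.contV h.monoV hmb.1 hab
    have h2 := fluxG_sub_le h.contV h.monoV hK hmb.1 hab hma.2
    rw [abs_of_nonneg (by linarith), abs_of_nonneg (by linarith), abs_of_nonneg (by linarith)]
    ring

theorem sum_fluxG_le (h : IsLagrangian T η M V p₀ p X) (hK : LipschitzOnWith K V (Icc 0 M))
    {t c D r : ℝ} (hr : 0 ≤ r) (n : ℕ) {σ x : ℕ → ℝ} (hσ : ∀ i, |σ i| ≤ 1) (hx : Monotone x)
    (hc : c = x 0 - r) (hD0 : 0 ≤ D)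
    (hD : eVariationOn (expAvg η (p t)) (Icc c (x n)) ≤ ENNReal.ofReal D) :
    ∑ i ∈ Finset.range n, σ i * (fluxG V (expAvg η (p t) (x (i + 1) - r))
        - fluxG V (expAvg η (p t) (x i - r)))
      + ∑ i ∈ Finset.range n, σ i *
        ((M * K * expAvg η (p t) (x (i + 1)) - fluxG V (expAvg η (p t) (x (i + 1))))
          - (M * K * expAvg η (p t) (x i) - fluxG V (expAvg η (p t) (x i)))) ≤ M * K * D := by
  have hMK : 0 ≤ M * K := mul_nonneg h.bound_nonneg K.2
  set W := expAvg η (p t)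
  have hcx : c ≤ x 0 := by linarith
  have hmain := eVariationOn_add_sum_edist_le (h.edist_fluxG_add_le hK t) hx hcx n
  have hlip : eVariationOn (fun y => M * K * W y) (Icc c (x n)) ≤ ENNReal.ofReal (M * K * D) := by
    refine eVariationOn_le_ofReal fun m u hu hus => ?_
    have h1 := sum_abs_sub_le_of_eVariationOn_le hD0 hD m hu fun i _ => hus i
    calc _ = M * K * ∑ i ∈ Finset.range m, |W (u (i + 1)) - W (u i)| := by
          rw [Finset.mul_sum]
          refine Finset.sum_congr rfl fun i _ => ?_
          rw [← mul_sub, abs_mul, abs_of_nonneg hMK]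
      _ ≤ _ := mul_le_mul_of_nonneg_left h1 hMK
  have hshift : ∑ i ∈ Finset.range n, edist (fluxG V (W (x (i + 1) - r))) (fluxG V (W (x i - r)))
      ≤ eVariationOn (fun y => fluxG V (W y)) (Icc c (x n)) :=
    eVariationOn.sum_le_of_monotoneOn_Iic (f := fun y => fluxG V (W y)) (u := fun i => x i - r)
      (fun i _ j _ hij => sub_le_sub_right (hx hij) r)
      fun i hi => ⟨by rw [hc]; exact sub_le_sub_right (hx (Nat.zero_le i)) r,
        (sub_le_self _ hr).trans (hx hi)⟩
  have hfin := (add_le_add_left hshift _).trans (hmain.trans hlip)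
  simp only [edist_dist, Real.dist_eq] at hfin
  rw [← ENNReal.ofReal_sum_of_nonneg fun _ _ => abs_nonneg _,
    ← ENNReal.ofReal_sum_of_nonneg fun _ _ => abs_nonneg _,
    ← ENNReal.ofReal_add (Finset.sum_nonneg fun _ _ => abs_nonneg _)
      (Finset.sum_nonneg fun _ _ => abs_nonneg _),
    ENNReal.ofReal_le_ofReal_iff (mul_nonneg hMK hD0)] at hfin
  have hσm : ∀ i a, σ i * a ≤ |a| := fun i a =>
    (le_abs_self _).trans (by rw [abs_mul]; exact mul_le_of_le_one_left (abs_nonneg _) (hσ i))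
  exact (add_le_add (Finset.sum_le_sum fun i _ => hσm i _)
    (Finset.sum_le_sum fun i _ => hσm i _)).trans hfin

theorem eVariationOn_flow_le (h : IsLagrangian T η M V p₀ p X)
    (hK : LipschitzOnWith K V (Icc 0 M)) {a b B C B₀ : ℝ} (hB : 0 ≤ B) (hC : 0 ≤ C)
    (hB₀ : eVariationOn (expAvg η p₀) univ ≤ ENNReal.ofReal B₀) (hB₀0 : 0 ≤ B₀)
    (hle : B₀ ≤ B + C)
    (hvar : ∀ t ∈ Icc 0 T, ∀ s, 0 ≤ s → eVariationOn (expAvg η (p t))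
      (Icc (X t a - η * s) (X t b)) ≤ ENNReal.ofReal (B + C * s)) {t : ℝ} (ht : t ∈ Icc 0 T) :
    eVariationOn (expAvg η (p t)) (Icc (X t a) (X t b))
      ≤ ENNReal.ofReal (B + C - (B + C - B₀) * Real.exp (-(M * K / η * T))) := by
  have hη := h.η_pos
  refine eVariationOn_le_ofReal fun n u hu hus => ?_
  choose y hy using fun i => h.flow.surj t ht (u i)
  have hym : Monotone y := fun i j hij =>
    (h.flow.mono t ht).le_iff_le.1 (by rw [hy, hy]; exact hu hij)
  have hyab : ∀ i, y i ∈ Icc a b := fun i =>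
    ⟨(h.flow.mono t ht).le_iff_le.1 (by rw [hy]; exact (hus i).1),
      (h.flow.mono t ht).le_iff_le.1 (by rw [hy]; exact (hus i).2)⟩
  set σ : ℕ → ℝ := fun i => SignType.sign (expAvg η (p t) (u (i + 1)) - expAvg η (p t) (u i))
  have hσ : ∀ i, |σ i| ≤ 1 := fun i => by
    simp only [σ]
    rcases SignType.sign (expAvg η (p t) (u (i + 1)) - expAvg η (p t) (u i)) <;> simp
  set v : ℝ → ℝ := fun s => ∑ i ∈ Finset.range n,
    σ i * (expAvg η (p s) (X s (y (i + 1))) - expAvg η (p s) (X s (y i))) with hv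
  have hvt : ∑ i ∈ Finset.range n, |expAvg η (p t) (u (i + 1)) - expAvg η (p t) (u i)| = v t := by
    simp only [hv, hy, σ]
    exact Finset.sum_congr rfl fun i _ => (sign_mul_self _).symm
  rw [hvt]
  have hΛ : 0 ≤ M * K / η := by have := h.bound_nonneg; positivity
  set g : ℝ → ℝ → ℝ := fun s y => fluxG V (expAvg η (p s) y) with hg
  refine le_of_hasDerivAt_le (f' := fun s => ∑ i ∈ Finset.range n, σ i *
    ((expAvg η (g s) (X s (y (i + 1))) - g s (X s (y (i + 1)))) / η
      - (expAvg η (g s) (X s (y i)) - g s (X s (y i))) / η)) ?_ ?_ ?_ ?_ hle hΛ ht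
  · exact continuousOn_finsetSum _ fun i _ => continuousOn_const.mul
      ((h.continuousOn_expAvg_flow _).sub (h.continuousOn_expAvg_flow _))
  · intro s hs
    exact HasDerivAt.fun_sum fun i _ =>
      ((h.hasDerivAt_expAvg_flow hs _).sub (h.hasDerivAt_expAvg_flow hs _)).const_mul _
  · intro s hs
    have hs' := Ioo_subset_Icc_self hs
    set x : ℕ → ℝ := fun i => X s (y i) with hx
    have hxm : Monotone x := (h.flow.mono s hs').monotone.comp hym
    set E := ∑ i ∈ Finset.range n, σ i *
        ((M * K * expAvg η (p s) (x (i + 1)) - g s (x (i + 1)))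
          - (M * K * expAvg η (p s) (x i) - g s (x i))) with hE
    have hA := sum_expAvg_sub_le (η := η) (P := M * K * B - E) (Q := M * K * C)
      (h.continuous_fluxG_expAvg s).measurable (h.abs_fluxG_expAvg_le s) n σ x fun r hr => by
        have hDr : 0 ≤ B + C * r := by positivity
        have hsub : Icc (x 0 - η * r) (x n) ⊆ Icc (X s a - η * r) (X s b) :=
          Icc_subset_Icc (sub_le_sub_right ((h.flow.mono s hs').monotone (hyab 0).1) _)
            ((h.flow.mono s hs').monotone (hyab n).2)
        have h1 := h.sum_fluxG_le hK (by positivity) n hσ hxm rfl hDr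
          ((eVariationOn.mono _ hsub).trans (hvar s hs' r hr.le))
        linarith
    have hEv : E = M * K * v s - ∑ i ∈ Finset.range n, σ i * (g s (x (i + 1)) - g s (x i)) := by
      rw [hE, hv, Finset.mul_sum, ← Finset.sum_sub_distrib]
      exact Finset.sum_congr rfl fun i _ => by ring
    have hsplit : ∑ i ∈ Finset.range n, σ i * ((expAvg η (g s) (x (i + 1)) - g s (x (i + 1))) / η
        - (expAvg η (g s) (x i) - g s (x i)) / η)
        = (∑ i ∈ Finset.range n, σ i * (expAvg η (g s) (x (i + 1)) - expAvg η (g s) (x i))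
          - ∑ i ∈ Finset.range n, σ i * (g s (x (i + 1)) - g s (x i))) / η := by
      rw [← Finset.sum_sub_distrib, Finset.sum_div]
      exact Finset.sum_congr rfl fun i _ => by ring
    change ∑ i ∈ Finset.range n, σ i * ((expAvg η (g s) (x (i + 1)) - g s (x (i + 1))) / η
        - (expAvg η (g s) (x i) - g s (x i)) / η) ≤ _
    rw [hsplit]
    calc _ ≤ (M * K * (B + C - v s)) / η := by
          gcongr
          change ∑ i ∈ Finset.range n,
            σ i * (expAvg η (g s) (x (i + 1)) - expAvg η (g s) (x i)) ≤ _ at hA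
          linarith
      _ = _ := by ring
  · simp only [hv, h.flow.zero, h.expAvg_zero]
    refine le_trans (Finset.sum_le_sum fun i _ => ?_)
      (sum_abs_sub_le_of_eVariationOn_le hB₀0 hB₀ n hym fun i _ => mem_univ _)
    exact (le_abs_self _).trans
      (by rw [abs_mul]; exact mul_le_of_le_one_left (abs_nonneg _) (hσ i))

end IsLagrangian

theorem eVariationOn_expAvg_le {f : ℝ → ℝ} {N η B₀ : ℝ} (hf : Measurable f) (hN : ∀ x, |f x| ≤ N)
    (hB₀0 : 0 ≤ B₀) (hB₀ : eVariationOn f univ ≤ ENNReal.ofReal B₀) :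
    eVariationOn (expAvg η f) univ ≤ ENNReal.ofReal B₀ := by
  refine eVariationOn_le_ofReal fun n u hu _ => ?_
  set σ : ℕ → ℝ := fun i => SignType.sign (expAvg η f (u (i + 1)) - expAvg η f (u i))
  have hσ : ∀ i, |σ i| ≤ 1 := fun i => by
    simp only [σ]
    rcases SignType.sign (expAvg η f (u (i + 1)) - expAvg η f (u i)) <;> simp
  have key := sum_expAvg_sub_le (η := η) (P := B₀) (Q := 0) hf hN n σ u fun r _ => by
    rw [zero_mul, add_zero]
    refine le_trans (Finset.sum_le_sum fun i _ => ?_)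
      (sum_abs_sub_le_of_eVariationOn_le hB₀0 hB₀ n (u := fun i => u i - η * r)
        (fun i j hij => sub_le_sub_right (hu hij) _) fun i _ => mem_univ _)
    exact (le_abs_self _).trans
      (by rw [abs_mul]; exact mul_le_of_le_one_left (abs_nonneg _) (hσ i))
  rw [add_zero] at key
  refine le_trans (le_of_eq ?_) key
  exact Finset.sum_congr rfl fun i _ => (sign_mul_self _).symm

namespace IsLagrangian

variable {T η M : ℝ} {V p₀ : ℝ → ℝ} {p X : ℝ → ℝ → ℝ} {K : NNReal}

theorem eVariationOn_Icc_le_mul (h : IsLagrangian T η M V p₀ p X) (t c d : ℝ) :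
    eVariationOn (expAvg η (p t)) (Icc c d) ≤ ENNReal.ofReal (2 * M / η * (d - c)) := by
  have hM := h.bound_nonneg
  have hη := h.η_pos
  refine eVariationOn_le_ofReal fun n u hu hus => ?_
  calc _ ≤ ∑ i ∈ Finset.range n, 2 * M / η * (u (i + 1) - u i) :=
        Finset.sum_le_sum fun i _ => by
          have h1 := (lipschitzWith_expAvg h.η_pos (h.meas t) (h.abs_le t)).dist_le_mul
            (u (i + 1)) (u i)
          rwa [Real.dist_eq, Real.dist_eq, Real.coe_toNNReal _ (by positivity),
            abs_of_nonneg (sub_nonneg.2 (hu (Nat.le_succ i)))] at h1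
    _ = 2 * M / η * (u n - u 0) := by rw [← Finset.mul_sum, Finset.sum_range_sub]
    _ ≤ _ := by
        have := (hus n).2
        have := (hus 0).1
        gcongr

theorem exists_uniform_eVariationOn_le (h : IsLagrangian T η M V p₀ p X)
    (hK : LipschitzOnWith K V (Icc 0 M)) {B₀ : ℝ} (hB₀0 : 0 ≤ B₀)
    (hB₀ : eVariationOn (expAvg η p₀) univ ≤ ENNReal.ofReal B₀) :
    ∃ D : ℝ, ∀ t ∈ Icc 0 T, ∀ a b, a ≤ b →
      eVariationOn (expAvg η (p t)) (Icc (X t a) (X t b)) ≤ ENNReal.ofReal D := by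
  have hM := h.bound_nonneg
  have hη := h.η_pos
  have hTp := h.T_pos
  set κ := Real.exp (-(M * K / η * T)) with hκd
  have hκ : 0 < κ := Real.exp_pos _
  refine ⟨B₀ + 2 * M / κ, fun t ht a b hab => ?_⟩
  set β := ⨆ t ∈ Icc 0 T, eVariationOn (expAvg η (p t)) (Icc (X t a) (X t b)) with hβ
  have hle : ∀ t ∈ Icc 0 T, eVariationOn (expAvg η (p t)) (Icc (X t a) (X t b)) ≤ β :=
    fun t ht => le_iSup₂_of_le t ht le_rfl
  have hβtop : β ≠ ⊤ := by
    refine ne_top_of_le_ne_top (ENNReal.ofReal_ne_top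
      (r := 2 * M / η * (b - a + 2 * max |V (-M)| |V M| * T))) (iSup₂_le fun t ht => ?_)
    refine (h.eVariationOn_Icc_le_mul t _ _).trans
      (ENNReal.ofReal_le_ofReal ?_)
    have := h.flow_sub_le ht b a
    gcongr
  refine (hle t ht).trans ((ENNReal.le_ofReal_iff_toReal_le hβtop (by positivity)).2 ?_)
  by_cases hcmp : B₀ ≤ β.toReal + 2 * M
  · have hstep : β ≤ ENNReal.ofReal (β.toReal + 2 * M - (β.toReal + 2 * M - B₀) * κ) := by
      refine iSup₂_le fun t ht => h.eVariationOn_flow_le hK ENNReal.toReal_nonneg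
        (by positivity) hB₀ hB₀0 hcmp (fun t ht s hs => ?_) ht
      have hηs : 0 ≤ η * s := by positivity
      have hX := (h.flow.mono t ht).monotone hab
      have e := eVariationOn.Icc_add_Icc (expAvg η (p t)) (s := univ)
        (sub_le_self (X t a) hηs) hX (mem_univ _)
      simp only [univ_inter] at e
      rw [← e, add_comm β.toReal, ENNReal.ofReal_add (by positivity) ENNReal.toReal_nonneg,
        ENNReal.ofReal_toReal hβtop]
      refine add_le_add ((h.eVariationOn_Icc_le_mul t _ _).trans_eq ?_) (hle t ht)
      congr 1
      field_simp
      ring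
    have hκ1 : κ ≤ 1 := Real.exp_le_one_iff.2 (by
      have : 0 ≤ M * K / η * T := by positivity
      linarith)
    have hnn : 0 ≤ β.toReal + 2 * M - (β.toReal + 2 * M - B₀) * κ := by
      nlinarith [mul_le_mul_of_nonneg_left hκ1 (sub_nonneg.2 hcmp)]
    have := (ENNReal.le_ofReal_iff_toReal_le hβtop hnn).1 hstep
    have h2 : β.toReal + 2 * M - B₀ ≤ 2 * M / κ := by
      rw [le_div_iff₀ hκ]; linarith
    linarith
  · push Not at hcmp
    have : 0 ≤ 2 * M / κ := by positivity
    linarith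

theorem eVariationOn_le (h : IsLagrangian T η M V p₀ p X)
    (hK : LipschitzOnWith K V (Icc 0 M)) {B₀ : ℝ} (hB₀0 : 0 ≤ B₀)
    (hB₀ : eVariationOn p₀ univ ≤ ENNReal.ofReal B₀) {t : ℝ} (ht : t ∈ Icc 0 T) :
    eVariationOn (expAvg η (p t)) univ ≤ ENNReal.ofReal B₀ := by
  have hA := eVariationOn_expAvg_le (η := η) h.meas₀
    (fun x => by rw [abs_of_nonneg (h.nonneg₀ x)]; exact h.le₀ x) hB₀0 hB₀
  obtain ⟨D, hD⟩ := h.exists_uniform_eVariationOn_le hK hB₀0 hA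
  have hη := h.η_pos
  set κ := Real.exp (-(M * K / η * T)) with hκd
  have hκ : 0 < κ := Real.exp_pos _
  set β := ⨆ t ∈ Icc 0 T, ⨆ a, ⨆ b, ⨆ _ : a ≤ b,
    eVariationOn (expAvg η (p t)) (Icc (X t a) (X t b)) with hβ
  have hle : ∀ t ∈ Icc 0 T, ∀ a b, a ≤ b →
      eVariationOn (expAvg η (p t)) (Icc (X t a) (X t b)) ≤ β := fun t ht a b hab =>
    le_iSup₂_of_le t ht (le_iSup_of_le a (le_iSup₂_of_le b hab le_rfl))
  have hβtop : β ≠ ⊤ := ne_top_of_le_ne_top (ENNReal.ofReal_ne_top (r := D))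
    (iSup₂_le fun t ht => iSup_le fun a => iSup₂_le fun b hab => hD t ht a b hab)
  have hβle : β ≤ ENNReal.ofReal B₀ := by
    rw [ENNReal.le_ofReal_iff_toReal_le hβtop hB₀0]
    by_contra! hcmp
    have hstep : β ≤ ENNReal.ofReal (β.toReal + 0 - (β.toReal + 0 - B₀) * κ) := by
      refine iSup₂_le fun t ht => iSup_le fun a => iSup₂_le fun b hab =>
        h.eVariationOn_flow_le hK ENNReal.toReal_nonneg le_rfl hA hB₀0 (by linarith)
        (fun t ht s hs => ?_) ht
      rw [zero_mul, add_zero, ENNReal.ofReal_toReal hβtop]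
      obtain ⟨a', ha'⟩ := h.flow.surj t ht (X t a - η * s)
      have hηs : 0 ≤ η * s := by positivity
      rw [← ha']
      refine hle t ht a' b ((h.flow.mono t ht).le_iff_le.1 ?_)
      rw [ha']
      linarith [(h.flow.mono t ht).monotone hab]
    have hpos := mul_pos (sub_pos.2 hcmp) hκ
    have hlt : ENNReal.ofReal (β.toReal + 0 - (β.toReal + 0 - B₀) * κ) < β := by
      conv_rhs => rw [← ENNReal.ofReal_toReal hβtop]
      rw [ENNReal.ofReal_lt_ofReal_iff (hB₀0.trans_lt hcmp)]
      linarith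
    exact absurd hstep (not_le.2 hlt)
  refine eVariationOn_le_ofReal fun n u hu _ => ?_
  obtain ⟨a, ha⟩ := h.flow.surj t ht (u 0)
  obtain ⟨b, hb⟩ := h.flow.surj t ht (u n)
  have hab : a ≤ b := (h.flow.mono t ht).le_iff_le.1 (by rw [ha, hb]; exact hu (Nat.zero_le n))
  refine sum_abs_sub_le_of_eVariationOn_le hB₀0 ((hle t ht a b hab).trans hβle) n hu fun i hi => ?_
  rw [ha, hb]
  exact ⟨hu (Nat.zero_le i), hu hi⟩

end IsLagrangian

theorem intervalIntegrable_of_abs_le {f : ℝ → ℝ} {N : ℝ} (hf : Measurable f)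
    (hN : ∀ x, |f x| ≤ N) (a b : ℝ) : IntervalIntegrable f volume a b :=
  ⟨Measure.integrableOn_of_bounded (M := N) (by simp) hf.aestronglyMeasurable
    (Eventually.of_forall hN), Measure.integrableOn_of_bounded (M := N) (by simp)
    hf.aestronglyMeasurable (Eventually.of_forall hN)⟩

theorem abs_intervalIntegral_le {f : ℝ → ℝ} {N : ℝ} (hN : ∀ x, |f x| ≤ N) {a b : ℝ}
    (hab : a ≤ b) : |∫ x in a..b, f x| ≤ N * (b - a) := by
  have := intervalIntegral.norm_integral_le_of_norm_le_const (a := a) (b := b) (f := f)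
    (C := N) fun x _ => hN x
  rwa [abs_of_nonneg (sub_nonneg.2 hab)] at this

theorem measurable_intervalIntegral_translate {f : ℝ → ℝ} {N : ℝ} (hf : Measurable f)
    (hN : ∀ x, |f x| ≤ N) (a b : ℝ) : Measurable fun y => ∫ x in (y + a)..(y + b), f x := by
  have hi := intervalIntegrable_of_abs_le hf hN
  have hc : Continuous fun y => ∫ x in (0:ℝ)..y, f x :=
    intervalIntegral.continuous_primitive hi 0
  have e : (fun y => ∫ x in (y + a)..(y + b), f x)
      = fun y => (∫ x in (0:ℝ)..(y + b), f x) - ∫ x in (0:ℝ)..(y + a), f x := by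
    ext y
    rw [intervalIntegral.integral_interval_sub_left (hi _ _) (hi _ _)]
  rw [e]
  exact ((hc.comp (by fun_prop)).sub (hc.comp (by fun_prop))).measurable

theorem intervalIntegral_expAvg_eq_expAvg {f : ℝ → ℝ} {N : ℝ} (hf : Measurable f)
    (hN : ∀ x, |f x| ≤ N) (η c a b : ℝ) : ∫ x in (c + a)..(c + b), expAvg η f x
      = expAvg η (fun y => ∫ x in (y + a)..(y + b), f x) c := by
  rw [intervalIntegral_expAvg hf hN, expAvg]
  congr 1
  ext r
  rw [intervalIntegral.integral_comp_sub_right]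
  congr 2 <;> ring

namespace IsLagrangian

variable {T η M : ℝ} {V p₀ : ℝ → ℝ} {p X : ℝ → ℝ → ℝ} {K : NNReal}

theorem intervalIntegral_le_of_abs_flow_sub_le (h : IsLagrangian T η M V p₀ p X) {s t κ : ℝ}
    (hs : s ∈ Icc 0 T) (ht : t ∈ Icc 0 T) (hκ : ∀ ξ, |X t ξ - X s ξ| ≤ κ) {c d : ℝ} (hcd : c ≤ d) :
    ∫ x in c..d, p t x ≤ ∫ x in (c - κ)..(d + κ), p s x := by
  have hm₀ := h.meas₀
  have hκ0 : 0 ≤ κ := (abs_nonneg _).trans (hκ 0)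
  have e : ∀ r ∈ Icc 0 T, ∀ a b, a ≤ b →
      ∫ x in a..b, p r x = ∫ z, p₀ z * (Icc a b).indicator (fun _ => (1:ℝ)) (X r z) := by
    intro r hr a b hab
    rw [← h.push r hr, intervalIntegral.integral_of_le hab, ← integral_Icc_eq_integral_Ioc,
      ← integral_indicator measurableSet_Icc]
    congr 1
    ext x
    by_cases hx : x ∈ Icc a b
    · simp [hx]
    · simp [hx]
  rw [e t ht c d hcd, e s hs _ _ (by linarith)]
  obtain ⟨a, ha⟩ := h.flow.surj s hs (c - κ)
  obtain ⟨b, hb⟩ := h.flow.surj s hs (d + κ)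
  have hpre : ∀ z, (Icc (c - κ) (d + κ)).indicator (fun _ => (1:ℝ)) (X s z)
      = (Icc a b).indicator (fun _ => (1:ℝ)) z := fun z => by
    simp only [indicator, mem_Icc, ← ha, ← hb, (h.flow.mono s hs).le_iff_le]
  refine integral_mono_of_nonneg (Eventually.of_forall fun z =>
    mul_nonneg (h.nonneg₀ z) (indicator_nonneg (fun _ _ => zero_le_one) _)) ?_
    (Eventually.of_forall fun z => mul_le_mul_of_nonneg_left ?_ (h.nonneg₀ z))
  · simp only [hpre]
    have hI : Integrable ((Icc a b).indicator p₀) := (integrable_indicator_iff measurableSet_Icc).2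
      (Measure.integrableOn_of_bounded (M := M) (by simp) hm₀.aestronglyMeasurable
      (Eventually.of_forall fun x => by
        rw [Real.norm_eq_abs, abs_of_nonneg (h.nonneg₀ x)]; exact h.le₀ x))
    refine hI.congr (Eventually.of_forall fun z => ?_)
    by_cases hz : z ∈ Icc a b
    · simp [hz]
    · simp [hz]
  · by_cases hz : X t z ∈ Icc c d
    · have h1 := _root_.abs_le.1 (hκ z)
      have hz' : X s z ∈ Icc (c - κ) (d + κ) := ⟨by linarith [hz.1], by linarith [hz.2]⟩
      rw [indicator_of_mem hz, indicator_of_mem hz']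
    · rw [indicator_of_notMem hz]
      exact indicator_nonneg (fun _ _ => zero_le_one) _

theorem abs_flow_sub_le (h : IsLagrangian T η M V p₀ p X) (hK : LipschitzOnWith K V (Icc 0 M))
    {M₀ : ℝ} (hM₀ : ∀ x, p₀ x ≤ M₀) (s t ξ : ℝ) :
    |X t ξ - X s ξ| ≤ max |V (-M₀)| |V M₀| * |t - s| := by
  refine h.flow.abs_sub_le (fun r x => abs_le_of_monotone h.monoV ?_) ξ s t
  rw [abs_of_nonneg (h.expAvg_mem _ _).1]
  exact h.expAvg_le hK hM₀ (clampIcc_mem h.T_pos.le r) x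

theorem intervalIntegral_expAvg_le (h : IsLagrangian T η M V p₀ p X)
    (hK : LipschitzOnWith K V (Icc 0 M)) {M₀ : ℝ} (hM₀ : ∀ x, p₀ x ≤ M₀) {s t : ℝ}
    (hs : s ∈ Icc 0 T) (ht : t ∈ Icc 0 T) {c d : ℝ} (hcd : c ≤ d) :
    ∫ x in c..d, expAvg η (p t) x ≤ (∫ x in c..d, expAvg η (p s) x)
      + 2 * M₀ * max |V (-M₀)| |V M₀| * |t - s| := by
  set κ := max |V (-M₀)| |V M₀| * |t - s| with hκd
  have hκ : ∀ ξ, |X t ξ - X s ξ| ≤ κ := h.abs_flow_sub_le hK hM₀ s t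
  have hκ0 : 0 ≤ κ := (abs_nonneg _).trans (hκ 0)
  have h1 : ∫ x in c..d, expAvg η (p t) x ≤ ∫ x in (c - κ)..(d + κ), expAvg η (p s) x := by
    have e1 := intervalIntegral_expAvg_eq_expAvg (h.meas t) (h.abs_le t) η c 0 (d - c)
    have e2 := intervalIntegral_expAvg_eq_expAvg (h.meas s) (h.abs_le s) η c (-κ) (d - c + κ)
    have i1 : c + (d - c) = d := by ring
    have i2 : c + (d - c + κ) = d + κ := by ring
    rw [add_zero, i1] at e1
    rw [i2, ← sub_eq_add_neg] at e2
    rw [e1, e2]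
    refine expAvg_mono (measurable_intervalIntegral_translate (h.meas t) (h.abs_le t) _ _)
      (fun y => abs_intervalIntegral_le (h.abs_le t) (by linarith) |>.trans_eq
        (show _ = M * (d - c) by ring))
      (measurable_intervalIntegral_translate (h.meas s) (h.abs_le s) _ _)
      (fun y => abs_intervalIntegral_le (h.abs_le s) (by linarith) |>.trans_eq
        (show _ = M * (d - c + κ + κ) by ring)) (fun y => ?_) η c
    have := h.intervalIntegral_le_of_abs_flow_sub_le hs ht hκ
      (show y + 0 ≤ y + (d - c) by linarith)
    convert this using 2 <;> ring
  have hi : ∀ a b, IntervalIntegrable (expAvg η (p s)) volume a b := fun a b =>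
    (h.continuous_expAvg s).intervalIntegrable a b
  have hM0b : ∀ a b, a ≤ b → ∫ x in a..b, expAvg η (p s) x ≤ M₀ * (b - a) := fun a b hab => by
    have := intervalIntegral.integral_mono_on hab (hi a b) intervalIntegrable_const
      (fun x _ => h.expAvg_le hK hM₀ hs x)
    simpa [mul_comm] using this
  have h2 := hM0b (c - κ) c (by linarith)
  have h3 := hM0b d (d + κ) (by linarith)
  have e1 := intervalIntegral.integral_add_adjacent_intervals (hi (c - κ) c) (hi c d)
  have e2 := intervalIntegral.integral_add_adjacent_intervals (hi (c - κ) d) (hi d (d + κ))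
  have : 2 * M₀ * max |V (-M₀)| |V M₀| * |t - s| = 2 * M₀ * κ := by rw [hκd]; ring
  rw [this]
  linarith

theorem abs_intervalIntegral_expAvg_sub_le (h : IsLagrangian T η M V p₀ p X)
    (hK : LipschitzOnWith K V (Icc 0 M)) {M₀ : ℝ} (hM₀ : ∀ x, p₀ x ≤ M₀) {s t : ℝ}
    (hs : s ∈ Icc 0 T) (ht : t ∈ Icc 0 T) (c d : ℝ) :
    |(∫ x in c..d, expAvg η (p t) x) - ∫ x in c..d, expAvg η (p s) x|
      ≤ 2 * M₀ * max |V (-M₀)| |V M₀| * |t - s| := by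
  wlog hcd : c ≤ d generalizing c d
  · have := this d c (le_of_not_ge hcd)
    rw [intervalIntegral.integral_symm c d, intervalIntegral.integral_symm c d, neg_sub_neg,
      abs_sub_comm] at this
    exact this
  have h1 := h.intervalIntegral_expAvg_le hK hM₀ hs ht hcd
  have h2 := h.intervalIntegral_expAvg_le hK hM₀ ht hs hcd
  rw [abs_sub_comm s t] at h2
  exact _root_.abs_le.2 ⟨by linarith, by linarith⟩

end IsLagrangian

/-- On every bounded interval, `w` is within `B * h` in mean of the forward difference quotients
of `u` with step `h`. -/
structure DiffQuotClose (B : ℝ) (u w : ℝ → ℝ) : Prop where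
  cont : Continuous u
  meas : Measurable w
  bdd : ∃ N, ∀ x, |w x| ≤ N
  close : ∀ R, 0 ≤ R → ∀ h, 0 < h → ∫ x in -R..R, |w x - (u (x + h) - u x) / h| ≤ B * h

lemma abs_sub_le_variationOnFromTo {w : ℝ → ℝ} (hw : BoundedVariationOn w univ) {x y : ℝ}
    (hxy : x ≤ y) : |w y - w x| ≤ variationOnFromTo w univ x y := by
  rw [variationOnFromTo.eq_of_le _ _ hxy, ← Real.dist_eq, dist_edist]
  exact ENNReal.toReal_mono (hw.mono (subset_univ _))
    (eVariationOn.edist_le w ⟨mem_univ _, hxy, le_rfl⟩ ⟨mem_univ _, le_rfl, hxy⟩)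

lemma variationOnFromTo_le {w : ℝ → ℝ} {B : ℝ} (hB : 0 ≤ B)
    (hw : eVariationOn w univ ≤ ENNReal.ofReal B) {x y : ℝ} (hxy : x ≤ y) :
    variationOnFromTo w univ x y ≤ B := by
  rw [variationOnFromTo.eq_of_le _ _ hxy]
  exact ENNReal.toReal_le_of_le_ofReal hB
    ((eVariationOn.mono w (subset_univ _)).trans hw)

lemma diffQuotClose_primitive {w : ℝ → ℝ} {B N : ℝ} (hc : Continuous w) (hN : ∀ x, |w x| ≤ N)
    (hB : 0 ≤ B) (hw : eVariationOn w univ ≤ ENNReal.ofReal B) :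
    DiffQuotClose B (fun x => ∫ y in 0..x, w y) w := by
  have hbv : BoundedVariationOn w univ := ne_top_of_le_ne_top ENNReal.ofReal_ne_top hw
  have hlbv := hbv.locallyBoundedVariationOn
  set f := variationOnFromTo w univ 0 with hf
  have hmono : Monotone f := monotoneOn_univ.1 (variationOnFromTo.monotoneOn hlbv (mem_univ _))
  have hsub : ∀ x y, f y - f x = variationOnFromTo w univ x y := fun x y => by
    have := variationOnFromTo.add hlbv (mem_univ (0 : ℝ)) (mem_univ x) (mem_univ y)
    simp only [hf]; linarith
  have hii : ∀ a b, IntervalIntegrable f volume a b := fun a b => hmono.intervalIntegrable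
  have hcu : Continuous fun x => ∫ y in 0..x, w y :=
    intervalIntegral.continuous_primitive (fun a b => hc.intervalIntegrable a b) 0
  refine ⟨hcu, hc.measurable, ⟨N, hN⟩, fun R hR h hh => ?_⟩
  have hpt : ∀ x, |w x - ((∫ y in 0..x + h, w y) - ∫ y in 0..x, w y) / h| ≤ f (x + h) - f x := by
    intro x
    rw [intervalIntegral.integral_interval_sub_left (hc.intervalIntegrable _ _)
      (hc.intervalIntegrable _ _)]
    have e : w x - (∫ y in x..x + h, w y) / h = (∫ y in x..x + h, (w x - w y)) / h := by
      rw [intervalIntegral.integral_sub (by simp) (hc.intervalIntegrable _ _)]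
      simp
      field_simp
    rw [e, abs_div, abs_of_pos hh, div_le_iff₀ hh]
    have := intervalIntegral.norm_integral_le_of_norm_le_const (a := x) (b := x + h)
      (C := f (x + h) - f x) (f := fun y => w x - w y) (fun y hy => by
        rw [uIoc_of_le (by linarith)] at hy
        have h1 := abs_sub_le_variationOnFromTo hbv hy.1.le
        rw [← hsub] at h1
        have h2 := hmono hy.2
        rw [Real.norm_eq_abs, abs_sub_comm]
        linarith)
    simpa [abs_of_pos hh] using this
  have hcomp : ∀ a b d, IntervalIntegrable (fun x => f (x + d)) volume a b := fun a b d =>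
    (hmono.comp fun _ _ hxy => by linarith : Monotone fun x => f (x + d)).intervalIntegrable
  calc ∫ x in -R..R, |w x - ((∫ y in 0..x + h, w y) - ∫ y in 0..x, w y) / h|
      ≤ ∫ x in -R..R, (f (x + h) - f x) := by
        refine intervalIntegral.integral_mono_on (by linarith) ?_
          ((hcomp _ _ _).sub (hii _ _)) fun x _ => hpt x
        refine Continuous.intervalIntegrable ?_ _ _
        have := hcu.comp (continuous_add_const h)
        simp only [comp_def] at this
        fun_prop
    _ = ∫ x in -R..-R + h, (f (x + 2 * R) - f x) := by
        rw [intervalIntegral.integral_sub (hcomp _ _ _) (hii _ _),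
          intervalIntegral.integral_sub (hcomp _ _ _) (hii _ _),
          intervalIntegral.integral_comp_add_right f h,
          intervalIntegral.integral_comp_add_right f (2 * R),
          intervalIntegral.integral_interval_sub_interval_comm' (hii _ _) (hii _ _) (hii _ _)]
        congr 2 <;> ring
    _ ≤ ∫ x in -R..-R + h, B := by
        refine intervalIntegral.integral_mono_on (by linarith) ((hcomp _ _ _).sub (hii _ _))
          (by simp) fun x _ => ?_
        rw [hsub]
        exact variationOnFromTo_le hB hw (by linarith)
    _ = B * h := by simp [mul_comm]

lemma abs_diffQuot_le {u : ℝ → ℝ} {N : ℝ} (hu : ∀ x y, |u x - u y| ≤ N * |x - y|) {h : ℝ}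
    (hh : 0 < h) (x : ℝ) : |(u (x + h) - u x) / h| ≤ N := by
  rw [abs_div, abs_of_pos hh, div_le_iff₀ hh]
  simpa [abs_of_pos hh] using hu (x + h) x

lemma DiffQuotClose.integral_diffQuot_sub_le {B : ℝ} {u w : ℝ → ℝ} (H : DiffQuotClose B u w)
    {R : ℝ} (hR : 0 ≤ R) {h k : ℝ} (hh : 0 < h) (hk : 0 < k) :
    ∫ x in -R..R, |(u (x + h) - u x) / h - (u (x + k) - u x) / k| ≤ B * h + B * k := by
  have hq : ∀ d, Continuous fun x => (u (x + d) - u x) / d := fun d =>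
    ((H.cont.comp (continuous_add_const d)).sub H.cont).div_const d
  obtain ⟨N, hN⟩ := H.bdd
  have hw : IntervalIntegrable w volume (-R) R := intervalIntegrable_of_abs_le H.meas hN _ _
  have hi : ∀ d, IntervalIntegrable (fun x => |w x - (u (x + d) - u x) / d|) volume (-R) R :=
    fun d => (hw.sub ((hq d).intervalIntegrable _ _)).abs
  have h1 := H.close R hR h hh
  have h2 := H.close R hR k hk
  have h3 : ∫ x in -R..R, |(u (x + h) - u x) / h - (u (x + k) - u x) / k| ≤
      ∫ x in -R..R, (|w x - (u (x + h) - u x) / h| + |w x - (u (x + k) - u x) / k|) := by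
    refine intervalIntegral.integral_mono_on (by linarith)
      (((hq h).sub (hq k)).abs.intervalIntegrable _ _) ((hi h).add (hi k)) fun x _ => ?_
    rw [abs_sub_comm (w x)]
    exact abs_sub_le _ _ _
  rw [intervalIntegral.integral_add (hi h) (hi k)] at h3
  linarith

lemma diffQuotClose_deriv_of_tendsto {B N : ℝ} {u : ℕ → ℝ → ℝ} {w : ℕ → ℝ → ℝ} {v : ℝ → ℝ}
    (H : ∀ k, DiffQuotClose B (u k) (w k)) (hu : ∀ k x y, |u k x - u k y| ≤ N * |x - y|)
    (hv : ∀ x, Tendsto (fun k => u k x) atTop (nhds (v x))) : DiffQuotClose B v (deriv v) := by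
  have hvl : ∀ x y, |v x - v y| ≤ N * |x - y| := fun x y =>
    le_of_tendsto ((hv x).sub (hv y)).abs (Eventually.of_forall fun k => hu k x y)
  have hN : 0 ≤ N := by simpa using (abs_nonneg _).trans (hvl 1 0)
  have hlip : LipschitzWith N.toNNReal v := LipschitzWith.of_dist_le_mul fun x y => by
    simpa [Real.dist_eq, hN] using hvl x y
  have hq : ∀ (f : ℝ → ℝ), Continuous f → ∀ d, Continuous fun x => (f (x + d) - f x) / d :=
    fun f hf d => ((hf.comp (continuous_add_const d)).sub hf).div_const d
  have hle : ∀ R, 0 ≤ R → ∀ h, 0 < h → ∀ k, 0 < k →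
      ∫ x in -R..R, |(v (x + h) - v x) / h - (v (x + k) - v x) / k| ≤ B * h + B * k := by
    intro R hR h hh k hk
    refine le_of_tendsto (intervalIntegral.tendsto_integral_filter_of_dominated_convergence
      (F := fun j x => |(u j (x + h) - u j x) / h - (u j (x + k) - u j x) / k|) (l := atTop)
      (fun _ => N + N) ?_ ?_ (by simp) ?_) (Eventually.of_forall fun j =>
        (H j).integral_diffQuot_sub_le hR hh hk)
    · exact Eventually.of_forall fun j =>
        ((hq _ (H j).cont h).sub (hq _ (H j).cont k)).abs.aestronglyMeasurable
    · refine Eventually.of_forall fun j => Eventually.of_forall fun x _ => ?_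
      rw [Real.norm_eq_abs, abs_abs]
      exact (abs_sub _ _).trans
        (add_le_add (abs_diffQuot_le (hu j) hh x) (abs_diffQuot_le (hu j) hk x))
    · exact Eventually.of_forall fun x _ => ((((hv _).sub (hv _)).div_const h).sub
        (((hv _).sub (hv _)).div_const k)).abs
  refine ⟨hlip.continuous, measurable_deriv v, ⟨N, fun x => ?_⟩, fun R hR h hh => ?_⟩
  · simpa [hN] using norm_deriv_le_of_lipschitz (x₀ := x) hlip
  have hseq : Tendsto (fun n : ℕ => (1 : ℝ) / (n + 1)) atTop (nhdsWithin 0 (Ioi 0)) :=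
    tendsto_nhdsWithin_iff.2 ⟨tendsto_one_div_add_atTop_nhds_zero_nat,
      Eventually.of_forall fun n => by simp only [mem_Ioi]; positivity⟩
  have hlim : Tendsto (fun n : ℕ => ∫ x in -R..R, |(v (x + 1 / ((n : ℝ) + 1)) - v x) /
      (1 / ((n : ℝ) + 1)) - (v (x + h) - v x) / h|) atTop
      (nhds (∫ x in -R..R, |deriv v x - (v (x + h) - v x) / h|)) := by
    refine intervalIntegral.tendsto_integral_filter_of_dominated_convergence
      (fun _ => N + N) ?_ ?_ (by simp) ?_
    · exact Eventually.of_forall fun j =>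
        ((hq _ hlip.continuous _).sub (hq _ hlip.continuous h)).abs.aestronglyMeasurable
    · refine Eventually.of_forall fun j => Eventually.of_forall fun x _ => ?_
      rw [Real.norm_eq_abs, abs_abs]
      exact (abs_sub _ _).trans
        (add_le_add (abs_diffQuot_le hvl (by positivity) x) (abs_diffQuot_le hvl hh x))
    · filter_upwards [hlip.ae_differentiableAt_real] with x hx _
      have := hx.hasDerivAt.tendsto_slope_zero_right.comp hseq
      refine Tendsto.abs (Tendsto.sub_const ?_ _)
      refine this.congr fun n => ?_
      simp only [comp_apply, smul_eq_mul]
      exact inv_mul_eq_div _ _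
  have hrhs : Tendsto (fun n : ℕ => B * (1 / ((n : ℝ) + 1)) + B * h) atTop
      (nhds (B * 0 + B * h)) :=
    ((tendsto_nhds_of_tendsto_nhdsWithin hseq).const_mul B).add_const _
  rw [mul_zero, zero_add] at hrhs
  exact le_of_tendsto_of_tendsto' hlim hrhs fun n => hle R hR _ (by positivity) h hh

lemma DiffQuotClose.integral_sub_le {B e R h : ℝ} {u v w z : ℝ → ℝ} (H : DiffQuotClose B u w)
    (H' : DiffQuotClose B v z) (hR : 0 ≤ R) (hh : 0 < h) (hh1 : h ≤ 1)
    (huv : ∀ x ∈ Icc (-R) (R + 1), |u x - v x| ≤ e) :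
    ∫ x in -R..R, |w x - z x| ≤ 2 * B * h + 4 * R * e / h := by
  have hq : ∀ (f : ℝ → ℝ), Continuous f → Continuous fun x => (f (x + h) - f x) / h :=
    fun f hf => ((hf.comp (continuous_add_const h)).sub hf).div_const h
  obtain ⟨N, hN⟩ := H.bdd
  obtain ⟨N', hN'⟩ := H'.bdd
  have hw : IntervalIntegrable w volume (-R) R := intervalIntegrable_of_abs_le H.meas hN _ _
  have hz : IntervalIntegrable z volume (-R) R := intervalIntegrable_of_abs_le H'.meas hN' _ _
  have i1 := (hw.sub ((hq u H.cont).intervalIntegrable (-R) R)).abs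
  have i2 := (hz.sub ((hq v H'.cont).intervalIntegrable (-R) R)).abs
  have h1 := H.close R hR h hh
  have h2 := H'.close R hR h hh
  have h3 : ∫ x in -R..R, |w x - z x| ≤ ∫ x in -R..R, (|w x - (u (x + h) - u x) / h| +
      |z x - (v (x + h) - v x) / h| + 2 * e / h) := by
    refine intervalIntegral.integral_mono_on (by linarith) (hw.sub hz).abs
      ((i1.add i2).add (by simp)) fun x hx => ?_
    have e1 := huv x ⟨hx.1, by linarith [hx.2]⟩
    have e2 := huv (x + h) ⟨by linarith [hx.1], by linarith [hx.2]⟩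
    have e3 : |(u (x + h) - u x) / h - (v (x + h) - v x) / h| ≤ 2 * e / h := by
      rw [← sub_div, abs_div, abs_of_pos hh]
      gcongr
      rw [_root_.abs_le] at e1 e2 ⊢
      constructor <;> linarith
    have e4 : w x - z x = (w x - (u (x + h) - u x) / h) - (z x - (v (x + h) - v x) / h) +
      ((u (x + h) - u x) / h - (v (x + h) - v x) / h) := by ring
    rw [e4]
    exact (abs_add_le _ _).trans (add_le_add (abs_sub _ _) e3)
  rw [intervalIntegral.integral_add (i1.add i2) (by simp), intervalIntegral.integral_add i1 i2]
    at h3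
  have h4 : ∫ x in -R..R, 2 * e / h = 4 * R * e / h := by
    rw [intervalIntegral.integral_const, smul_eq_mul]; ring
  rw [h4] at h3
  linarith

lemma exists_subseq_tendstoUniformlyOn {U : ℕ → C(ℝ × ℝ, ℝ)} {L : NNReal} {g : ℝ × ℝ → ℝ}
    (hL : ∀ k, LipschitzWith L (U k)) (hg : ∀ k p, |U k p| ≤ g p) :
    ∃ ψ : ℕ → ℕ, StrictMono ψ ∧ ∃ U' : C(ℝ × ℝ, ℝ), LipschitzWith L U' ∧
      ∀ K : Set (ℝ × ℝ), IsCompact K → TendstoUniformlyOn (fun j p => U (ψ j) p) U' atTop K := by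
  set S : Set C(ℝ × ℝ, ℝ) := {f | LipschitzWith L f ∧ ∀ p, |f p| ≤ g p} with hS
  have himg : ContinuousMap.toFun '' S =
      {f : ℝ × ℝ → ℝ | LipschitzWith L f} ∩ univ.pi fun p => Icc (-g p) (g p) := by
    ext f
    constructor
    · rintro ⟨f, ⟨h1, h2⟩, rfl⟩
      exact ⟨h1, fun p _ => abs_le.1 (h2 p)⟩
    · rintro ⟨h1, h2⟩
      exact ⟨⟨f, h1.continuous⟩, ⟨h1, fun p => abs_le.2 (h2 p (mem_univ _))⟩, rfl⟩
  have hcomp : IsCompact S := by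
    refine ArzelaAscoli.isCompact_of_equicontinuous S ?_ ?_
    · rw [himg]
      exact (isCompact_univ_pi fun p => isCompact_Icc).inter_left (isClosed_setOfPred_lipschitzWith L)
    · exact (LipschitzWith.uniformEquicontinuous (fun f : S => ((f : C(ℝ × ℝ, ℝ)) : ℝ × ℝ → ℝ)) L
        fun f => f.2.1).equicontinuous
  obtain ⟨U', hU', ψ, hψ, hlim⟩ := hcomp.tendsto_subseq (x := U) fun k => ⟨hL k, hg k⟩
  exact ⟨ψ, hψ, U', hU'.1, ContinuousMap.tendsto_iff_forall_isCompact_tendstoUniformlyOn.1 hlim⟩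

lemma DiffQuotClose.setIntegral_sub_le {B R δ : ℝ} {u v w z : ℝ → ℝ} (H : DiffQuotClose B u w)
    (H' : DiffQuotClose B v z) (hB : 0 ≤ B) (hR : 0 ≤ R) (hδ : 0 < δ) {K : Set ℝ}
    (hK : K ⊆ Icc (-R) R)
    (huv : ∀ x ∈ Icc (-R) (R + 1),
      |u x - v x| ≤ δ * min 1 (δ / (4 * (B + 1))) / (8 * (R + 1))) :
    ∫ x in K, |w x - z x| ≤ δ := by
  set h := min 1 (δ / (4 * (B + 1))) with hh
  have hh0 : 0 < h := lt_min one_pos (by positivity)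
  have h1 := H.integral_sub_le H' hR hh0 (min_le_left _ _) huv
  obtain ⟨N, hN⟩ := H.bdd
  obtain ⟨N', hN'⟩ := H'.bdd
  have hi : IntegrableOn (fun x => |w x - z x|) (Icc (-R) R) :=
    ((intervalIntegrable_iff_integrableOn_Icc_of_le (by linarith)).1
      ((intervalIntegrable_of_abs_le H.meas hN (-R) R).sub
        (intervalIntegrable_of_abs_le H'.meas hN' (-R) R))).abs
  have h2 : ∫ x in K, |w x - z x| ≤ ∫ x in Icc (-R) R, |w x - z x| :=
    setIntegral_mono_set hi (Eventually.of_forall fun x => abs_nonneg _) hK.eventuallyLE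
  rw [integral_Icc_eq_integral_Ioc, ← intervalIntegral.integral_of_le (by linarith)] at h2
  have h3 : 2 * B * h ≤ δ / 2 := by
    have : h ≤ δ / (4 * (B + 1)) := min_le_right _ _
    rw [le_div_iff₀ (by positivity)] at this
    nlinarith
  have h4 : 4 * R * (δ * h / (8 * (R + 1))) / h ≤ δ / 2 := by
    rw [div_le_iff₀ hh0, ← mul_div_assoc, div_le_iff₀ (by positivity)]
    nlinarith [mul_pos hδ hh0]
  linarith

lemma exists_subseq_of_equibounded_variation {T M B C : ℝ} (hT : 0 < T) (hB : 0 ≤ B)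
    {W : ℕ → ℝ → ℝ → ℝ} (hc : ∀ k, ∀ t ∈ Icc 0 T, Continuous (W k t))
    (hM : ∀ k, ∀ t ∈ Icc 0 T, ∀ x, |W k t x| ≤ M)
    (hV : ∀ k, ∀ t ∈ Icc 0 T, eVariationOn (W k t) univ ≤ ENNReal.ofReal B)
    (hC : ∀ k, ∀ s ∈ Icc 0 T, ∀ t ∈ Icc 0 T, ∀ c d,
      |(∫ x in c..d, W k t x) - ∫ x in c..d, W k s x| ≤ C * |t - s|) :
    ∃ ψ : ℕ → ℕ, StrictMono ψ ∧
      ∃ Wstar : ℝ → ℝ → ℝ,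
        Measurable (uncurry Wstar) ∧
        (∀ s ∈ Icc (0:ℝ) T, ∀ K : Set ℝ, IsCompact K →
          Tendsto (fun t => ∫ x in K, |Wstar t x - Wstar s x|)
            (nhdsWithin s (Icc (0:ℝ) T)) (nhds 0)) ∧
        (∀ K : Set ℝ, IsCompact K → ∀ δ : ℝ, 0 < δ →
          ∃ N : ℕ, ∀ j ≥ N, ∀ t ∈ Icc (0:ℝ) T,
            (∫ x in K, |W (ψ j) t x - Wstar t x|) ≤ δ) := by
  have hcl : ∀ t, clampIcc T t ∈ Icc 0 T := clampIcc_mem hT.le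
  have hM0 : 0 ≤ M := (abs_nonneg _).trans (hM 0 0 ⟨le_rfl, hT.le⟩ 0)
  have hC0 : 0 ≤ C := by
    have := (abs_nonneg _).trans (hC 0 0 ⟨le_rfl, hT.le⟩ T ⟨hT.le, le_rfl⟩ 0 0)
    rw [sub_zero, abs_of_pos hT] at this
    exact nonneg_of_mul_nonneg_left this hT
  have hUx : ∀ k t x y, |(∫ z in 0..x, W k (clampIcc T t) z) - ∫ z in 0..y, W k (clampIcc T t) z| ≤
      M * |x - y| := by
    intro k t x y
    rw [intervalIntegral.integral_interval_sub_left ((hc k _ (hcl t)).intervalIntegrable _ _)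
      ((hc k _ (hcl t)).intervalIntegrable _ _)]
    exact intervalIntegral.norm_integral_le_of_norm_le_const (f := W k (clampIcc T t))
      fun z _ => hM k _ (hcl t) z
  have hUt : ∀ k s t x, |(∫ z in 0..x, W k (clampIcc T t) z) - ∫ z in 0..x, W k (clampIcc T s) z| ≤
      C * |t - s| := fun k s t x => (hC k _ (hcl s) _ (hcl t) 0 x).trans
    (mul_le_mul_of_nonneg_left (by simpa [abs_sub_comm] using abs_clampIcc_sub_le T t s) hC0)
  have hlip : ∀ k, LipschitzWith (C + M).toNNReal
      fun p : ℝ × ℝ => ∫ z in 0..p.2, W k (clampIcc T p.1) z := by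
    intro k
    refine LipschitzWith.of_dist_le_mul fun p r => ?_
    rw [Real.coe_toNNReal _ (by positivity), Real.dist_eq, add_mul]
    have h1 := hUt k r.1 p.1 p.2
    have h2 := hUx k r.1 p.2 r.2
    have h3 : |p.1 - r.1| ≤ dist p r := le_max_left _ _
    have h4 : |p.2 - r.2| ≤ dist p r := le_max_right _ _
    exact (abs_sub_le _ _ _).trans (add_le_add
      (h1.trans (mul_le_mul_of_nonneg_left h3 hC0)) (h2.trans (mul_le_mul_of_nonneg_left h4 hM0)))
  obtain ⟨ψ, hψ, U, hU, hlim⟩ := exists_subseq_tendstoUniformlyOn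
    (U := fun k => ⟨fun p : ℝ × ℝ => ∫ z in 0..p.2, W k (clampIcc T p.1) z, (hlip k).continuous⟩)
    (g := fun p => M * |p.2|) hlip fun k p => by simpa using hUx k p.1 p.2 0
  simp only [ContinuousMap.coe_mk] at hlim
  have hpt : ∀ p : ℝ × ℝ, Tendsto (fun j => ∫ z in 0..p.2, W (ψ j) (clampIcc T p.1) z) atTop
      (nhds (U p)) := fun p =>
    (hlim {p} isCompact_singleton).tendsto_at (mem_singleton p)
  have hclose : ∀ k, ∀ t ∈ Icc 0 T,
      DiffQuotClose B (fun x => ∫ z in 0..x, W k t z) (W k t) := fun k t ht =>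
    diffQuotClose_primitive (hc k t ht) (hM k t ht) hB (hV k t ht)
  have hcloseU : ∀ t ∈ Icc 0 T,
      DiffQuotClose B (fun x => U (t, x)) (deriv fun x => U (t, x)) := fun t ht => by
    refine diffQuotClose_deriv_of_tendsto (N := M) (fun j => hclose (ψ j) t ht) (fun j x y => ?_)
      fun x => ?_
    · simpa [clampIcc_of_mem ht] using hUx (ψ j) t x y
    · simpa [clampIcc_of_mem ht] using hpt (t, x)
  have hball : ∀ K : Set ℝ, IsCompact K → ∃ R, 0 ≤ R ∧ K ⊆ Icc (-R) R := fun K hK => by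
    obtain ⟨R, hR, hKR⟩ := hK.isBounded.subset_closedBall_lt 0 0
    refine ⟨R, hR.le, ?_⟩
    simpa [Real.closedBall_eq_Icc] using hKR
  refine ⟨ψ, hψ, fun t x => deriv (fun y => U (t, y)) x, ?_, ?_, ?_⟩
  · exact measurable_deriv_with_param (f := fun t x => U (t, x)) U.continuous
  · intro s hs K hK
    obtain ⟨R, hR, hKR⟩ := hball K hK
    rw [Metric.tendsto_nhdsWithin_nhds]
    intro δ hδ
    set e := δ / 2 * min 1 (δ / 2 / (4 * (B + 1))) / (8 * (R + 1)) with he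
    have he0 : 0 < e := by
      have : 0 < min 1 (δ / 2 / (4 * (B + 1))) := lt_min one_pos (by positivity)
      positivity
    refine ⟨e / (C + M + 1), by positivity, fun t ht hts => ?_⟩
    have h1 := (hcloseU t ht).setIntegral_sub_le (hcloseU s hs) hB hR (half_pos hδ) hKR
      fun x _ => by
        have h2 := hU.dist_le_mul (t, x) (s, x)
        rw [Real.coe_toNNReal _ (by positivity), Real.dist_eq] at h2
        have h3 : dist ((t, x) : ℝ × ℝ) (s, x) = dist t s := by simp [Prod.dist_eq]
        rw [h3] at h2
        rw [lt_div_iff₀ (by positivity)] at hts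
        refine h2.trans ?_
        nlinarith [dist_nonneg (x := t) (y := s)]
    rw [Real.dist_eq, sub_zero, abs_of_nonneg (integral_nonneg fun x => abs_nonneg _)]
    linarith
  · intro K hK δ hδ
    obtain ⟨R, hR, hKR⟩ := hball K hK
    have he0 : 0 < δ * min 1 (δ / (4 * (B + 1))) / (8 * (R + 1)) := by
      have : 0 < min 1 (δ / (4 * (B + 1))) := lt_min one_pos (by positivity)
      positivity
    obtain ⟨N, hN⟩ := eventually_atTop.1 (Metric.tendstoUniformlyOn_iff.1
      (hlim (Icc 0 T ×ˢ Icc (-R) (R + 1)) (isCompact_Icc.prod isCompact_Icc)) _ he0)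
    refine ⟨N, fun j hj t ht => (hclose (ψ j) t ht).setIntegral_sub_le (hcloseU t ht) hB hR hδ hKR
      fun x hx => ?_⟩
    have h := hN j hj (t, x) ⟨ht, hx⟩
    rw [dist_comm, Real.dist_eq] at h
    simpa [clampIcc_of_mem ht] using h.le

lemma nonlocalTerm_expKernel {η : ℝ} (hη : 0 < η) (q : ℝ → ℝ → ℝ) (t x : ℝ) :
    nonlocalTerm (expKernel η) q t x = expAvg η (fun y => |q t y|) x :=
  (expAvg_eq_integral_Iic hη _ x).symm

lemma exists_isLagrangian {T η : ℝ} {V q₀ : ℝ → ℝ} {q : ℝ → ℝ → ℝ} (hT : 0 < T) (hη : 0 < η)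
    (hV : LocallyLipschitz V) (hVmono : Monotone V) (hq₀ : Measurable q₀)
    (hq₀bdd : ∃ M : ℝ, ∀ x, |q₀ x| ≤ M) (hq : InSolutionClass T q)
    (hw : IsWeakSolutionNonlocal T V (expKernel η) q₀ q) :
    ∃ M X, IsLagrangian T η M V (fun x => |q₀ x|) (fun t x => |q t x|) X := by
  obtain ⟨M₁, hM₁⟩ := hq₀bdd
  obtain ⟨M₂, hM₂⟩ := hq.bdd
  set M := max M₁ M₂
  have hq₀M : ∀ x, |q₀ x| ≤ M := fun x => (hM₁ x).trans (le_max_left _ _)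
  have hM : ∀ t x, |q t x| ≤ M := fun t x => (hM₂ t x).trans (le_max_right _ _)
  have hmeas : ∀ t, Measurable fun x => |q t x| := fun t =>
    (hq.meas.comp measurable_prodMk_left : Measurable (q t)).norm
  have hM' : ∀ t x, |(|q t x|)| ≤ M := fun t x => by rw [abs_abs]; exact hM t x
  have hav : ∀ t x, |expAvg η (fun y => |q t y|) x| ≤ M := fun t =>
    abs_expAvg_le (hmeas t) (hM' t) η
  obtain ⟨K, hK⟩ := LocallyLipschitzOn.exists_lipschitzOnWith_of_compact
    (isCompact_Icc (a := -M) (b := M)) (hV.locallyLipschitzOn (s := Icc (-M) M))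
  set v : ℝ → ℝ → ℝ := fun t x => V (expAvg η (fun y => |q (clampIcc T t) y|) x) with hv
  have hB : ∀ t x, |v t x| ≤ max |V (-M)| |V M| := fun t x =>
    abs_le_of_monotone hVmono (hav _ x)
  have hvK : ∀ t, LipschitzWith (K * (2 * M / η).toNNReal) (v t) := fun t =>
    lipschitzOnWith_univ.1 (hK.comp
      (lipschitzWith_expAvg hη (hmeas (clampIcc T t)) (hM' (clampIcc T t))).lipschitzOnWith
      fun x _ => abs_le.1 (hav _ x))
  have hc : ∀ x, Continuous fun t => v t x := fun x =>
    hV.continuous.comp <| continuous_iff_continuousAt.2 fun t =>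
      (tendsto_expAvg_abs hη hq hM (clampIcc_mem hT.le t) x).comp
        (tendsto_nhdsWithin_iff.2 ⟨(continuous_clampIcc T).continuousAt,
          Eventually.of_forall (clampIcc_mem hT.le)⟩)
  obtain ⟨X, hX⟩ := exists_isFlow hT hB hvK hc
  have hwt : IsWeakTransport T v q₀ q := fun φ hφ => by
    refine Eq.trans ?_ (hw φ hφ)
    congr 1
    refine setIntegral_congr_fun measurableSet_Ioo fun t ht => ?_
    simp only [hv, clampIcc_of_mem (Ioo_subset_Icc_self ht), nonlocalTerm_expKernel hη]
  refine ⟨M, X, hT, hη, hV.continuous, hVmono, hmeas, fun t x => abs_nonneg _, hM, hq₀.norm,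
    fun x => abs_nonneg _, hq₀M, hX, fun t ht k => ?_⟩
  have hqt : Measurable (q t) := hq.meas.comp measurable_prodMk_left
  exact integral_mul_abs_comp hqt hq₀ (hX.mono t ht) (hX.surj t ht)
    (map_withDensity_abs_eq hqt hq₀ (hM t) hq₀M (hX.mono t ht) (hX.surj t ht) fun a b hab =>
      integral_flow_eq hT hq hM hq₀ hq₀M hB hvK hc hX hwt hab ht) k

/-- Lemma 4.1, compactness of the nonlocal terms in
`C([0,T]; L¹_loc(ℝ))`, exponential kernel. -/
theorem nonlocal_term_compactness
    (T : ℝ) (hT : 0 < T)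
    (V : ℝ → ℝ) (hV : LocallyLipschitz V) (hVmono : Monotone V)
    (q₀ : ℝ → ℝ) (hq₀meas : Measurable q₀) (hq₀bdd : ∃ M : ℝ, ∀ x, |q₀ x| ≤ M)
    (hq₀BV : BoundedVariationOn q₀ univ)
    (q : ℝ → ℝ → ℝ → ℝ)
    (hq : ∀ η : ℝ, 0 < η →
      InSolutionClass T (q η) ∧ IsWeakSolutionNonlocal T V (expKernel η) q₀ (q η)) :
    ∃ ε : ℝ, 0 < ε ∧
      ∀ ηk : ℕ → ℝ, (∀ k, ηk k ∈ Ioo (0:ℝ) ε) →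
        ∃ ψ : ℕ → ℕ, StrictMono ψ ∧
          ∃ Wstar : ℝ → ℝ → ℝ,
            Measurable (uncurry Wstar) ∧
            (∀ s ∈ Icc (0:ℝ) T, ∀ K : Set ℝ, IsCompact K →
              Tendsto (fun t => ∫ x in K, |Wstar t x - Wstar s x|)
                (nhdsWithin s (Icc (0:ℝ) T)) (nhds 0)) ∧
            (∀ K : Set ℝ, IsCompact K → ∀ δ : ℝ, 0 < δ →
              ∃ N : ℕ, ∀ j ≥ N, ∀ t ∈ Icc (0:ℝ) T,
                (∫ x in K,
                  |nonlocalTerm (expKernel (ηk (ψ j))) (q (ηk (ψ j))) t x - Wstar t x|)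
                  ≤ δ) := by
  refine ⟨1, one_pos, fun ηk hηk => ?_⟩
  have hBV : eVariationOn (fun x => |q₀ x|) univ ≤
      ENNReal.ofReal (eVariationOn q₀ univ).toReal := by
    rw [ENNReal.ofReal_toReal hq₀BV]
    simpa [comp_def] using (lipschitzWith_one_norm (E := ℝ)).lipschitzOnWith (s := univ)
      |>.comp_eVariationOn_le (mapsTo_univ q₀ univ)
  have hL := fun k => exists_isLagrangian hT (hηk k).1 hV hVmono hq₀meas hq₀bdd
    (hq _ (hηk k).1).1 (hq _ (hηk k).1).2
  choose M X hL using hL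
  obtain ⟨M₀, hM₀⟩ := hq₀bdd
  choose K hK using fun k => LocallyLipschitzOn.exists_lipschitzOnWith_of_compact
    (isCompact_Icc (a := 0) (b := M k)) (hV.locallyLipschitzOn (s := Icc 0 (M k)))
  obtain ⟨ψ, hψ, Wstar, h1, h2, h3⟩ := exists_subseq_of_equibounded_variation hT
    (ENNReal.toReal_nonneg (a := eVariationOn q₀ univ))
    (W := fun k t x => expAvg (ηk k) (fun y => |q (ηk k) t y|) x)
    (fun k t _ => (hL k).continuous_expAvg t)
    (fun k t ht x => by
      rw [abs_of_nonneg ((hL k).expAvg_mem t x).1]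
      exact (hL k).expAvg_le (hK k) hM₀ ht x)
    (fun k t ht => (hL k).eVariationOn_le (hK k) ENNReal.toReal_nonneg hBV ht)
    (fun k s hs t ht c d => (hL k).abs_intervalIntegral_expAvg_sub_le (hK k) hM₀ hs ht c d)
  refine ⟨ψ, hψ, Wstar, h1, h2, fun C hC δ hδ => ?_⟩
  obtain ⟨N, hN⟩ := h3 C hC δ hδ
  refine ⟨N, fun j hj t ht => ?_⟩
  simpa only [nonlocalTerm_expKernel (hηk _).1] using hN j hj t ht

end
end

section
/- (Entropy dissipation identity for strong nonlocal solutions.) Let T > 0, η > 0, let V ∈ C¹(ℝ) be nondecreasing, and let q ∈ W^{1,∞}(Ω_T) be a strong solution of the nonlocal conservation law ∂_t q + ∂_x(V(W)q) = 0 with exponential kernel γ_η, where W := W[q,γ_η] and q₀ := q(0,·). Then for every α ∈ C²(ℝ), every β ∈ C¹(ℝ) with β' = α'·f' where f(x) := x·V(|x|), and every φ ∈ C¹_c([0,T)×ℝ): ℰ[φ,α,q] = ∬_{Ω_T} α''(q) ∂_x q (V(|q|) − V(W)) q φ dx dt + ∬_{Ω_T} α'(q)(V(|q|) − V(W)) q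 ∂_xφ dx dt, where all partial derivatives of q are understood almost everywhere. -/
open MeasureTheory Set Filter Function

noncomputable section

theorem LocallyLipschitz.mul_real {X : Type*} [PseudoEMetricSpace X] {f g : X → ℝ}
    (hf : LocallyLipschitz f) (hg : LocallyLipschitz g) :
    LocallyLipschitz (fun x => f x * g x) :=
  (contDiff_mul (𝕜 := ℝ) (𝔸 := ℝ) (n := 1)).locallyLipschitz.comp (hf.prodMk hg)

theorem LocallyLipschitz.add_real {X : Type*} [PseudoEMetricSpace X] {f g : X → ℝ}
    (hf : LocallyLipschitz f) (hg : LocallyLipschitz g) :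
    LocallyLipschitz (fun x => f x + g x) :=
  (contDiff_add (𝕜 := ℝ) (F := ℝ) (n := 1)).locallyLipschitz.comp (hf.prodMk hg)

theorem LocallyLipschitz.sub_real {X : Type*} [PseudoEMetricSpace X] {f g : X → ℝ}
    (hf : LocallyLipschitz f) (hg : LocallyLipschitz g) :
    LocallyLipschitz (fun x => f x - g x) :=
  ((contDiff_fst (𝕜 := ℝ) (E := ℝ) (F := ℝ) (n := 1)).sub contDiff_snd).locallyLipschitz.comp
    (hf.prodMk hg)

/-- The fundamental theorem of calculus for locally Lipschitz functions. -/
theorem LocallyLipschitz.integral_deriv_eq_sub {f : ℝ → ℝ} (hf : LocallyLipschitz f) (a b : ℝ) :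
    ∫ x in a..b, deriv f x = f b - f a := by
  obtain ⟨K, hK⟩ :=
    (hf.locallyLipschitzOn (s := uIcc a b)).exists_lipschitzOnWith_of_compact isCompact_uIcc
  exact hK.absolutelyContinuousOnInterval.integral_deriv_eq_sub

theorem LocallyLipschitz.integral_deriv_eq_zero {f : ℝ → ℝ} (hf : LocallyLipschitz f)
    (hc : HasCompactSupport f) : ∫ x, deriv f x = 0 := by
  obtain ⟨R, hR⟩ := hc.isCompact.isBounded.subset_ball 0
  rw [Real.ball_eq_Ioo] at hR
  have hout : ∀ x, x ∉ Ioo (0 - R) (0 + R) → f x = 0 := fun x hx =>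
    image_eq_zero_of_notMem_tsupport fun h => hx (hR h)
  rw [← intervalIntegral.integral_eq_integral_of_support_subset
    ((support_deriv_subset.trans hR).trans Ioo_subset_Ioc_self), hf.integral_deriv_eq_sub,
    hout _ (by simp), hout _ (by simp), sub_zero]

theorem DifferentiableAt.uncurry_left {f : ℝ → ℝ → ℝ} {p : ℝ × ℝ}
    (hf : DifferentiableAt ℝ (uncurry f) p) : DifferentiableAt ℝ (fun s => f s p.2) p.1 :=
  DifferentiableAt.comp (g := uncurry f) (f := fun s => (s, p.2)) p.1 hf
    (differentiableAt_id.prodMk (differentiableAt_const p.2))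

theorem DifferentiableAt.uncurry_right {f : ℝ → ℝ → ℝ} {p : ℝ × ℝ}
    (hf : DifferentiableAt ℝ (uncurry f) p) : DifferentiableAt ℝ (fun y => f p.1 y) p.2 :=
  DifferentiableAt.comp (g := uncurry f) (f := fun y => (p.1, y)) p.2 hf
    ((differentiableAt_const p.1).prodMk differentiableAt_id)

theorem deriv_uncurry_left {f : ℝ → ℝ → ℝ} {p : ℝ × ℝ}
    (hf : DifferentiableAt ℝ (uncurry f) p) :
    deriv (fun s => f s p.2) p.1 = fderiv ℝ (uncurry f) p (1, 0) :=
  (HasFDerivAt.comp_hasDerivAt (l := uncurry f) p.1 hf.hasFDerivAt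
    ((hasDerivAt_id p.1).prodMk (hasDerivAt_const p.1 p.2))).deriv

theorem deriv_uncurry_right {f : ℝ → ℝ → ℝ} {p : ℝ × ℝ}
    (hf : DifferentiableAt ℝ (uncurry f) p) :
    deriv (fun y => f p.1 y) p.2 = fderiv ℝ (uncurry f) p (0, 1) :=
  (HasFDerivAt.comp_hasDerivAt (l := uncurry f) p.2 hf.hasFDerivAt
    ((hasDerivAt_const p.2 p.1).prodMk (hasDerivAt_id p.2))).deriv

theorem HasCompactSupport.slice_right {f : ℝ → ℝ → ℝ} (hf : HasCompactSupport (uncurry f)) (t : ℝ) :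
    HasCompactSupport (fun x => f t x) := by
  refine HasCompactSupport.of_support_subset_isCompact (hf.isCompact.image continuous_snd) ?_
  exact fun x hx => ⟨(t, x), subset_tsupport _ hx, rfl⟩

theorem IsTestFun.deriv_left_eq {T : ℝ} {φ : ℝ → ℝ → ℝ} (hφ : IsTestFun T φ) :
    (fun p : ℝ × ℝ => deriv (fun s => φ s p.2) p.1) = fun p => fderiv ℝ (uncurry φ) p (1, 0) :=
  funext fun p => deriv_uncurry_left (hφ.smooth.differentiable one_ne_zero p)

theorem IsTestFun.continuous_deriv_left {T : ℝ} {φ : ℝ → ℝ → ℝ} (hφ : IsTestFun T φ) :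
    Continuous (fun p : ℝ × ℝ => deriv (fun s => φ s p.2) p.1) :=
  hφ.deriv_left_eq ▸ (hφ.smooth.continuous_fderiv one_ne_zero).clm_apply continuous_const

theorem IsTestFun.hasCompactSupport_deriv_left {T : ℝ} {φ : ℝ → ℝ → ℝ} (hφ : IsTestFun T φ) :
    HasCompactSupport (fun p : ℝ × ℝ => deriv (fun s => φ s p.2) p.1) :=
  hφ.deriv_left_eq ▸ hφ.compSupp.fderiv_apply (𝕜 := ℝ) (1, 0)

theorem IsTestFun.deriv_right_eq {T : ℝ} {φ : ℝ → ℝ → ℝ} (hφ : IsTestFun T φ) :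
    (fun p : ℝ × ℝ => deriv (fun y => φ p.1 y) p.2) = fun p => fderiv ℝ (uncurry φ) p (0, 1) :=
  funext fun p => deriv_uncurry_right (hφ.smooth.differentiable one_ne_zero p)

theorem IsTestFun.continuous_deriv_right {T : ℝ} {φ : ℝ → ℝ → ℝ} (hφ : IsTestFun T φ) :
    Continuous (fun p : ℝ × ℝ => deriv (fun y => φ p.1 y) p.2) :=
  hφ.deriv_right_eq ▸ (hφ.smooth.continuous_fderiv one_ne_zero).clm_apply continuous_const

theorem IsTestFun.hasCompactSupport_deriv_right {T : ℝ} {φ : ℝ → ℝ → ℝ} (hφ : IsTestFun T φ) :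
    HasCompactSupport (fun p : ℝ × ℝ => deriv (fun y => φ p.1 y) p.2) :=
  hφ.deriv_right_eq ▸ hφ.compSupp.fderiv_apply (𝕜 := ℝ) (0, 1)

theorem differentiable_mul_comp_abs {V : ℝ → ℝ} (hV : ContDiff ℝ 1 V) :
    Differentiable ℝ (fun y : ℝ => y * V |y|) := by
  intro y
  rcases eq_or_ne y 0 with rfl | hy
  · have h : HasDerivAt (fun y : ℝ => y * V |y|) (V |0|) 0 := by
      rw [hasDerivAt_iff_tendsto_slope_zero]
      have hc : Tendsto (fun t : ℝ => V |t|) (nhdsWithin 0 {0}ᶜ) (nhds (V |0|)) :=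
        ((hV.continuous.comp continuous_abs).tendsto 0).mono_left nhdsWithin_le_nhds
      refine hc.congr' ?_
      filter_upwards [self_mem_nhdsWithin] with t ht
      have ht' : t ≠ 0 := ht
      simp [ht']
    exact h.differentiableAt
  · exact differentiableAt_id.mul
      (DifferentiableAt.comp (g := V) y (hV.differentiable one_ne_zero _) (differentiableAt_abs hy))

theorem locallyLipschitz_mul_comp_abs {V : ℝ → ℝ} (hV : ContDiff ℝ 1 V) :
    LocallyLipschitz (fun y : ℝ => y * V |y|) :=
  LocallyLipschitz.id.mul_real (hV.locallyLipschitz.comp lipschitzWith_one_norm.locallyLipschitz)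

theorem Continuous.integrable_mul_of_bounded {g h : ℝ × ℝ → ℝ} (hg : Continuous g)
    (hc : HasCompactSupport g) (hh : Measurable h) {C : ℝ} (hC : ∀ p, ‖h p‖ ≤ C) :
    Integrable (fun p => g p * h p) :=
  (hg.integrable_of_hasCompactSupport hc).mul_bdd hh.aestronglyMeasurable (.of_forall hC)

theorem nonlocalTerm_eq_integral_Iic_zero (γ : ℝ → ℝ) (q : ℝ → ℝ → ℝ) (t x : ℝ) :
    nonlocalTerm γ q t x = ∫ z in Iic (0 : ℝ), γ z * |q t (z + x)| := by
  have h := (measurePreserving_add_right (volume : Measure ℝ) x).setIntegral_preimage_emb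
    (measurableEmbedding_addRight x) (fun y => γ (y - x) * |q t y|) (Iic x)
  simpa [nonlocalTerm] using h.symm

theorem integrableOn_expKernel {η : ℝ} (hη : 0 < η) : IntegrableOn (expKernel η) (Iic 0) := by
  have h := (integrableOn_exp_mul_Iic (inv_pos.2 hη) 0).div_const η
  refine h.congr (.of_forall fun x => ?_)
  simp only [expKernel]
  congr 2
  field_simp

theorem integral_expKernel {η : ℝ} (hη : 0 < η) : ∫ z in Iic (0 : ℝ), expKernel η z = 1 := by
  have h := integral_exp_mul_Iic (inv_pos.2 hη) 0
  have h2 : ∀ z, expKernel η z = Real.exp (η⁻¹ * z) / η := fun z => by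
    simp only [expKernel]; congr 2; field_simp
  simp only [h2, integral_div, h]
  simp [hη.ne']

theorem expKernel_nonneg {η : ℝ} (hη : 0 < η) (z : ℝ) : 0 ≤ expKernel η z :=
  div_nonneg (Real.exp_pos _).le hη.le

theorem continuous_expKernel (η : ℝ) : Continuous (expKernel η) := by
  unfold expKernel; fun_prop

theorem integrableOn_expKernel_mul_abs {η : ℝ} (hη : 0 < η) :
    IntegrableOn (fun z => expKernel η z * |z|) (Iic 0) := by
  have h := (integrableOn_exp_mul_Iic (inv_pos.2 (mul_pos two_pos hη)) 0).const_mul 2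
  refine h.mono' ((continuous_expKernel η).mul continuous_abs).aestronglyMeasurable ?_
  filter_upwards [ae_restrict_mem measurableSet_Iic] with z hz
  have hz' : z ≤ 0 := hz
  rw [Real.norm_of_nonneg (mul_nonneg (expKernel_nonneg hη z) (abs_nonneg z)), abs_of_nonpos hz']
  have h1 := Real.add_one_le_exp (-z / (2 * η))
  have h2 : -z ≤ 2 * η * Real.exp (-z / (2 * η)) := by
    have h3 : -z / (2 * η) ≤ Real.exp (-z / (2 * η)) := by linarith
    rw [div_le_iff₀ (by positivity)] at h3
    linarith
  calc expKernel η z * -z ≤ expKernel η z * (2 * η * Real.exp (-z / (2 * η))) :=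
        mul_le_mul_of_nonneg_left h2 (expKernel_nonneg hη z)
    _ = 2 * (Real.exp (z / η) * Real.exp (-z / (2 * η))) := by
        unfold expKernel; field_simp
    _ = 2 * Real.exp ((2 * η)⁻¹ * z) := by
        rw [← Real.exp_add]; congr 2; field_simp; ring

theorem integrableOn_expKernel_mul_abs_lipschitz {η : ℝ} (hη : 0 < η) {g : ℝ → ℝ} {L : NNReal}
    (hg : LipschitzWith L g) : IntegrableOn (fun z => expKernel η z * |g z|) (Iic 0) := by
  refine (((integrableOn_expKernel hη).mul_const |g 0|).add
    ((integrableOn_expKernel_mul_abs hη).const_mul L)).mono'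
    ((continuous_expKernel η).mul hg.continuous.abs).aestronglyMeasurable (.of_forall fun z => ?_)
  rw [Real.norm_of_nonneg (mul_nonneg (expKernel_nonneg hη z) (abs_nonneg _))]
  have h1 := hg.dist_le_mul z 0
  rw [Real.dist_eq, Real.dist_eq, sub_zero] at h1
  have h2 : |g z| ≤ |g 0| + L * |z| := by
    have := abs_sub_abs_le_abs_sub (g z) (g 0); linarith
  calc expKernel η z * |g z| ≤ expKernel η z * (|g 0| + L * |z|) :=
        mul_le_mul_of_nonneg_left h2 (expKernel_nonneg hη z)
    _ = _ := by simp only [Pi.add_apply]; ring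

/-- With the exponential kernel, the nonlocal term inherits the Lipschitz constant. -/
theorem lipschitzWith_nonlocalTerm {η : ℝ} (hη : 0 < η) {q : ℝ → ℝ → ℝ} {L : NNReal}
    (hq : LipschitzWith L (uncurry q)) :
    LipschitzWith L (uncurry (nonlocalTerm (expKernel η) q)) := by
  refine LipschitzWith.of_dist_le_mul fun p r => ?_
  have hint : ∀ p : ℝ × ℝ,
      IntegrableOn (fun z => expKernel η z * |q p.1 (z + p.2)|) (Iic 0) := fun p => by
    have hshift : LipschitzWith 1 (fun z : ℝ => (p.1, z + p.2)) :=
      LipschitzWith.of_dist_le_mul fun y z => by simp [Prod.dist_eq]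
    exact integrableOn_expKernel_mul_abs_lipschitz hη (hq.comp hshift)
  simp only [uncurry, nonlocalTerm_eq_integral_Iic_zero]
  rw [Real.dist_eq, ← integral_sub (hint p) (hint r)]
  have hbound : ∀ z, ‖expKernel η z * |q p.1 (z + p.2)| - expKernel η z * |q r.1 (z + r.2)|‖
      ≤ expKernel η z * (L * dist p r) := fun z => by
    rw [← mul_sub, norm_mul, Real.norm_of_nonneg (expKernel_nonneg hη z)]
    refine mul_le_mul_of_nonneg_left ?_ (expKernel_nonneg hη z)
    refine (abs_abs_sub_abs_le_abs_sub _ _).trans ?_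
    have h := hq.dist_le_mul (p.1, z + p.2) (r.1, z + r.2)
    simpa [uncurry, Real.dist_eq, Prod.dist_eq] using h
  calc _ ≤ ∫ z in Iic (0 : ℝ), expKernel η z * (L * dist p r) :=
        norm_integral_le_of_norm_le ((integrableOn_expKernel hη).mul_const _)
          (.of_forall hbound)
    _ = L * dist p r := by rw [integral_mul_const, integral_expKernel hη, one_mul]

theorem deriv_entropy_flux_mul {V α β g w : ℝ → ℝ} (hV : ContDiff ℝ 1 V) (hα : ContDiff ℝ 2 α)
    (hβ : ContDiff ℝ 1 β)
    (hαβ : ∀ x : ℝ, deriv β x = deriv α x * deriv (fun y : ℝ => y * V |y|) x)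
    {ψ : ℝ → ℝ} {x : ℝ} (hg : DifferentiableAt ℝ g x) (hw : DifferentiableAt ℝ w x)
    (hψ : DifferentiableAt ℝ ψ x) :
    deriv (fun y => (β (g y) + deriv α (g y) * (V (w y) * g y - g y * V |g y|)) * ψ y) x =
      deriv α (g x) * deriv (fun y => V (w y) * g y) x * ψ x + β (g x) * deriv ψ x
        - deriv (deriv α) (g x) * deriv g x * (V |g x| - V (w x)) * g x * ψ x
        - deriv α (g x) * (V |g x| - V (w x)) * g x * deriv ψ x := by
  have hVw : HasDerivAt (fun y => V (w y) * g y) (deriv (fun y => V (w y) * g y) x) x :=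
    ((DifferentiableAt.comp (g := V) x (hV.differentiable one_ne_zero _) hw).mul hg).hasDerivAt
  have hf : HasDerivAt (fun y => g y * V |g y|)
      (deriv (fun y : ℝ => y * V |y|) (g x) * deriv g x) x :=
    HasDerivAt.comp x (differentiable_mul_comp_abs hV (g x)).hasDerivAt hg.hasDerivAt
  have hβg : HasDerivAt (fun y => β (g y)) (deriv β (g x) * deriv g x) x :=
    HasDerivAt.comp x (hβ.differentiable one_ne_zero (g x)).hasDerivAt hg.hasDerivAt
  have hα' : HasDerivAt (fun y => deriv α (g y)) (deriv (deriv α) (g x) * deriv g x) x :=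
    HasDerivAt.comp x ((ContDiff.deriv' (n := 1) hα).differentiable one_ne_zero (g x)).hasDerivAt
      hg.hasDerivAt
  have h := ((hβg.add (hα'.mul (hVw.sub hf))).mul hψ.hasDerivAt).deriv
  refine Eq.trans h ?_
  rw [hαβ]
  simp only [Pi.add_apply, Pi.mul_apply, Pi.sub_apply]
  ring

/-- The entropy dissipation identity for `∂ₜ q + ∂ₓ (V(w) q) = 0` with Lipschitz `q` and `w`. -/
theorem entropy_dissipation_of_lipschitz
    {T : ℝ} (hT : 0 < T) {V : ℝ → ℝ} (hV : ContDiff ℝ 1 V) {q w : ℝ → ℝ → ℝ} {L M : NNReal}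
    (hq : LipschitzWith L (uncurry q)) (hw : LipschitzWith M (uncurry w))
    (hpde : ∀ᵐ p : ℝ × ℝ ∂(volume.restrict (Ioo (0:ℝ) T ×ˢ (univ : Set ℝ))),
      deriv (fun s => q s p.2) p.1 + deriv (fun y => V (w p.1 y) * q p.1 y) p.2 = 0)
    {α β : ℝ → ℝ} (hα : ContDiff ℝ 2 α) (hβ : ContDiff ℝ 1 β)
    (hαβ : ∀ x : ℝ, deriv β x = deriv α x * deriv (fun y : ℝ => y * V |y|) x)
    {φ : ℝ → ℝ → ℝ} (hφ : IsTestFun T φ) :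
    entropyE T (fun x => q 0 x) α β φ q =
      (∫ t in Ioo (0:ℝ) T, ∫ x : ℝ,
        deriv (deriv α) (q t x) * deriv (fun y => q t y) x *
          (V |q t x| - V (w t x)) * q t x * φ t x)
      + (∫ t in Ioo (0:ℝ) T, ∫ x : ℝ,
        deriv α (q t x) * (V |q t x| - V (w t x)) * q t x * deriv (fun y => φ t y) x) := by
  have hα' : ContDiff ℝ 1 (deriv α) := ContDiff.deriv' (n := 1) hα
  have hα'' : Continuous (deriv (deriv α)) := hα'.continuous_deriv le_rfl
  have hqc : Continuous fun p : ℝ × ℝ => q p.1 p.2 := hq.continuous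
  have hwc : Continuous fun p : ℝ × ℝ => w p.1 p.2 := hw.continuous
  have hφc : Continuous fun p : ℝ × ℝ => φ p.1 p.2 := hφ.smooth.continuous
  have hφs : HasCompactSupport fun p : ℝ × ℝ => φ p.1 p.2 := hφ.compSupp
  have hVc := hV.continuous
  have hαc := hα.continuous
  have hα'c := hα'.continuous
  have hβc := hβ.continuous
  have hφt := hφ.continuous_deriv_left
  have hφx := hφ.continuous_deriv_right
  have hmeas_x : Measurable fun p : ℝ × ℝ => deriv (fun y => q p.1 y) p.2 :=
    measurable_deriv_with_param hq.continuous
  have hmeas_t : Measurable fun p : ℝ × ℝ => deriv (fun s => q s p.2) p.1 :=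
    (measurable_deriv_with_param (f := fun x s => q s x)
      (hqc.comp continuous_swap)).comp measurable_swap
  have hbound_x : ∀ p : ℝ × ℝ, ‖deriv (fun y => q p.1 y) p.2‖ ≤ L := fun p =>
    norm_deriv_le_of_lipschitz (by simpa using! hq.comp (LipschitzWith.prodMk_left p.1))
  have hbound_t : ∀ p : ℝ × ℝ, ‖deriv (fun s => q s p.2) p.1‖ ≤ L := fun p =>
    norm_deriv_le_of_lipschitz (by simpa using! hq.comp (LipschitzWith.prodMk_right p.2))
  set μ : Measure (ℝ × ℝ) := (volume.restrict (Ioo (0:ℝ) T)).prod volume with hμdef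
  have hμ : volume.restrict (Ioo (0:ℝ) T ×ˢ (univ : Set ℝ)) = μ := by
    rw [hμdef, Measure.volume_eq_prod, ← Measure.prod_restrict, Measure.restrict_univ]
  have hle : μ ≤ volume := hμ ▸ Measure.restrict_le_self
  set A : ℝ × ℝ → ℝ := fun p =>
    α (q p.1 p.2) * deriv (fun s => φ s p.2) p.1 + β (q p.1 p.2) * deriv (fun y => φ p.1 y) p.2
    with hA
  set R₁ : ℝ × ℝ → ℝ := fun p =>
    deriv (deriv α) (q p.1 p.2) * deriv (fun y => q p.1 y) p.2 *
      (V |q p.1 p.2| - V (w p.1 p.2)) * q p.1 p.2 * φ p.1 p.2 with hR₁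
  set R₂ : ℝ × ℝ → ℝ := fun p =>
    deriv α (q p.1 p.2) * (V |q p.1 p.2| - V (w p.1 p.2)) * q p.1 p.2 *
      deriv (fun y => φ p.1 y) p.2 with hR₂
  have hAint : Integrable A μ := by
    refine Integrable.mono_measure ?_ hle
    refine Integrable.add ?_ ?_
    · exact Continuous.integrable_of_hasCompactSupport (by fun_prop)
        hφ.hasCompactSupport_deriv_left.mul_left
    · exact Continuous.integrable_of_hasCompactSupport (by fun_prop)
        hφ.hasCompactSupport_deriv_right.mul_left
  have hR₁int : Integrable R₁ μ := by
    refine Integrable.mono_measure ?_ hle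
    refine (Continuous.integrable_mul_of_bounded (g := fun p =>
      deriv (deriv α) (q p.1 p.2) * (V |q p.1 p.2| - V (w p.1 p.2)) * q p.1 p.2 * φ p.1 p.2)
      (by fun_prop) hφs.mul_left hmeas_x hbound_x).congr (.of_forall fun p => ?_)
    simp only [hR₁]; ring
  have hR₂int : Integrable R₂ μ :=
    Integrable.mono_measure (Continuous.integrable_of_hasCompactSupport (by fun_prop)
      hφ.hasCompactSupport_deriv_right.mul_left) hle
  set F : ℝ → ℝ → ℝ := fun t x => α (q t x) * φ t x with hF
  set G : ℝ → ℝ → ℝ := fun t x =>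
    (β (q t x) + deriv α (q t x) * (V (w t x) * q t x - q t x * V |q t x|)) * φ t x with hG
  have hqL : LocallyLipschitz (uncurry q) := hq.locallyLipschitz
  have hφL : LocallyLipschitz (uncurry φ) := hφ.smooth.locallyLipschitz
  have hFL : LocallyLipschitz (uncurry F) :=
    (hα.of_le one_le_two).locallyLipschitz.comp hqL |>.mul_real hφL
  have hGL : LocallyLipschitz (uncurry G) :=
    ((hβ.locallyLipschitz.comp hqL).add_real ((hα'.locallyLipschitz.comp hqL).mul_real
      (((hV.locallyLipschitz.comp hw.locallyLipschitz).mul_real hqL).sub_real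
        ((locallyLipschitz_mul_comp_abs hV).comp hqL)))).mul_real hφL
  have hdiff : ∀ᵐ p ∂μ, DifferentiableAt ℝ (uncurry q) p ∧ DifferentiableAt ℝ (uncurry w) p :=
    ae_mono hle (hq.ae_differentiableAt.and hw.ae_differentiableAt)
  have hφd : Differentiable ℝ (uncurry φ) := hφ.smooth.differentiable one_ne_zero
  have hFt : ∀ᵐ p ∂μ, deriv (fun s => F s p.2) p.1 =
      deriv α (q p.1 p.2) * φ p.1 p.2 * deriv (fun s => q s p.2) p.1
        + α (q p.1 p.2) * deriv (fun s => φ s p.2) p.1 := by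
    filter_upwards [hdiff] with p hp
    have hαq : HasDerivAt (fun s => α (q s p.2))
        (deriv α (q p.1 p.2) * deriv (fun s => q s p.2) p.1) p.1 :=
      HasDerivAt.comp (h₂ := α) p.1 (hα.differentiable two_ne_zero _).hasDerivAt
        hp.1.uncurry_left.hasDerivAt
    refine (hαq.mul (hφd p).uncurry_left.hasDerivAt).deriv.trans ?_
    ring
  have hFtint : Integrable (fun p : ℝ × ℝ => deriv (fun s => F s p.2) p.1) μ := by
    refine Integrable.congr (Integrable.mono_measure ?_ hle) (hFt.mono fun p hp => hp.symm)
    refine Integrable.add ?_ ?_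
    · exact Continuous.integrable_mul_of_bounded (by fun_prop) hφs.mul_left hmeas_t hbound_t
    · exact Continuous.integrable_of_hasCompactSupport (by fun_prop)
        hφ.hasCompactSupport_deriv_left.mul_left
  have hGx : ∀ᵐ p ∂μ, A p - R₁ p - R₂ p - deriv (fun s => F s p.2) p.1 =
      deriv (fun y => G p.1 y) p.2 := by
    rw [hμ] at hpde
    filter_upwards [hdiff, hpde, hFt] with p hp hpde hFt
    have hflux := deriv_entropy_flux_mul hV hα hβ hαβ hp.1.uncurry_right hp.2.uncurry_right
      (hφd p).uncurry_right
    rw [hFt, eq_neg_of_add_eq_zero_left hpde]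
    refine Eq.trans ?_ hflux.symm
    simp only [hA, hR₁, hR₂]
    ring
  have hGint := ((hAint.sub hR₁int).sub hR₂int).sub hFtint
  have hGzero : ∫ p, deriv (fun y => G p.1 y) p.2 ∂μ = 0 := by
    rw [hμdef, integral_prod _ (hGint.congr hGx)]
    have hslice : ∀ t, ∫ x, deriv (fun y => G t y) x = 0 := fun t =>
      (hGL.comp (LocallyLipschitz.prodMk_left t)).integral_deriv_eq_zero
        (HasCompactSupport.mul_left (hφ.compSupp.slice_right t))
    simp [hslice]
  have hFint : ∫ p, deriv (fun s => F s p.2) p.1 ∂μ = -∫ x, α (q 0 x) * φ 0 x := by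
    rw [hμdef, integral_prod_symm _ hFtint, ← integral_neg]
    refine integral_congr_ae (.of_forall fun x => ?_)
    have h := (hFL.comp (LocallyLipschitz.prodMk_right x)).integral_deriv_eq_sub 0 T
    rw [intervalIntegral.integral_of_le hT.le, integral_Ioc_eq_integral_Ioo] at h
    refine h.trans ?_
    simp [hF, hφ.vanish T x le_rfl]
  have hsum := integral_congr_ae hGx
  rw [hGzero, integral_sub (f := fun p => A p - R₁ p - R₂ p)
      ((hAint.sub hR₁int).sub hR₂int) hFtint,
    integral_sub (f := fun p => A p - R₁ p) (hAint.sub hR₁int) hR₂int,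
    integral_sub hAint hR₁int, hFint, hμdef, integral_prod _ hAint,
    integral_prod _ hR₁int, integral_prod _ hR₂int] at hsum
  unfold entropyE
  linarith

/-- entropy dissipation identity for strong nonlocal
solutions. -/
theorem entropy_dissipation_identity
    (T : ℝ) (hT : 0 < T) (η : ℝ) (hη : 0 < η)
    (V : ℝ → ℝ) (hV : ContDiff ℝ 1 V) (hVmono : Monotone V)
    (q : ℝ → ℝ → ℝ)
    (hq : IsStrongSolutionNonlocal T V (expKernel η) (fun x => q 0 x) q) :
    ∀ α β : ℝ → ℝ, ContDiff ℝ 2 α → ContDiff ℝ 1 β →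
      (∀ x : ℝ, deriv β x = deriv α x * deriv (fun y : ℝ => y * V |y|) x) →
      ∀ φ : ℝ → ℝ → ℝ, IsTestFun T φ →
        entropyE T (fun x => q 0 x) α β φ q =
          (∫ t in Ioo (0:ℝ) T, ∫ x : ℝ,
            deriv (deriv α) (q t x) * deriv (fun y => q t y) x *
              (V |q t x| - V (nonlocalTerm (expKernel η) q t x)) * q t x * φ t x)
          + (∫ t in Ioo (0:ℝ) T, ∫ x : ℝ,
            deriv α (q t x) * (V |q t x| - V (nonlocalTerm (expKernel η) q t x)) *
              q t x * deriv (fun y => φ t y) x) := by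
  intro α β hα hβ hαβ φ hφ
  obtain ⟨⟨L, hL⟩, -, hpde⟩ := hq
  -- extend `q` from `[0, T] × ℝ` to a globally Lipschitz function
  set r : ℝ → ℝ → ℝ := fun t x => q (projIcc 0 T hT.le t) x with hr
  have hrL : LipschitzWith L (uncurry r) := by
    have hproj : LipschitzWith 1 (fun p : ℝ × ℝ => ((projIcc 0 T hT.le p.1 : ℝ), p.2)) := by
      have h₁ : LipschitzWith 1 (fun p : ℝ × ℝ => (projIcc 0 T hT.le p.1 : ℝ)) := by
        simpa using! (LipschitzWith.subtype_val (Icc 0 T)).comp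
          ((LipschitzWith.projIcc hT.le).comp LipschitzWith.prod_fst)
      simpa using h₁.prodMk LipschitzWith.prod_snd
    have h := hL.comp (hproj.lipschitzOnWith (s := univ))
      (fun p _ => ⟨(projIcc 0 T hT.le p.1).2, mem_univ _⟩)
    simpa using! lipschitzOnWith_univ.1 h
  have hrq : ∀ t ∈ Icc 0 T, r t = q t := fun t ht => by
    funext x; simp only [hr, projIcc_of_mem hT.le ht]
  have hrq' : ∀ t ∈ Ioo 0 T, r t = q t := fun t ht => hrq t (Ioo_subset_Icc_self ht)
  have hW : ∀ t ∈ Ioo 0 T, nonlocalTerm (expKernel η) r t = nonlocalTerm (expKernel η) q t :=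
    fun t ht => by funext x; simp only [nonlocalTerm, hrq' t ht]
  have hpde' : ∀ᵐ p : ℝ × ℝ ∂(volume.restrict (Ioo (0:ℝ) T ×ˢ (univ : Set ℝ))),
      deriv (fun s => r s p.2) p.1
        + deriv (fun y => V (nonlocalTerm (expKernel η) r p.1 y) * r p.1 y) p.2 = 0 := by
    filter_upwards [hpde, ae_restrict_mem (measurableSet_Ioo.prod MeasurableSet.univ)]
      with p hp hmem
    have hder : deriv (fun s => r s p.2) p.1 = deriv (fun s => q s p.2) p.1 := by
      refine Filter.EventuallyEq.deriv_eq ?_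
      filter_upwards [isOpen_Ioo.mem_nhds hmem.1] with s hs
      rw [hrq' s hs]
    rw [hder, hW _ hmem.1, hrq' _ hmem.1]
    exact hp
  have key := entropy_dissipation_of_lipschitz hT hV hrL (lipschitzWith_nonlocalTerm hη hrL)
    hpde' hα hβ hαβ hφ
  have hcongr : ∀ {f g : ℝ → ℝ}, (∀ t ∈ Ioo 0 T, f t = g t) →
      ∫ t in Ioo 0 T, f t = ∫ t in Ioo 0 T, g t := fun h =>
    setIntegral_congr_fun measurableSet_Ioo h
  unfold entropyE at key ⊢
  rw [hrq 0 ⟨le_rfl, hT.le⟩] at key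
  convert key using 2
  · exact hcongr fun t ht => by simp only [hrq' t ht]
  · exact hcongr fun t ht => by simp only [hrq' t ht, hW t ht]
  · exact hcongr fun t ht => by simp only [hrq' t ht, hW t ht]

end
end
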